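/- Level-2 phylogenetic networks are reconstructible from their multisets of distances: if N and N' are level-2 networks on the same leaf set X and d^{N}(x,y) = d^{N'}(x,y) (as multisets) for all leaves x, y ∈ X, then N and N' are isomorphic by an isomorphism fixing the leaf labels. -/

import Mathlib

open SimpleGraph

/-- A labelled graph: the raw data of a phylogenetic network on a label set `X`:
a finite vertex type, a simple graph on it, and a labelling map from `X` to vertices. -/
structure LabGraph (X : Type) where
  V : Type
  [fV : Fintype V]
  G : SimpleGraph V
  leaf : X → V

attribute [instance] LabGraph.fV

namespace LabGraph

variable {X : Type} [Fintype X] [DecidableEq X]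

/-- The shortest distance `d_m(x,y)` between the leaves labelled `x` and `y`. -/
noncomputable def dm (N : LabGraph X) (x y : X) : ℕ :=
  N.G.dist (N.leaf x) (N.leaf y)

/-- The multiset `d(x,y)` of the lengths of all paths between the leaves `x` and `y`. -/
noncomputable def dms (N : LabGraph X) (x y : X) : Multiset ℕ := by
  classical
  exact (Finset.univ : Finset (N.G.Path (N.leaf x) (N.leaf y))).val.map fun p => p.1.length

/-- The degree of a vertex. -/
noncomputable def degOf (N : LabGraph X) (v : N.V) : ℕ := (N.G.neighborSet v).ncard

/-- `N` is an (unweighted unrooted binary) phylogenetic network on `X`: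
it is connected, the labelling is injective, and either it is the singleton graph
(when `|X| = 1`), or every leaf-labelled vertex has degree 1 and every other
vertex has degree 3 (so the degree-1 vertices are exactly the labelled leaves). -/
def IsNetwork (N : LabGraph X) : Prop :=
  N.G.Connected ∧ Function.Injective N.leaf ∧
    ((Fintype.card X = 1 ∧ Fintype.card N.V = 1) ∨
      ((∀ x : X, N.degOf (N.leaf x) = 1) ∧
        ∀ v : N.V, v ∉ Set.range N.leaf → N.degOf v = 3))

/-- Two labelled graphs on `X` are isomorphic by a graph isomorphism fixing the leaf labels. -/
def IsomLabelled (N M : LabGraph X) : Prop :=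
  ∃ φ : N.G ≃g M.G, ∀ x : X, φ (N.leaf x) = M.leaf x

/-- A subgraph is 2-connected (with at least three vertices): it is connected and
remains connected after deleting any one of its vertices. -/
def TwoConnSub (N : LabGraph X) (H : N.G.Subgraph) : Prop :=
  3 ≤ H.verts.ncard ∧ H.coe.Connected ∧
    ∀ v ∈ H.verts, (H.deleteVerts {v}).coe.Connected

/-- A blob: a maximal 2-connected subgraph with at least three vertices. -/
def IsBlob (N : LabGraph X) (H : N.G.Subgraph) : Prop :=
  N.TwoConnSub H ∧ ∀ H' : N.G.Subgraph, N.TwoConnSub H' → H ≤ H' → H' = H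

/-- Exactly `r` edges must be deleted from the (connected) subgraph `H` to obtain a
tree: `|E(H)| - |V(H)| + 1 = r`.  A level-1 blob has rank 1, a level-2 blob rank 2. -/
def BlobRank (N : LabGraph X) (H : N.G.Subgraph) (r : ℕ) : Prop :=
  H.edgeSet.ncard + 1 = H.verts.ncard + r

/-- A network is level-`k` if at most `k` edges must be deleted from every blob
to obtain a tree. -/
def IsLevel (N : LabGraph X) (k : ℕ) : Prop :=
  ∀ H : N.G.Subgraph, N.IsBlob H → H.edgeSet.ncard + 1 ≤ H.verts.ncard + k

/-- A cut-edge: an edge whose deletion disconnects the graph. -/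
def IsCutEdge (N : LabGraph X) (e : Sym2 N.V) : Prop :=
  e ∈ N.G.edgeSet ∧ ¬ (N.G.deleteEdges {e}).Connected

/-- A trivial (cut-)edge: one incident to a leaf. -/
def TrivialEdge (N : LabGraph X) (e : Sym2 N.V) : Prop :=
  ∃ x : X, N.leaf x ∈ e

/-- An edge is incident to a blob if one of its endpoints is a vertex of the blob. -/
def EdgeIncBlob (N : LabGraph X) (e : Sym2 N.V) (H : N.G.Subgraph) : Prop :=
  ∃ v ∈ H.verts, v ∈ e

/-- A pendant blob: a blob with exactly one incident non-trivial cut-edge. -/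
def IsPendantBlob (N : LabGraph X) (H : N.G.Subgraph) : Prop :=
  N.IsBlob H ∧
    ∃! e : Sym2 N.V, N.IsCutEdge e ∧ ¬ N.TrivialEdge e ∧ N.EdgeIncBlob e H

/-- A leaf is contained in a blob if its neighbour is a vertex of the blob. -/
def LeafInBlob (N : LabGraph X) (x : X) (H : N.G.Subgraph) : Prop :=
  ∃ v : N.V, N.G.Adj (N.leaf x) v ∧ v ∈ H.verts

/-- `N` has at least two blobs. -/
def TwoBlobs (N : LabGraph X) : Prop :=
  ∃ H₁ H₂ : N.G.Subgraph, N.IsBlob H₁ ∧ N.IsBlob H₂ ∧ H₁ ≠ H₂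

/-- Every leaf of `N` is contained in a blob. -/
def AllLeavesInBlobs (N : LabGraph X) : Prop :=
  ∀ x : X, ∃ H : N.G.Subgraph, N.IsBlob H ∧ N.LeafInBlob x H

/-- A chain: a `k`-tuple of leaves with consecutive shortest distances equal to 3. -/
def IsChainT (N : LabGraph X) (k : ℕ) (a : Fin k → X) : Prop :=
  ∀ (i : ℕ) (h : i + 1 < k),
    N.dm (a ⟨i, Nat.lt_of_succ_lt h⟩) (a ⟨i + 1, h⟩) = 3

/-- A maximal chain: a chain whose leaf set is not properly contained in the leaf
set of another chain. -/
def IsMaxChainT (N : LabGraph X) (k : ℕ) (a : Fin k → X) : Prop :=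
  N.IsChainT k a ∧ ∀ (l : ℕ) (b : Fin l → X), N.IsChainT l b →
    Set.range a ⊆ Set.range b → Set.range a = Set.range b

/-- The chain `a` is contained in the blob `H`: the edges between the neighbours of
consecutive chain leaves are edges of `H`. -/
def ChainInBlob (N : LabGraph X) (k : ℕ) (a : Fin k → X) (H : N.G.Subgraph) : Prop :=
  ∀ (i : ℕ) (h : i + 1 < k) (p q : N.V),
    N.G.Adj (N.leaf (a ⟨i, Nat.lt_of_succ_lt h⟩)) p →
    N.G.Adj (N.leaf (a ⟨i + 1, h⟩)) q → H.Adj p q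

/-- The multiset of natural numbers `A`, viewed in `ℤ`. -/
def toZ (A : Multiset ℕ) : Multiset ℤ := A.map (fun t => (t : ℤ))

/-- `A - n`: subtract `n` from every element of the multiset `A` (in `ℤ`). -/
def zsub (A : Multiset ℕ) (n : ℤ) : Multiset ℤ := A.map (fun t => (t : ℤ) - n)

end LabGraph

namespace L2R
open Polynomial
open scoped Classical

section GF
variable {V : Type} [Fintype V] (G : SimpleGraph V)

/-- Generating function (by length) of the paths from `u` to `v` inside the vertex set `S`. -/
noncomputable def gf (S : Finset V) (u v : V) : ℤ[X] :=
  if h : u ∈ S then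
    (if u = v then 1
      else X * ∑ y ∈ Finset.univ.filter (fun y => G.Adj u y), gf (S.erase u) y v)
  else 0
termination_by S.card
decreasing_by exact Finset.card_erase_lt_of_mem h

theorem gf_notMem {S : Finset V} {u v : V} (h : u ∉ S) : gf G S u v = 0 := by
  rw [gf]; simp [h]

theorem gf_self {S : Finset V} {u : V} (h : u ∈ S) : gf G S u u = 1 := by
  rw [gf]; simp [h]

theorem gf_step {S : Finset V} {u v : V} (h : u ∈ S) (huv : u ≠ v) :
    gf G S u v = X * ∑ y ∈ Finset.univ.filter (fun y => G.Adj u y), gf G (S.erase u) y v := by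
  rw [gf]; simp [h, huv]

theorem gf_target_notMem {S : Finset V} {u v : V} (h : v ∉ S) : gf G S u v = 0 := by
  induction hn : S.card generalizing S u with
  | zero =>
    apply gf_notMem
    rw [Finset.card_eq_zero.mp hn]; simp
  | succ n ih =>
    by_cases hu : u ∈ S
    · have huv : u ≠ v := fun e => h (e ▸ hu)
      rw [gf_step G hu huv, Finset.sum_eq_zero, mul_zero]
      intro y _
      apply ih
      · simp [h]
      · rw [Finset.card_erase_of_mem hu]; omega
    · exact gf_notMem G hu

/-- Restricting the sum to neighbours that matter. -/
theorem gf_step' {S : Finset V} {u v : V} (h : u ∈ S) (huv : u ≠ v) :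
    gf G S u v = X * ∑ y ∈ (S.erase u).filter (fun y => G.Adj u y), gf G (S.erase u) y v := by
  rw [gf_step G h huv]
  congr 1
  symm
  apply Finset.sum_subset
  · intro y hy; simp at hy ⊢; exact hy.2
  · intro y hy hy'
    simp only [Finset.mem_filter, Finset.mem_univ, true_and] at hy
    apply gf_notMem
    intro hh
    exact hy' (by simp only [Finset.mem_filter]; exact ⟨hh, hy⟩)

theorem gf_eq_sum_paths (S : Finset V) (u v : V) :
    gf G S u v = ∑ p ∈ (Finset.univ : Finset (G.Path u v)).filter
      (fun p => ∀ z ∈ p.1.support, z ∈ S), (X : ℤ[X]) ^ p.1.length := by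
  induction hn : S.card generalizing S u with
  | zero =>
    have hS := Finset.card_eq_zero.mp hn
    subst hS
    rw [gf_notMem G (by simp), Finset.sum_eq_zero]
    intro p hp
    simp only [Finset.mem_filter] at hp
    exact absurd (hp.2 u p.1.start_mem_support) (by simp)
  | succ n ih =>
    by_cases hu : u ∈ S
    · by_cases huv : u = v
      · subst huv
        rw [gf_self G hu]
        have : (Finset.univ : Finset (G.Path u u)).filter
            (fun p => ∀ z ∈ p.1.support, z ∈ S) = {SimpleGraph.Path.nil} := by
          ext p
          simp only [Finset.mem_filter, Finset.mem_univ, true_and, Finset.mem_singleton]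
          constructor
          · intro _; exact p.loop_eq
          · rintro rfl; simp [SimpleGraph.Path.nil, hu]
        rw [this]; simp [SimpleGraph.Path.nil]
      · rw [gf_step G hu huv]
        have hc : (S.erase u).card = n := by rw [Finset.card_erase_of_mem hu]; omega
        simp_rw [fun y => ih (S.erase u) y hc]
        rw [Finset.mul_sum]
        simp_rw [Finset.mul_sum]
        rw [Finset.sum_sigma']
        refine Finset.sum_bij
          (i := fun (q : (y : V) × G.Path y v) hq =>
            (⟨Walk.cons (by simp at hq; exact hq.1) q.2.1, ?_⟩ : G.Path u v)) ?_ ?_ ?_ ?_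
        · simp only [Finset.mem_sigma, Finset.mem_filter, Finset.mem_univ, true_and] at hq
          rw [Walk.cons_isPath_iff]
          refine ⟨q.2.2, fun h => ?_⟩
          have := hq.2 u h
          simp at this
        · rintro ⟨y, q⟩ hq
          simp only [Finset.mem_sigma, Finset.mem_filter, Finset.mem_univ, true_and] at hq ⊢
          intro z hz
          simp only [Walk.support_cons, List.mem_cons] at hz
          rcases hz with rfl | hz
          · exact hu
          · exact Finset.mem_of_mem_erase (hq.2 z hz)
        · rintro ⟨y, q, hq0⟩ hq ⟨y', q', hq0'⟩ hq' h
          simp only [Subtype.mk.injEq, Walk.cons.injEq] at h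
          obtain ⟨rfl, h⟩ := h
          simp only [heq_eq_eq] at h
          subst h
          rfl
        · rintro ⟨p, hpp⟩ hp
          cases p with
          | nil => exact absurd rfl huv
          | cons h q =>
            simp only [Finset.mem_filter, Finset.mem_univ, true_and] at hp
            have hpp' := hpp
            rw [Walk.cons_isPath_iff] at hpp'
            refine ⟨⟨_, ⟨q, hpp'.1⟩⟩, ?_, rfl⟩
            simp only [Finset.mem_sigma, Finset.mem_filter, Finset.mem_univ, true_and]
            refine ⟨by simpa using h, ?_⟩
            intro z hz
            rw [Finset.mem_erase]
            refine ⟨fun e => hpp'.2 (e ▸ hz), hp z (by simp [hz])⟩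
        · rintro ⟨y, q⟩ hq
          simp [pow_succ, mul_comm]
    · rw [gf_notMem G hu, Finset.sum_eq_zero]
      intro p hp
      simp only [Finset.mem_filter] at hp
      exact absurd (hp.2 u p.1.start_mem_support) hu

theorem gf_symm (S : Finset V) (u v : V) : gf G S u v = gf G S v u := by
  rw [gf_eq_sum_paths, gf_eq_sum_paths]
  refine Finset.sum_bij' (i := fun p _ => p.reverse) (j := fun p _ => p.reverse) ?_ ?_ ?_ ?_ ?_
  · intro p hp; simpa [SimpleGraph.Path.reverse] using hp
  · intro p hp; simpa [SimpleGraph.Path.reverse] using hp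
  · intro p hp; ext; simp [SimpleGraph.Path.reverse]
  · intro p hp; ext; simp [SimpleGraph.Path.reverse]
  · intro p hp; simp [SimpleGraph.Path.reverse]

/-- A closed set traps paths. -/
theorem gf_closed {S U : Finset V} {u v : V} (hu : u ∈ U) (hv : v ∉ U)
    (hcl : ∀ x ∈ U, ∀ y ∈ S, x ∈ S → G.Adj x y → y ∈ U) : gf G S u v = 0 := by
  induction hn : S.card generalizing S u with
  | zero =>
    apply gf_notMem
    rw [Finset.card_eq_zero.mp hn]; simp
  | succ n ih =>
    by_cases huS : u ∈ S
    · have huv : u ≠ v := fun e => hv (e ▸ hu)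
      rw [gf_step' G huS huv, Finset.sum_eq_zero, mul_zero]
      intro y hy
      simp only [Finset.mem_filter, Finset.mem_erase] at hy
      apply ih (hcl u hu y hy.1.2 huS hy.2)
      · intro x hx y hy hxS
        exact hcl x hx y (Finset.mem_of_mem_erase hy) (Finset.mem_of_mem_erase hxS)
      · rw [Finset.card_erase_of_mem huS]; omega
    · exact gf_notMem G huS

/-- `S` is a side of a bridge `d c`, with `d` inside and `c` outside. -/
structure IsSide (S : Finset V) (d c : V) : Prop where
  din : d ∈ S
  cout : c ∉ S
  adj : G.Adj d c
  only : ∀ x ∈ S, ∀ y ∉ S, G.Adj x y → x = d ∧ y = c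

variable {G}

theorem IsSide.compl {S : Finset V} {d c : V} (h : IsSide G S d c) : IsSide G Sᶜ c d where
  din := by simpa using h.cout
  cout := by simpa using h.din
  adj := h.adj.symm
  only := by
    intro x hx y hy hxy
    simp only [Finset.mem_compl, not_not] at hx hy
    exact (h.only y hy x hx hxy.symm).symm

theorem gf_inside_aux {S T : Finset V} {d c x y : V} (h : IsSide G S d c) (hx : x ∈ S)
    (hc : c ∉ T) : gf G T x y = gf G (T ∩ S) x y := by
  induction hn : T.card generalizing T x with
  | zero => rw [Finset.card_eq_zero.mp hn]; simp
  | succ n ih =>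
    by_cases hxT : x ∈ T
    · by_cases hxy : x = y
      · subst hxy; rw [gf_self G hxT, gf_self G (by simp [hxT, hx])]
      · rw [gf_step G hxT hxy, gf_step G (S := T ∩ S) (by simp [hxT, hx]) hxy]
        congr 1
        apply Finset.sum_congr rfl
        intro z hz
        simp only [Finset.mem_filter, Finset.mem_univ, true_and] at hz
        by_cases hzS : z ∈ S
        · rw [ih hzS (fun hh => hc (Finset.mem_of_mem_erase hh))
            (by rw [Finset.card_erase_of_mem hxT]; omega), Finset.erase_inter]
        · have := (h.only x hx z hzS hz).2
          subst this
          rw [gf_notMem, gf_notMem]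
          · simp [hc]
          · simp [hc]
    · rw [gf_notMem G hxT, gf_notMem]
      simp [hxT]

/-- Paths across a bridge. -/
theorem gf_bridge {S T : Finset V} {d c x y : V} (h : IsSide G S d c) (hx : x ∉ S)
    (hy : y ∈ S) : gf G T x y = gf G (T \ S) x c * X * gf G (T ∩ S) d y := by
  induction hn : T.card generalizing T x with
  | zero => rw [Finset.card_eq_zero.mp hn]; rw [gf_notMem, gf_notMem] <;> simp
  | succ n ih =>
    have hxy : x ≠ y := fun e => hx (e ▸ hy)
    by_cases hxT : x ∈ T
    · rw [gf_step G hxT hxy]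
      by_cases hxc : x = c
      · subst hxc
        rw [gf_self G (by simp [hxT, hx]), one_mul]
        congr 1
        rw [Finset.sum_eq_single d]
        · rw [gf_inside_aux h h.din (by simp), Finset.erase_inter, Finset.erase_eq_of_notMem]
          simp [hx]
        · intro z hz hzd
          simp only [Finset.mem_filter, Finset.mem_univ, true_and] at hz
          by_cases hzS : z ∈ S
          · exact absurd (h.only z hzS x hx hz.symm).1 hzd
          · rw [ih hzS (by rw [Finset.card_erase_of_mem hxT]; omega),
              gf_target_notMem G (u := z) (v := x) (by simp)]
            simp
        · intro hd
          simp only [Finset.mem_filter, Finset.mem_univ, true_and] at hd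
          exact absurd h.adj.symm hd
      · rw [gf_step G (S := T \ S) (by simp [hxT, hx]) hxc, mul_assoc, mul_assoc, Finset.sum_mul]
        congr 1
        apply Finset.sum_congr rfl
        intro z hz
        simp only [Finset.mem_filter, Finset.mem_univ, true_and] at hz
        have hzS : z ∉ S := fun hzS => hxc (h.only z hzS x hx hz.symm).2
        rw [ih hzS (by rw [Finset.card_erase_of_mem hxT]; omega), mul_assoc]
        congr 2
        · rw [Finset.erase_sdiff_comm]
        · rw [Finset.erase_inter, Finset.erase_eq_of_notMem]
          simp [hx]
    · rw [gf_notMem G hxT, gf_notMem]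
      · simp
      · simp [hxT]

/-- Paths between two vertices of a side stay in the side. -/
theorem gf_inside {S T : Finset V} {d c x y : V} (h : IsSide G S d c) (hx : x ∈ S)
    (hy : y ∈ S) : gf G T x y = gf G (T ∩ S) x y := by
  induction hn : T.card generalizing T x with
  | zero => rw [Finset.card_eq_zero.mp hn]; simp
  | succ n ih =>
    by_cases hxT : x ∈ T
    · by_cases hxy : x = y
      · subst hxy; rw [gf_self G hxT, gf_self G (by simp [hxT, hx])]
      · rw [gf_step G hxT hxy, gf_step G (S := T ∩ S) (by simp [hxT, hx]) hxy]
        congr 1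
        apply Finset.sum_congr rfl
        intro z hz
        simp only [Finset.mem_filter, Finset.mem_univ, true_and] at hz
        by_cases hzS : z ∈ S
        · rw [ih hzS (by rw [Finset.card_erase_of_mem hxT]; omega), Finset.erase_inter]
        · have h1 := (h.only x hx z hzS hz).1
          subst h1
          rw [gf_bridge h hzS hy, gf_notMem G (S := (T.erase x) ∩ S) (by simp), mul_zero,
            gf_notMem]
          simp [hzS]
    · rw [gf_notMem G hxT, gf_notMem]
      simp [hxT]

end GF
end L2R

namespace L2R
set_option linter.unusedSectionVars false
open Polynomial
open scoped Classical

section Cls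
variable {V : Type} [Fintype V] {G : SimpleGraph V}

/-- Connectivity, phrased with cuts. -/
def CutConn (G : SimpleGraph V) : Prop :=
  ∀ U : Finset V, U.Nonempty → (∀ x ∈ U, ∀ y ∉ U, ¬ G.Adj x y) → U = Finset.univ

theorem cutConn_of_connected (h : G.Connected) : CutConn G := by
  intro U ⟨a, ha⟩ hU
  ext b
  simp only [Finset.mem_univ, iff_true]
  obtain ⟨p⟩ := h.preconnected a b
  induction p with
  | nil => exact ha
  | cons hadj q ih =>
    apply ih
    by_contra hv
    exact hU _ ha _ hv hadj

/-- The 2-edge-connected class of `w`. -/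
noncomputable def cls (G : SimpleGraph V) (w : V) : Finset V :=
  Finset.univ.filter (fun u => ∀ S d c, IsSide G S d c → (w ∈ S ↔ u ∈ S))

theorem mem_cls {w u : V} : u ∈ cls G w ↔ ∀ S d c, IsSide G S d c → (w ∈ S ↔ u ∈ S) := by
  simp [cls]

theorem self_mem_cls (w : V) : w ∈ cls G w := by simp [mem_cls]

theorem cls_subset {w a : V} {S : Finset V} {d c : V} (h : IsSide G S d c) (ha : a ∈ cls G w)
    (haS : a ∈ S) {u : V} (hu : u ∈ cls G w) : u ∈ S := by
  rw [mem_cls] at ha hu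
  exact (hu S d c h).1 ((ha S d c h).2 haS)

theorem cls_not {w a : V} {S : Finset V} {d c : V} (h : IsSide G S d c) (ha : a ∈ cls G w)
    (haS : a ∉ S) {u : V} (hu : u ∈ cls G w) : u ∉ S :=
  fun huS => haS (cls_subset h hu huS ha)

/-- A part: a side hanging off the core `K`. -/
structure Part (G : SimpleGraph V) (K S : Finset V) (d c : V) : Prop where
  side : IsSide G S d c
  cK : c ∈ K
  dis : ∀ u ∈ K, u ∉ S

theorem part_of_edge {w c d : V} (hc : c ∈ cls G w) (hd : d ∉ cls G w) (h : G.Adj c d) :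
    ∃ S, Part G (cls G w) S d c := by
  have : ∃ S a b, IsSide G S a b ∧ ¬ (c ∈ S ↔ d ∈ S) := by
    by_contra hcon
    push Not at hcon
    apply hd
    rw [mem_cls] at hc ⊢
    intro S a b hS
    exact (hc S a b hS).trans (hcon S a b hS)
  obtain ⟨S, a, b, hS, hne⟩ := this
  by_cases hcS : c ∈ S
  · have hdS : d ∉ S := fun hh => hne (by simp [hcS, hh])
    obtain ⟨rfl, rfl⟩ := hS.only c hcS d hdS h
    refine ⟨Sᶜ, hS.compl, hc, ?_⟩
    intro u hu
    simp only [Finset.mem_compl, not_not]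
    exact cls_subset hS hc hcS hu
  · have hdS : d ∈ S := by by_contra hh; exact hne (by simp [hcS, hh])
    obtain ⟨rfl, rfl⟩ := hS.only d hdS c hcS h.symm
    exact ⟨S, hS, hc, fun u hu => cls_not hS hc hcS hu⟩

theorem side_unique (hG : CutConn G) {S S' : Finset V} {d c : V} (h : IsSide G S d c)
    (h' : IsSide G S' d c) : S ⊆ S' := by
  by_contra hne
  have hne' : (S \ S').Nonempty := by
    rw [Finset.sdiff_nonempty]; exact hne
  have := hG _ hne' (by
    intro x hx y hy hxy
    simp only [Finset.mem_sdiff, not_and, not_not] at hx hy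
    by_cases hyS : y ∈ S
    · obtain ⟨rfl, rfl⟩ := h'.only y (hy hyS) x hx.2 hxy.symm
      exact h.cout hx.1
    · obtain ⟨rfl, rfl⟩ := h.only x hx.1 y hyS hxy
      exact hx.2 h'.din)
  have hc : c ∈ S \ S' := by rw [this]; simp
  exact h.cout (Finset.mem_sdiff.1 hc).1

theorem Part.eq (hG : CutConn G) {K S S' : Finset V} {d c : V} (h : Part G K S d c)
    (h' : Part G K S' d c) : S = S' :=
  Finset.Subset.antisymm (side_unique hG h.side h'.side) (side_unique hG h'.side h.side)

theorem Part.disjoint (hG : CutConn G) {K S S' : Finset V} {d c d' c' : V} (h : Part G K S d c)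
    (h' : Part G K S' d' c') (hne : ¬ (d = d' ∧ c = c')) : Disjoint S S' := by
  by_contra hcon
  have hne' : (S ∩ S').Nonempty := by
    rw [Finset.disjoint_iff_inter_eq_empty] at hcon
    exact Finset.nonempty_iff_ne_empty.2 hcon
  have := hG _ hne' (by
    intro x hx y hy hxy
    simp only [Finset.mem_inter, not_and] at hx hy
    by_cases hyS : y ∈ S
    · obtain ⟨rfl, rfl⟩ := h'.side.only x hx.2 y (hy hyS) hxy
      exact h.dis _ h'.cK hyS
    · obtain ⟨rfl, rfl⟩ := h.side.only x hx.1 y hyS hxy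
      obtain ⟨rfl, rfl⟩ := h'.side.only _ hx.2 _ (h'.dis _ h.cK) hxy
      exact hne ⟨rfl, rfl⟩)
  have hc : c ∈ S ∩ S' := by rw [this]; simp
  exact h.side.cout (Finset.mem_inter.1 hc).1

theorem part_cover (hG : CutConn G) (w x : V) :
    x ∈ cls G w ∨ ∃ S d c, Part G (cls G w) S d c ∧ x ∈ S := by
  have := hG (Finset.univ.filter (fun x => x ∈ cls G w ∨ ∃ S d c, Part G (cls G w) S d c ∧ x ∈ S))
    ⟨w, by simp [self_mem_cls]⟩ (by
      intro x hx y hy hxy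
      simp only [Finset.mem_filter, Finset.mem_univ, true_and, not_or, not_exists, not_and] at hx hy
      rcases hx with hx | ⟨S, d, c, hS, hx⟩
      · obtain ⟨S, hS⟩ := part_of_edge hx hy.1 hxy
        exact hy.2 S y x hS hS.side.din
      · have hyS := hy.2 S d c hS
        obtain ⟨rfl, rfl⟩ := hS.side.only x hx y hyS hxy
        exact hy.1 hS.cK)
  have hx : x ∈ Finset.univ := Finset.mem_univ x
  rw [← this] at hx
  simpa using hx

theorem cls_twoEdge (hG : CutConn G) {w : V} {U : Finset V} (hU : U ⊆ cls G w)
    (hne : U.Nonempty) (hprop : U ≠ cls G w) (a b : V) :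
    ∃ x ∈ U, ∃ y ∈ cls G w, y ∉ U ∧ G.Adj x y ∧ ¬ (x = a ∧ y = b) := by
  by_contra hcon
  push Not at hcon
  obtain ⟨k, hkK, hkU⟩ : ∃ k ∈ cls G w, k ∉ U := by
    by_contra hh
    push Not at hh
    exact hprop (Finset.Subset.antisymm hU hh)
  set W : Finset V := Finset.univ.filter
    (fun x => x ∈ U ∨ ∃ S d c, Part G (cls G w) S d c ∧ c ∈ U ∧ x ∈ S) with hW
  have hUW : ∀ x ∈ U, x ∈ W := by intro x hx; simp [hW, hx]
  have hkW : ∀ k ∈ cls G w, k ∈ W → k ∈ U := by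
    intro k hk hkW
    simp only [hW, Finset.mem_filter, Finset.mem_univ, true_and] at hkW
    rcases hkW with h | ⟨S, d, c, hS, _, hx⟩
    · exact h
    · exact absurd hx (hS.dis k hk)
  have key : ∀ x ∈ W, ∀ y ∉ W, G.Adj x y → x ∈ U ∧ y ∈ cls G w ∧ y ∉ U := by
    intro x hx y hy hxy
    have hyU : y ∉ U := fun h => hy (hUW y h)
    simp only [hW, Finset.mem_filter, Finset.mem_univ, true_and, not_or, not_exists, not_and]
      at hx hy
    rcases hx with hx | ⟨S, d, c, hS, hcU, hx⟩
    · refine ⟨hx, ?_, hyU⟩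
      by_contra hyK
      obtain ⟨S, hS⟩ := part_of_edge (hU hx) hyK hxy
      exact hy.2 S y x hS hx hS.side.din
    · have hyS := hy.2 S d c hS hcU
      obtain ⟨rfl, rfl⟩ := hS.side.only x hx y hyS hxy
      exact absurd hcU hyU
  by_cases hex : ∃ x ∈ W, ∃ y, y ∉ W ∧ G.Adj x y
  · obtain ⟨x, hx, y, hy, hxy⟩ := hex
    obtain ⟨hxU, hyK, hyU⟩ := key x hx y hy hxy
    obtain ⟨rfl, rfl⟩ := hcon x hxU y hyK hyU hxy
    have hs : IsSide G W x y := ⟨hx, hy, hxy, by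
      intro x' hx' y' hy' h'
      obtain ⟨hxU', hyK', hyU'⟩ := key x' hx' y' hy' h'
      exact hcon x' hxU' y' hyK' hyU' h'⟩
    exact hy (cls_subset hs (hU hxU) hx hyK)
  · push Not at hex
    have := hG W (hne.mono hUW) (fun x hx y hy => hex x hx y hy)
    exact hkU (hkW k hkK (by rw [this]; simp))

theorem gf_core {w : V} {T : Finset V} {x y : V} (hx : x ∈ cls G w) (hy : y ∈ cls G w) :
    gf G T x y = gf G (T ∩ cls G w) x y := by
  induction hn : T.card generalizing T x with
  | zero => rw [Finset.card_eq_zero.mp hn]; simp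
  | succ n ih =>
    by_cases hxT : x ∈ T
    · by_cases hxy : x = y
      · subst hxy; rw [gf_self G hxT, gf_self G (by simp [hxT, hx])]
      · rw [gf_step G hxT hxy, gf_step G (S := T ∩ _) (by simp [hxT, hx]) hxy]
        congr 1
        apply Finset.sum_congr rfl
        intro z hz
        simp only [Finset.mem_filter, Finset.mem_univ, true_and] at hz
        by_cases hzK : z ∈ cls G w
        · rw [ih hzK (by rw [Finset.card_erase_of_mem hxT]; omega), Finset.erase_inter]
        · obtain ⟨S, hS⟩ := part_of_edge hx hzK hz
          have e1 : gf G (T.erase x) z y = 0 := by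
            rw [gf_symm, gf_bridge hS.side (hS.dis y hy) hS.side.din,
              gf_target_notMem G (u := y) (v := x) (by simp)]
            simp
          have e2 : gf G ((T ∩ cls G w).erase x) z y = 0 := gf_notMem G (by simp [hzK])
          rw [e1, e2]
    · rw [gf_notMem G hxT, gf_notMem]
      simp [hxT]

/-- A part of the core that lies inside the rooted side `S₀`. -/
structure RPart (G : SimpleGraph V) (S₀ K S : Finset V) (d c : V) : Prop extends
    Part G K S d c where
  sub : S ⊆ S₀

variable {S₀ : Finset V} {w v : V}

theorem cls_sub_side (h₀ : IsSide G S₀ w v) : cls G w ⊆ S₀ := fun _ hu =>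
  cls_subset h₀ (self_mem_cls w) h₀.din hu

theorem outer_part (h₀ : IsSide G S₀ w v) : Part G (cls G w) S₀ᶜ v w :=
  ⟨h₀.compl, self_mem_cls w, fun u hu => by simpa using cls_sub_side h₀ hu⟩

theorem rpart_of_part (hG : CutConn G) (h₀ : IsSide G S₀ w v) {S : Finset V} {d c : V}
    (h : Part G (cls G w) S d c) (hne : ¬ (d = v ∧ c = w)) : RPart G S₀ (cls G w) S d c :=
  ⟨h, by
    have := h.disjoint hG (outer_part h₀) hne
    rwa [← Finset.subset_compl_iff_disjoint_right, compl_compl] at this⟩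

theorem RPart.ne (h₀ : IsSide G S₀ w v) {S : Finset V} {d c : V} {K : Finset V}
    (h : RPart G S₀ K S d c) : d ≠ v := by
  rintro rfl
  exact h₀.cout (h.sub h.side.din)

theorem rpart_cover (hG : CutConn G) (h₀ : IsSide G S₀ w v) {x : V} (hx : x ∈ S₀) :
    x ∈ cls G w ∨ ∃ S d c, RPart G S₀ (cls G w) S d c ∧ x ∈ S := by
  rcases part_cover hG w x with h | ⟨S, d, c, h, hxS⟩
  · exact Or.inl h
  · refine Or.inr ⟨S, d, c, rpart_of_part hG h₀ h ?_, hxS⟩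
    rintro ⟨rfl, rfl⟩
    have := h.eq hG (outer_part h₀)
    subst this
    simp [hx] at hxS

theorem RPart.card_lt (h₀ : IsSide G S₀ w v) {S : Finset V} {d c : V}
    (h : RPart G S₀ (cls G w) S d c) : S.card < S₀.card := by
  apply Finset.card_lt_card
  refine ⟨h.sub, fun hh => ?_⟩
  exact h.dis w (self_mem_cls w) (hh h₀.din)

theorem gf_root (h₀ : IsSide G S₀ w v) {S : Finset V} {d c x : V}
    (h : RPart G S₀ (cls G w) S d c) (hx : x ∈ S) :
    gf G S₀ w x = gf G (cls G w) w c * X * gf G S d x := by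
  rw [gf_bridge h.side (h.dis w (self_mem_cls w)) hx, Finset.inter_eq_right.2 h.sub,
    gf_core (self_mem_cls w) h.cK]
  congr 3
  ext u
  simp only [Finset.mem_inter, Finset.mem_sdiff]
  exact ⟨fun hh => hh.2, fun hu => ⟨⟨cls_sub_side h₀ hu, h.dis u hu⟩, hu⟩⟩

theorem gf_pair {S S' : Finset V} {d c x d' c' y : V}
    (h : Part G (cls G w) S d c) (h' : Part G (cls G w) S' d' c') (hd : Disjoint S S')
    (hx : x ∈ S) (hy : y ∈ S') :
    gf G Finset.univ x y = gf G (cls G w) c c' * (X * gf G S d x) * (X * gf G S' d' y) := by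
  rw [gf_bridge h'.side (Finset.disjoint_left.1 hd hx) hy,
    gf_bridge (T := Finset.univ \ S') h.side.compl (by simpa using hx)
      (by simpa using h.dis _ h'.cK)]
  have e1 : (Finset.univ \ S') \ Sᶜ = S := by
    ext u; simp only [Finset.mem_sdiff, Finset.mem_univ, true_and, Finset.mem_compl, not_not]
    exact ⟨fun hh => hh.2, fun hu => ⟨Finset.disjoint_left.1 hd hu, hu⟩⟩
  rw [e1, gf_core h.cK h'.cK, gf_symm G S x d, Finset.univ_inter]
  have e2 : (Finset.univ \ S' ∩ Sᶜ ∩ cls G w) = cls G w := by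
    ext u; simp only [Finset.mem_sdiff, Finset.mem_univ, true_and, Finset.mem_compl, Finset.mem_inter]
    exact ⟨fun hh => hh.2, fun hu => ⟨⟨h'.dis u hu, h.dis u hu⟩, hu⟩⟩
  rw [e2]; ring

end Cls
end L2R

namespace L2R
set_option linter.unusedSectionVars false
open Polynomial
open scoped Classical

section Blob
variable {V : Type} [Fintype V] {G : SimpleGraph V}

/-- Degree inside `K`. -/
noncomputable def dK (G : SimpleGraph V) (K : Finset V) (u : V) : ℕ := (K.filter (G.Adj u)).card

/-- Connectivity of the induced graph on `T`, phrased with cuts. -/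
def CutConnOn (G : SimpleGraph V) (T : Finset V) : Prop :=
  ∀ U : Finset V, U ⊆ T → U.Nonempty → (∀ x ∈ U, ∀ y ∈ T, y ∉ U → ¬ G.Adj x y) → U = T

theorem two_le_dK (hG : CutConn G) {w u : V} (hK : 2 ≤ (cls G w).card) (hu : u ∈ cls G w) :
    2 ≤ dK G (cls G w) u := by
  have hprop : ({u} : Finset V) ≠ cls G w := by
    intro h; rw [← h] at hK; simp at hK
  obtain ⟨x, hx, y, hy, -, hxy, -⟩ := cls_twoEdge hG (Finset.singleton_subset_iff.2 hu) (by simp)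
    hprop u u
  rw [Finset.mem_singleton] at hx; subst hx
  obtain ⟨x', hx', y', hy', -, hxy', hne⟩ := cls_twoEdge hG (Finset.singleton_subset_iff.2 hu)
    (by simp) hprop x y
  rw [Finset.mem_singleton] at hx'; subst hx'
  have : ({y, y'} : Finset V) ⊆ (cls G w).filter (G.Adj x') := by
    intro z hz
    simp only [Finset.mem_insert, Finset.mem_singleton] at hz
    rcases hz with rfl | rfl <;> simp [*]
  have h2 := Finset.card_le_card this
  rw [Finset.card_pair (by rintro rfl; exact hne ⟨rfl, rfl⟩)] at h2
  exact h2

theorem cls_cutConnOn (hG : CutConn G) (w : V) : CutConnOn G (cls G w) := by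
  intro U hU hne h
  by_contra hcon
  obtain ⟨x, hx, y, hy, hyU, hxy, -⟩ := cls_twoEdge hG hU hne hcon w w
  exact h x hx y hy hyU hxy

theorem three_le_card (hG : CutConn G) {w : V} (hK : 2 ≤ (cls G w).card) :
    3 ≤ (cls G w).card := by
  have h := two_le_dK hG hK (self_mem_cls w)
  have : (cls G w).filter (G.Adj w) ⊆ (cls G w).erase w := by
    intro z hz
    simp only [Finset.mem_filter] at hz
    simp only [Finset.mem_erase]
    exact ⟨hz.2.ne', hz.1⟩
  have h2 := Finset.card_le_card this
  rw [Finset.card_erase_of_mem (self_mem_cls w)] at h2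
  unfold dK at h
  omega

/-- Two neighbours of `z` in one half `U` of a cut of `K \ z`. -/
theorem two_nbr_aux (hG : CutConn G) {w z : V} {U : Finset V}
    (hU : U ⊆ (cls G w).erase z) (hz : z ∈ cls G w) (hne : U.Nonempty)
    (hcl : ∀ x ∈ U, ∀ y ∈ (cls G w).erase z, y ∉ U → ¬ G.Adj x y) :
    2 ≤ (U.filter (G.Adj z)).card := by
  have hprop : U ≠ cls G w := by
    rintro rfl; simpa using hU hz
  have hUK : U ⊆ cls G w := hU.trans (Finset.erase_subset _ _)
  have key : ∀ a, ∃ x ∈ U, G.Adj z x ∧ x ≠ a := by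
    intro a
    obtain ⟨x, hx, y, hy, hyU, hxy, hn⟩ := cls_twoEdge hG hUK hne hprop a z
    have hyz : y = z := by
      by_contra hyz
      exact hcl x hx y (by simp [hyz, hy]) hyU hxy
    subst hyz
    exact ⟨x, hx, hxy.symm, fun h => hn ⟨h, rfl⟩⟩
  obtain ⟨x, hx, hzx, -⟩ := key z
  obtain ⟨x', hx', hzx', hn⟩ := key x
  have : ({x', x} : Finset V) ⊆ U.filter (G.Adj z) := by
    intro t ht
    simp only [Finset.mem_insert, Finset.mem_singleton] at ht
    rcases ht with rfl | rfl <;> simp [*]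
  have h2 := Finset.card_le_card this
  rwa [Finset.card_pair hn] at h2

theorem cls_erase_cutConnOn (hG : CutConn G)
    (hdeg : ∀ u, (Finset.univ.filter (G.Adj u)).card ≤ 3) {w z : V} (hz : z ∈ cls G w) :
    CutConnOn G ((cls G w).erase z) := by
  intro U hU hne h
  by_contra hcon
  have h1 := two_nbr_aux hG hU hz hne h
  have h2 := two_nbr_aux hG (U := (cls G w).erase z \ U) (z := z) Finset.sdiff_subset hz
    (by
      rw [Finset.sdiff_nonempty]
      intro hh; exact hcon (Finset.Subset.antisymm hU hh))
    (by
      intro x hx y hy hyU hxy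
      simp only [Finset.mem_sdiff] at hx hyU
      have : y ∈ U := by by_contra hh; exact hyU ⟨hy, hh⟩
      exact h y this x hx.1 hx.2 hxy.symm)
  have hd : Disjoint (U.filter (G.Adj z)) (((cls G w).erase z \ U).filter (G.Adj z)) :=
    Finset.disjoint_filter_filter Finset.disjoint_sdiff
  have h3 := Finset.card_union_of_disjoint hd
  have h4 : (U.filter (G.Adj z)) ∪ (((cls G w).erase z \ U).filter (G.Adj z)) ⊆
      Finset.univ.filter (G.Adj z) := by
    intro t ht
    simp only [Finset.mem_union, Finset.mem_filter] at ht
    simp only [Finset.mem_filter, Finset.mem_univ, true_and]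
    tauto
  have h5 := Finset.card_le_card h4
  have h6 := hdeg z
  omega

theorem sub_connected {H : G.Subgraph} {T : Finset V} (hv : H.verts = (T : Set V))
    (ha : ∀ u ∈ T, ∀ v ∈ T, G.Adj u v → H.Adj u v) (hT : CutConnOn G T) (hne : T.Nonempty) :
    H.coe.Connected := by
  have hmem : ∀ u, u ∈ H.verts ↔ u ∈ T := by intro u; rw [hv]; simp
  rw [connected_iff]
  refine ⟨?_, ?_⟩
  · intro a b
    set U : Finset V := T.filter (fun u => ∃ h : u ∈ H.verts, H.coe.Reachable a ⟨u, h⟩) with hU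
    have haU : a.1 ∈ U := by
      simp only [hU, Finset.mem_filter]
      exact ⟨(hmem _).1 a.2, a.2, Reachable.refl _⟩
    have := hT U (Finset.filter_subset _ _) ⟨a.1, haU⟩ (by
      intro x hx y hy hyU hxy
      simp only [hU, Finset.mem_filter] at hx hyU
      obtain ⟨hxT, hxv, hr⟩ := hx
      apply hyU
      refine ⟨hy, (hmem y).2 hy, hr.trans (Adj.reachable ?_)⟩
      rw [Subgraph.coe_adj]
      exact ha x hxT y hy hxy)
    have hb : b.1 ∈ U := by rw [this]; exact (hmem _).1 b.2
    simp only [hU, Finset.mem_filter] at hb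
    obtain ⟨_, _, hr⟩ := hb
    exact hr
  · obtain ⟨t, ht⟩ := hne
    exact ⟨⟨t, (hmem t).2 ht⟩⟩

theorem connected_cross {H : G.Subgraph} (h : H.coe.Connected) {a b : V} (ha : a ∈ H.verts)
    (hb : b ∈ H.verts) (S : Finset V) (haS : a ∈ S) (hbS : b ∉ S) :
    ∃ x y, x ∈ S ∧ y ∉ S ∧ H.Adj x y := by
  by_contra hcon
  push Not at hcon
  obtain ⟨p⟩ := h.preconnected ⟨a, ha⟩ ⟨b, hb⟩
  have : ∀ (u v : H.verts) (p : H.coe.Walk u v), u.1 ∈ S → v.1 ∈ S := by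
    intro u v p
    induction p with
    | nil => exact id
    | cons hadj q ih =>
      intro hu
      apply ih
      by_contra hv
      exact hcon _ _ hu hv hadj
  exact hbS (this _ _ p haS)

theorem blob_verts_sub (hG : CutConn G) {w : V} (hK : 2 ≤ (cls G w).card) {H : G.Subgraph}
    (hc : H.coe.Connected) (hdel : ∀ v ∈ H.verts, (H.deleteVerts {v}).coe.Connected)
    (hsub : ∀ u ∈ cls G w, u ∈ H.verts) {u : V} (hu : u ∈ H.verts) : u ∈ cls G w := by
  by_contra hcon
  rw [mem_cls] at hcon
  push Not at hcon
  obtain ⟨S, d, c, hS, hne⟩ := hcon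
  have h3 := three_le_card hG hK
  have main : ∀ S d c, IsSide G S d c → w ∈ S → u ∉ S → False := by
    intro S d c hS hw huS
    obtain ⟨k, hk, hkd⟩ : ∃ k ∈ cls G w, k ≠ d := by
      apply Finset.exists_mem_ne (by omega)
    have hkS : k ∈ S := cls_subset hS (self_mem_cls w) hw hk
    have hud : u ≠ d := by rintro rfl; exact huS hS.din
    by_cases hd : d ∈ H.verts
    · obtain ⟨x, y, hx, hy, hxy⟩ := connected_cross (hdel d hd) (a := k) (b := u)
        (by simp [hsub k hk, hkd]) (by simp [hu, hud]) S hkS huS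
      have hG' : G.Adj x y := hxy.adj_sub
      obtain ⟨rfl, rfl⟩ := hS.only x hx y hy hG'
      have := hxy.fst_mem
      simp at this
    · obtain ⟨x, y, hx, hy, hxy⟩ := connected_cross hc (hsub k hk) hu S hkS huS
      obtain ⟨rfl, rfl⟩ := hS.only x hx y hy hxy.adj_sub
      exact hd hxy.fst_mem
  by_cases hw : w ∈ S
  · have huS : u ∉ S := by
      rcases hne with h | h
      · exact h.2
      · exact absurd hw h.1
    exact main S d c hS hw huS
  · have huS : u ∈ S := by
      rcases hne with h | h
      · exact absurd h.1 hw
      · exact h.2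
    exact main _ _ _ hS.compl (by simpa using hw) (by simpa using huS)

theorem dK_le (hdeg : ∀ u, (Finset.univ.filter (G.Adj u)).card ≤ 3) (K : Finset V) (u : V) :
    dK G K u ≤ 3 := by
  refine le_trans (Finset.card_le_card ?_) (hdeg u)
  intro t ht
  simp only [Finset.mem_filter] at ht
  simp [ht.2]

/-- Handshake for the induced subgraph. -/
theorem sum_dK (K : Finset V) :
    ∑ u ∈ K, dK G K u = 2 * (((⊤ : G.Subgraph).induce (K : Set V)).edgeSet).ncard := by
  set H := ((⊤ : G.Subgraph).induce (K : Set V)) with hH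
  have h1 := H.spanningCoe.sum_degrees_eq_twice_card_edges
  have h2 : H.edgeSet.ncard = H.spanningCoe.edgeFinset.card := by
    rw [← Subgraph.edgeSet_spanningCoe, ← coe_edgeFinset, Set.ncard_coe_finset]
  rw [h2, ← h1]
  have h3 : ∀ u, H.spanningCoe.degree u = if u ∈ K then dK G K u else 0 := by
    intro u
    rw [← card_neighborFinset_eq_degree]
    split_ifs with hu
    · unfold dK
      congr 1
      ext t
      simp [hH, hu]
    · rw [Finset.card_eq_zero]
      ext t
      simp [hH, hu]
  simp only [h3]
  simp

end Blob

section Lab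
variable {X : Type} {N : LabGraph X}

theorem blob_of_cls (hG : CutConn N.G)
    (hdeg : ∀ u, (Finset.univ.filter (N.G.Adj u)).card ≤ 3) {w : N.V}
    (hK : 2 ≤ (cls N.G w).card) :
    N.IsBlob ((⊤ : N.G.Subgraph).induce (cls N.G w : Set N.V)) := by
  have h3 := three_le_card hG hK
  refine ⟨⟨?_, ?_, ?_⟩, ?_⟩
  · simpa using h3
  · apply sub_connected (T := cls N.G w) (by simp) _ (cls_cutConnOn hG w) ⟨w, self_mem_cls w⟩
    intro u hu v hv h
    simp [hu, hv, h]
  · intro z hz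
    have hz' : z ∈ cls N.G w := by simpa using hz
    apply sub_connected (T := (cls N.G w).erase z) _ _ (cls_erase_cutConnOn hG hdeg hz')
    · rw [← Finset.card_pos, Finset.card_erase_of_mem hz']; omega
    · ext t; simp [and_comm]
    · intro u hu v hv h
      simp only [Finset.mem_erase] at hu hv
      simp [hu, hv, h]
  · intro H' hH' hle
    have hv : ∀ u ∈ H'.verts, u ∈ cls N.G w := fun u hu =>
      blob_verts_sub hG hK hH'.2.1 hH'.2.2 (fun u hu => hle.1 (by simpa using hu)) hu
    apply le_antisymm _ hle
    refine ⟨?_, ?_⟩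
    · intro u hu; simpa using hv u hu
    · intro u v huv
      simp [hv u huv.fst_mem, hv v huv.snd_mem, huv.adj_sub]

theorem level_cases (hG : CutConn N.G)
    (hdeg : ∀ u, (Finset.univ.filter (N.G.Adj u)).card ≤ 3) (hl : N.IsLevel 2) {w : N.V}
    (hK : 2 ≤ (cls N.G w).card) :
    (∀ u ∈ cls N.G w, dK N.G (cls N.G w) u = 2) ∨
    ∃ P Q, P ∈ cls N.G w ∧ Q ∈ cls N.G w ∧ P ≠ Q ∧ dK N.G (cls N.G w) P = 3 ∧
      dK N.G (cls N.G w) Q = 3 ∧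
      ∀ u ∈ cls N.G w, u ≠ P → u ≠ Q → dK N.G (cls N.G w) u = 2 := by
  have hb := hl _ (blob_of_cls hG hdeg hK)
  have hs := sum_dK (G := N.G) (cls N.G w)
  set K := cls N.G w with hKdef
  set E := (((⊤ : N.G.Subgraph).induce (K : Set N.V)).edgeSet).ncard with hE
  have hv : ((⊤ : N.G.Subgraph).induce (K : Set N.V)).verts.ncard = K.card := by simp
  rw [hv] at hb
  have hd : ∀ u ∈ K, dK N.G K u = 2 + if dK N.G K u = 3 then 1 else 0 := by
    intro u hu
    have h1 := two_le_dK hG hK hu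
    have h2 := dK_le hdeg K u
    rw [← hKdef] at h1
    split_ifs <;> omega
  rw [Finset.sum_congr rfl hd, Finset.sum_add_distrib, ← Finset.card_filter] at hs
  simp only [Finset.sum_const, smul_eq_mul] at hs
  have hcard : (K.filter (fun u => dK N.G K u = 3)).card = 0 ∨
      (K.filter (fun u => dK N.G K u = 3)).card = 2 := by omega
  rcases hcard with h | h
  · left
    intro u hu
    rw [hd u hu]
    rw [Finset.card_eq_zero, Finset.filter_eq_empty_iff] at h
    simp [h hu]
  · right
    rw [Finset.card_eq_two] at h
    obtain ⟨P, Q, hPQ, h⟩ := h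
    have hm : ∀ u, (u ∈ K ∧ dK N.G K u = 3) ↔ (u = P ∨ u = Q) := by
      intro u
      have := Finset.ext_iff.1 h u
      simpa using this
    refine ⟨P, Q, ((hm P).2 (Or.inl rfl)).1, ((hm Q).2 (Or.inr rfl)).1, hPQ,
      ((hm P).2 (Or.inl rfl)).2, ((hm Q).2 (Or.inr rfl)).2, ?_⟩
    intro u hu hP hQ
    rw [hd u hu]
    have : ¬ dK N.G K u = 3 := fun hh => by
      rcases (hm u).1 ⟨hu, hh⟩ with h | h
      · exact hP h
      · exact hQ h
    simp [this]

end Lab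
end L2R

namespace L2R
set_option linter.unusedSectionVars false
open Polynomial
open scoped Classical

section Classify
variable {V : Type} [Fintype V] {G : SimpleGraph V}

theorem nbr_two {K : Finset V} {u x y : V} (hd : dK G K u = 2) (hxy : x ≠ y) (hx : x ∈ K)
    (hy : y ∈ K) (ax : G.Adj u x) (ay : G.Adj u y) (t : V) (ht : t ∈ K) :
    G.Adj u t ↔ t = x ∨ t = y := by
  have h : ({x, y} : Finset V) = K.filter (G.Adj u) := by
    apply Finset.eq_of_subset_of_card_le
    · intro z hz
      simp only [Finset.mem_insert, Finset.mem_singleton] at hz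
      rcases hz with rfl | rfl <;> simp [*]
    · rw [Finset.card_pair hxy]; exact hd.le
  have := Finset.ext_iff.1 h t
  simp only [Finset.mem_insert, Finset.mem_singleton, Finset.mem_filter] at this
  rw [this]; simp [ht]

theorem nbr_three {K : Finset V} {u x y z : V} (hd : dK G K u = 3) (hxy : x ≠ y) (hxz : x ≠ z)
    (hyz : y ≠ z) (hx : x ∈ K) (hy : y ∈ K) (hz : z ∈ K)
    (ax : G.Adj u x) (ay : G.Adj u y) (az : G.Adj u z) (t : V) (ht : t ∈ K) :
    G.Adj u t ↔ t = x ∨ t = y ∨ t = z := by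
  have h : ({x, y, z} : Finset V) = K.filter (G.Adj u) := by
    apply Finset.eq_of_subset_of_card_le
    · intro z hz
      simp only [Finset.mem_insert, Finset.mem_singleton] at hz
      rcases hz with rfl | rfl | rfl <;> simp [*]
    · rw [Finset.card_eq_three.2 ⟨x, y, z, hxy, hxz, hyz, rfl⟩]; exact hd.le
  have := Finset.ext_iff.1 h t
  simp only [Finset.mem_insert, Finset.mem_singleton, Finset.mem_filter] at this
  rw [this]; simp [ht]

theorem dK_erase {K : Finset V} {u x : V} (hx : x ∈ K) (h : G.Adj u x) :
    dK G (K.erase x) u + 1 = dK G K u := by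
  unfold dK
  rw [Finset.filter_erase]
  exact Finset.card_erase_add_one (by simp [hx, h])

theorem dK_mono {K K' : Finset V} (h : K ⊆ K') (u : V) : dK G K u ≤ dK G K' u :=
  Finset.card_le_card (Finset.filter_subset_filter _ h)

theorem peel {T : Finset V} (hT : CutConnOn G T) {a Q : V} (haT : a ∈ T) (hQT : Q ∈ T)
    (ha : a ≠ Q → dK G T a ≤ 1) (h2 : ∀ u ∈ T, u ≠ Q → dK G T u ≤ 2) :
    ∃ (k : ℕ) (y : ℕ → V), y 0 = a ∧ y k = Q ∧ (∀ i ≤ k, y i ∈ T) ∧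
      (∀ i ≤ k, ∀ j ≤ k, y i = y j → i = j) ∧
      (∀ i < k, G.Adj (y i) (y (i + 1))) ∧
      CutConnOn G (T \ (Finset.range k).image y) := by
  induction hn : T.card generalizing T a with
  | zero => rw [Finset.card_eq_zero] at hn; subst hn; simp at haT
  | succ n ih =>
    by_cases haQ : a = Q
    · subst haQ
      exact ⟨0, fun _ => a, rfl, rfl, by simp [haT], by simp, by simp, by simpa using hT⟩
    · obtain ⟨b, hbT, hab⟩ : ∃ b ∈ T, G.Adj a b := by
        by_contra hcon
        push Not at hcon
        have := hT {a} (by simpa using haT) (by simp) (by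
          intro x hx y hy _
          rw [Finset.mem_singleton] at hx; subst hx
          exact hcon y hy)
        rw [← this] at hQT
        simp at hQT; exact haQ hQT.symm
      have hb : ∀ t ∈ T, G.Adj a t → t = b := by
        intro t ht hat
        by_contra hne
        have h1 := ha haQ
        have : ({t, b} : Finset V) ⊆ T.filter (G.Adj a) := by
          intro z hz
          simp only [Finset.mem_insert, Finset.mem_singleton] at hz
          rcases hz with rfl | rfl <;> simp [*]
        have := Finset.card_le_card this
        rw [Finset.card_pair hne] at this
        unfold dK at h1; omega
      have hba : b ≠ a := hab.ne'
      have hT' : CutConnOn G (T.erase a) := by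
        intro U hU hne hcl
        by_cases hbU : b ∈ U
        · have := hT (insert a U) (by
              intro z hz
              rcases Finset.mem_insert.1 hz with rfl | hz
              · exact haT
              · exact (Finset.mem_erase.1 (hU hz)).2) (by simp) (by
              intro x hx y hy hyU hxy
              simp only [Finset.mem_insert, not_or] at hx hyU
              rcases hx with rfl | hx
              · exact hyU.2 (hb y hy hxy ▸ hbU)
              · exact hcl x hx y (by simp [hyU.1, hy]) hyU.2 hxy)
          rw [← this, Finset.erase_insert]
          intro h; simpa using hU h
        · exfalso
          have := hT U (hU.trans (Finset.erase_subset _ _)) hne (by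
            intro x hx y hy hyU hxy
            by_cases hya : y = a
            · subst hya
              have := hb x (Finset.mem_erase.1 (hU hx)).2 hxy.symm
              exact hbU (this ▸ hx)
            · exact hcl x hx y (by simp [hya, hy]) hyU hxy)
          rw [← this] at haT
          simpa using hU haT
      obtain ⟨k, y, hy0, hyk, hyT, hinj, hadj, hcc⟩ := ih hT' (a := b)
        (by simp [hba, hbT]) (by simp [Ne.symm haQ, hQT])
        (by
          intro hbQ
          have h3 := h2 b hbT hbQ
          have := dK_erase haT hab.symm
          omega)
        (by
          intro u hu huQ
          exact (dK_mono (Finset.erase_subset _ _) u).trans (h2 u (Finset.mem_erase.1 hu).2 huQ))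
        (by rw [Finset.card_erase_of_mem haT]; omega)
      refine ⟨k + 1, fun i => if i = 0 then a else y (i - 1), by simp, by simpa using hyk,
        ?_, ?_, ?_, ?_⟩
      · intro i hi
        rcases i with _ | i
        · simpa using haT
        · simpa using (Finset.mem_erase.1 (hyT i (by omega))).2
      · intro i hi j hj hij
        rcases i with _ | i <;> rcases j with _ | j
        · rfl
        · simp only [if_true, Nat.add_eq_zero_iff, one_ne_zero, and_false, if_false,
            Nat.add_sub_cancel] at hij
          exact absurd hij.symm (Finset.mem_erase.1 (hyT j (by omega))).1
        · simp only [if_true, Nat.add_eq_zero_iff, one_ne_zero, and_false, if_false,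
            Nat.add_sub_cancel] at hij
          exact absurd hij (Finset.mem_erase.1 (hyT i (by omega))).1
        · simp only [Nat.add_eq_zero_iff, one_ne_zero, and_false, if_false,
            Nat.add_sub_cancel] at hij
          rw [hinj i (by omega) j (by omega) hij]
      · intro i hi
        rcases i with _ | i
        · simpa [hy0] using hab
        · simpa using hadj i (by omega)
      · have : T \ (Finset.range (k + 1)).image (fun i => if i = 0 then a else y (i - 1)) =
            (T.erase a) \ (Finset.range k).image y := by
          ext t
          simp only [Finset.mem_sdiff, Finset.mem_image, Finset.mem_range, not_exists, not_and,
            Finset.mem_erase]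
          constructor
          · rintro ⟨h1, h2⟩
            refine ⟨⟨?_, h1⟩, ?_⟩
            · rintro rfl; exact h2 0 (by omega) (by simp)
            · intro i hi; simpa using h2 (i + 1) (by omega)
          · rintro ⟨⟨h0, h1⟩, h2⟩
            refine ⟨h1, ?_⟩
            intro i hi
            rcases i with _ | i
            · simpa using Ne.symm h0
            · simpa using h2 i (by omega)
        rw [this]; exact hcc

/-- Coordinates on a cycle core. -/
structure IsCyc (G : SimpleGraph V) (K : Finset V) (n : ℕ) (z : ℤ → V) : Prop where
  three : 3 ≤ n
  eqv : ∀ a b, z a = z b ↔ (n : ℤ) ∣ a - b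
  mem : ∀ a, z a ∈ K
  cover : ∀ u ∈ K, ∃ a, u = z a
  adj : ∀ a, ∀ u ∈ K, G.Adj (z a) u ↔ u = z (a - 1) ∨ u = z (a + 1)

theorem exists_cyc {K : Finset V} {w : V} (hw : w ∈ K) (hK : CutConnOn G (K.erase w))
    (hd : ∀ u ∈ K, dK G K u = 2) : ∃ n z, IsCyc G K n z ∧ z 0 = w := by
  have hdw := hd w hw
  obtain ⟨a, b, hab, hfil⟩ := Finset.card_eq_two.1 hdw
  have hmem : ∀ t, (t ∈ K ∧ G.Adj w t) ↔ t = a ∨ t = b := by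
    intro t
    have := Finset.ext_iff.1 hfil t
    simpa using this
  have ha := (hmem a).2 (Or.inl rfl)
  have hb := (hmem b).2 (Or.inr rfl)
  obtain ⟨k, y, hy0, hyk, hyT, hinj, hadj, hcc⟩ := peel hK (a := a) (Q := b)
    (by simp [ha.1, ha.2.ne']) (by simp [hb.1, hb.2.ne'])
    (by
      intro _
      have := dK_erase hw ha.2.symm
      have := hd a ha.1
      omega)
    (by
      intro u hu _
      rw [← hd u (Finset.mem_erase.1 hu).2]
      exact dK_mono (Finset.erase_subset _ _) u)
  have hk : 0 < k := by
    rcases Nat.eq_zero_or_pos k with rfl | h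
    · exact absurd (hy0.symm.trans hyk) hab
    · exact h
  have hyK : ∀ i ≤ k, y i ∈ K := fun i hi => (Finset.mem_erase.1 (hyT i hi)).2
  have hyw : ∀ i ≤ k, y i ≠ w := fun i hi => (Finset.mem_erase.1 (hyT i hi)).1
  have hbn := nbr_two (hd b hb.1) (hyw (k - 1) (by omega)) (hyK (k - 1) (by omega)) hw
    (by
      have := hadj (k - 1) (by omega)
      rw [Nat.sub_add_cancel hk, hyk] at this
      exact this.symm) hb.2.symm
  have hT1 := hcc {b} (by
      intro t ht
      rw [Finset.mem_singleton] at ht; subst ht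
      simp only [Finset.mem_sdiff, Finset.mem_image, Finset.mem_range, not_exists, not_and]
      refine ⟨by simp [hb.1, hb.2.ne'], ?_⟩
      intro i hi h
      rw [← hyk] at h
      have := hinj i (by omega) k le_rfl h
      omega) (by simp) (by
      intro x hx t ht htU hxt
      rw [Finset.mem_singleton] at hx; subst hx
      simp only [Finset.mem_sdiff, Finset.mem_image, Finset.mem_range, not_exists, not_and,
        Finset.mem_erase] at ht
      rcases (hbn t ht.1.2).1 hxt with h | h
      · exact ht.2 (k - 1) (by omega) h.symm
      · exact ht.1.1 h)
  have hcov : ∀ u ∈ K, u ≠ w → ∃ i ≤ k, u = y i := by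
    intro u hu huw
    by_cases h : ∃ i < k, u = y i
    · obtain ⟨i, hi, rfl⟩ := h; exact ⟨i, hi.le, rfl⟩
    · push Not at h
      have : u ∈ K.erase w \ (Finset.range k).image y := by
        simp only [Finset.mem_sdiff, Finset.mem_image, Finset.mem_range, not_exists, not_and,
          Finset.mem_erase]
        exact ⟨⟨huw, hu⟩, fun i hi hh => h i hi hh.symm⟩
      rw [← hT1, Finset.mem_singleton] at this
      exact ⟨k, le_rfl, this.trans hyk.symm⟩
  -- the periodic coordinate
  set Z : ℕ → V := fun i => if i = 0 then w else y (i - 1) with hZ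
  have Zinj : ∀ i < k + 2, ∀ j < k + 2, Z i = Z j → i = j := by
    intro i hi j hj hij
    rcases i with _ | i <;> rcases j with _ | j
    · rfl
    · simp [hZ] at hij; exact absurd hij.symm (hyw j (by omega))
    · simp [hZ] at hij; exact absurd hij (hyw i (by omega))
    · simp [hZ] at hij; rw [hinj i (by omega) j (by omega) hij]
  have Zadj : ∀ i, i + 1 < k + 2 → G.Adj (Z i) (Z (i + 1)) := by
    intro i hi
    rcases i with _ | i
    · simpa [hZ, hy0] using ha.2
    · simpa [hZ] using hadj i (by omega)
  have Zlast : G.Adj (Z (k + 1)) (Z 0) := by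
    simpa [hZ, hyk] using hb.2.symm
  have ZK : ∀ i < k + 2, Z i ∈ K := by
    intro i hi
    rcases i with _ | i
    · simpa [hZ] using hw
    · simpa [hZ] using hyK i (by omega)
  set n : ℕ := k + 2 with hn
  have hn0 : (n : ℤ) ≠ 0 := by omega
  have hnpos : (0 : ℤ) < n := by omega
  have hr : ∀ m : ℤ, (m % n).toNat < n := by
    intro m
    have := Int.emod_lt_of_pos m hnpos
    have := Int.emod_nonneg m hn0
    omega
  have heqv : ∀ a b : ℤ, Z (a % n).toNat = Z (b % n).toNat ↔ (n : ℤ) ∣ a - b := by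
    intro a b
    rw [Int.dvd_iff_emod_eq_zero, ← Int.emod_eq_emod_iff_emod_sub_eq_zero]
    constructor
    · intro h
      have := Zinj _ (hr a) _ (hr b) h
      have h1 := Int.emod_nonneg a hn0
      have h2 := Int.emod_nonneg b hn0
      omega
    · intro h; rw [h]
  have hadj1 : ∀ m : ℤ, G.Adj (Z (m % n).toNat) (Z ((m + 1) % n).toNat) := by
    intro m
    have h1 := Int.emod_nonneg m hn0
    have h2 := Int.emod_lt_of_pos m hnpos
    have h3 : (m + 1) % n = (m % n + 1) % n := by rw [Int.emod_add_emod]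
    by_cases h : m % n = n - 1
    · have : (m + 1) % n = 0 := by rw [h3, h]; simp
      rw [this, h]
      have : ((n : ℤ) - 1).toNat = k + 1 := by omega
      rw [this]; exact Zlast
    · have : (m + 1) % n = m % n + 1 := by rw [h3]; exact Int.emod_eq_of_lt (by omega) (by omega)
      rw [this]
      have : (m % n + 1).toNat = (m % n).toNat + 1 := by omega
      rw [this]
      exact Zadj _ (by omega)
  refine ⟨n, fun m => Z (m % n).toNat, ⟨by omega, heqv, fun m => ZK _ (hr m), ?_, ?_⟩, ?_⟩
  · intro u hu
    by_cases huw : u = w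
    · exact ⟨0, by simp [hZ, huw]⟩
    · obtain ⟨i, hi, rfl⟩ := hcov u hu huw
      refine ⟨(i + 1 : ℕ), ?_⟩
      have : (((i + 1 : ℕ) : ℤ) % n).toNat = i + 1 := by
        rw [Int.emod_eq_of_lt (by omega) (by omega)]; simp
      simp only [this]
      simp [hZ]
  · intro m
    apply nbr_two (hd _ (ZK _ (hr m))) _ (ZK _ (hr _)) (ZK _ (hr _))
    · have := hadj1 (m - 1)
      rw [Int.sub_add_cancel] at this
      exact this.symm
    · exact hadj1 m
    · intro h
      rw [heqv] at h
      have h' : (n : ℤ) ∣ 2 := by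
        have : m - 1 - (m + 1) = -2 := by ring
        rw [this] at h; exact (dvd_neg.1 h)
      have := Int.le_of_dvd (by norm_num) h'
      omega
  · simp [hZ]

end Classify
end L2R

namespace L2R
set_option linter.unusedSectionVars false
open Polynomial
open scoped Classical

section Theta
variable {V : Type} [Fintype V] {G : SimpleGraph V}

/-- Coordinates on a theta core: three arcs between the poles `P` and `Q`. -/
structure IsTheta (G : SimpleGraph V) (K : Finset V) (P Q : V) (l : Fin 3 → ℕ)
    (z : Fin 3 → ℕ → V) : Prop where
  pos : ∀ s, 1 ≤ l s
  one : ∀ s t, s ≠ t → l s = 1 → l t = 1 → False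
  zP : ∀ s, z s 0 = P
  zQ : ∀ s, z s (l s) = Q
  PK : P ∈ K
  QK : Q ∈ K
  PQ : P ≠ Q
  mem : ∀ s i, 0 < i → i < l s → z s i ∈ K
  neP : ∀ s i, 0 < i → i < l s → z s i ≠ P
  neQ : ∀ s i, 0 < i → i < l s → z s i ≠ Q
  inj : ∀ s i t j, 0 < i → i < l s → 0 < j → j < l t → z s i = z t j → s = t ∧ i = j
  cover : ∀ u ∈ K, u = P ∨ u = Q ∨ ∃ s i, 0 < i ∧ i < l s ∧ u = z s i
  adj : ∀ s i, 0 < i → i < l s → ∀ u ∈ K, G.Adj (z s i) u ↔ u = z s (i - 1) ∨ u = z s (i + 1)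
  adjP : ∀ u ∈ K, G.Adj P u ↔ ∃ s, u = z s 1
  adjQ : ∀ u ∈ K, G.Adj Q u ↔ ∃ s, u = z s (l s - 1)

theorem IsTheta.perm {K : Finset V} {P Q : V} {l : Fin 3 → ℕ} {z : Fin 3 → ℕ → V}
    (h : IsTheta G K P Q l z) (e : Equiv.Perm (Fin 3)) :
    IsTheta G K P Q (fun s => l (e s)) (fun s => z (e s)) where
  pos s := h.pos _
  one s t hst := h.one _ _ (fun hh => hst (e.injective hh))
  zP s := h.zP _
  zQ s := h.zQ _
  PK := h.PK
  QK := h.QK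
  PQ := h.PQ
  mem s := h.mem _
  neP s := h.neP _
  neQ s := h.neQ _
  inj s i t j hi hi' hj hj' hh := by
    have := h.inj _ i _ j hi hi' hj hj' hh
    exact ⟨e.injective this.1, this.2⟩
  cover u hu := by
    rcases h.cover u hu with h1 | h1 | ⟨s, i, h1, h2, h3⟩
    · exact Or.inl h1
    · exact Or.inr (Or.inl h1)
    · exact Or.inr (Or.inr ⟨e.symm s, i, h1, by simpa using h2, by simpa using h3⟩)
  adj s := h.adj _
  adjP u hu := by
    rw [h.adjP u hu]
    exact ⟨fun ⟨s, hs⟩ => ⟨e.symm s, by simpa using hs⟩, fun ⟨s, hs⟩ => ⟨e s, hs⟩⟩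
  adjQ u hu := by
    rw [h.adjQ u hu]
    exact ⟨fun ⟨s, hs⟩ => ⟨e.symm s, by simpa using hs⟩, fun ⟨s, hs⟩ => ⟨e s, hs⟩⟩

theorem IsTheta.rev {K : Finset V} {P Q : V} {l : Fin 3 → ℕ} {z : Fin 3 → ℕ → V}
    (h : IsTheta G K P Q l z) :
    IsTheta G K Q P l (fun s i => z s (l s - i)) where
  pos := h.pos
  one := h.one
  zP s := by simpa using h.zQ s
  zQ s := by simpa using h.zP s
  PK := h.QK
  QK := h.PK
  PQ := h.PQ.symm
  mem s i hi hi' := h.mem s _ (by omega) (by omega)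
  neP s i hi hi' := h.neQ s _ (by omega) (by omega)
  neQ s i hi hi' := h.neP s _ (by omega) (by omega)
  inj s i t j hi hi' hj hj' hh := by
    obtain ⟨rfl, h2⟩ := h.inj _ _ _ _ (by omega) (by omega) (by omega) (by omega) hh
    exact ⟨rfl, by omega⟩
  cover u hu := by
    rcases h.cover u hu with h1 | h1 | ⟨s, i, h1, h2, h3⟩
    · exact Or.inr (Or.inl h1)
    · exact Or.inl h1
    · refine Or.inr (Or.inr ⟨s, l s - i, by omega, by omega, ?_⟩)
      rw [h3]; congr 1; omega
  adj s i hi hi' u hu := by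
    rw [h.adj s _ (by omega) (by omega) u hu, or_comm]
    have e1 : l s - i + 1 = l s - (i - 1) := by omega
    have e2 : l s - i - 1 = l s - (i + 1) := by omega
    rw [e1, e2]
  adjP u hu := h.adjQ u hu
  adjQ u hu := by
    rw [h.adjP u hu]
    have : ∀ s, l s - (l s - 1) = 1 := fun s => by have := h.pos s; omega
    simp only [this]

/-- One leg from `P` towards `Q`. -/
theorem exists_leg {K T : Finset V} {P Q a : V} (hT : CutConnOn G T) (hTK : T ⊆ K.erase P)
    (hP : P ∈ K) (hQ : Q ∈ T) (ha : a ∈ T) (hPa : G.Adj P a)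
    (hd : ∀ u ∈ K, u ≠ P → u ≠ Q → dK G K u = 2) :
    ∃ (l : ℕ) (z : ℕ → V), 1 ≤ l ∧ z 0 = P ∧ z 1 = a ∧ z l = Q ∧
      (∀ i, 0 < i → i < l → z i ∈ T ∧ z i ≠ Q) ∧
      (∀ i j, 0 < i → i < l → 0 < j → j < l → z i = z j → i = j) ∧
      (∀ i, 0 < i → i < l → ∀ u ∈ K, G.Adj (z i) u ↔ u = z (i - 1) ∨ u = z (i + 1)) ∧
      (∀ i < l, G.Adj (z i) (z (i + 1))) ∧
      (∀ b, G.Adj P b → b ≠ a → ∀ i, 0 < i → i < l → z i ≠ b) ∧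
      CutConnOn G (T.filter (fun u => ∀ i, 0 < i → i < l → u ≠ z i)) := by
  have hTK' : ∀ u ∈ T, u ∈ K ∧ u ≠ P := fun u hu => by
    have := Finset.mem_erase.1 (hTK hu); exact ⟨this.2, this.1⟩
  obtain ⟨k, y, hy0, hyk, hyT, hinj, hadj, hcc⟩ := peel hT ha hQ
    (by
      intro haQ
      have h1 := dK_erase hP hPa.symm
      have h2 := hd a (hTK' a ha).1 (hTK' a ha).2 haQ
      have h3 := dK_mono (G := G) hTK a
      omega)
    (by
      intro u hu huQ
      have h2 := hd u (hTK' u hu).1 (hTK' u hu).2 huQ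
      have h3 := dK_mono (G := G) (hTK.trans (Finset.erase_subset _ _)) u
      omega)
  set z : ℕ → V := fun i => if i = 0 then P else y (i - 1) with hz
  have z0 : z 0 = P := by simp [hz]
  have zs : ∀ i, z (i + 1) = y i := by intro i; simp [hz]
  have hadj' : ∀ i < k + 1, G.Adj (z i) (z (i + 1)) := by
    intro i hi
    rcases i with _ | i
    · rw [z0, zs, hy0]; exact hPa
    · rw [zs, zs]; exact hadj i (by omega)
  have hint : ∀ i, 0 < i → i < k + 1 → z i ∈ T ∧ z i ≠ Q := by
    intro i hi hi'
    obtain ⟨i, rfl⟩ : ∃ j, i = j + 1 := ⟨i - 1, by omega⟩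
    rw [zs]
    refine ⟨hyT i (by omega), ?_⟩
    rw [← hyk]
    intro h
    have := hinj i (by omega) k le_rfl h
    omega
  have zK : ∀ i ≤ k + 1, z i ∈ K := by
    intro i hi
    rcases i with _ | i
    · rw [z0]; exact hP
    · rw [zs]; exact (hTK' _ (hyT i (by omega))).1
  have hnbr : ∀ i, 0 < i → i < k + 1 → ∀ u ∈ K, G.Adj (z i) u ↔ u = z (i - 1) ∨ u = z (i + 1) := by
    intro i hi hi'
    have h1 := hint i hi hi'
    have h2 := hTK' _ h1.1
    apply nbr_two (hd _ h2.1 h2.2 h1.2) _ (zK _ (by omega)) (zK _ (by omega))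
    · have := hadj' (i - 1) (by omega)
      rw [Nat.sub_add_cancel hi] at this
      exact this.symm
    · exact hadj' i hi'
    · obtain ⟨i, rfl⟩ : ∃ j, i = j + 1 := ⟨i - 1, by omega⟩
      simp only [Nat.add_sub_cancel]
      rw [zs]
      rcases i with _ | i
      · rw [z0]; exact (hTK' _ (hyT 1 (by omega))).2.symm
      · rw [zs]
        intro h
        have := hinj i (by omega) (i + 1 + 1) (by omega) h
        omega
  refine ⟨k + 1, z, by omega, z0, by rw [zs, hy0], by rw [zs, hyk], hint, ?_, hnbr, hadj', ?_, ?_⟩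
  · intro i j hi hi' hj hj' h
    obtain ⟨i, rfl⟩ : ∃ j, i = j + 1 := ⟨i - 1, by omega⟩
    obtain ⟨j, rfl⟩ : ∃ i, j = i + 1 := ⟨j - 1, by omega⟩
    rw [zs, zs] at h
    rw [hinj i (by omega) j (by omega) h]
  · intro b hPb hba i hi hi' h
    have := (hnbr i hi hi' P hP).1 (by rw [h]; exact hPb.symm)
    rcases this with h1 | h1
    · obtain ⟨i, rfl⟩ : ∃ j, i = j + 1 := ⟨i - 1, by omega⟩
      rcases i with _ | i
      · rw [zs, hy0] at h; exact hba h.symm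
      · simp only [Nat.add_sub_cancel] at h1
        rw [zs] at h1
        exact (hTK' _ (hyT i (by omega))).2 h1.symm
    · rw [zs] at h1
      exact (hTK' _ (hyT i (by omega))).2 h1.symm
  · convert hcc using 1
    ext u
    simp only [Finset.mem_filter, Finset.mem_sdiff, Finset.mem_image, Finset.mem_range, not_exists,
      not_and]
    refine and_congr_right fun _ => ⟨fun h i hi hh => ?_, fun h i hi hi' hh => ?_⟩
    · exact h (i + 1) (by omega) (by omega) (by rw [zs, hh])
    · apply h (i - 1) (by omega)
      rw [hh]
      obtain ⟨i, rfl⟩ : ∃ j, i = j + 1 := ⟨i - 1, by omega⟩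
      rw [zs]; simp

theorem exists_theta {K : Finset V} {P Q : V} (hPK : P ∈ K) (hQK : Q ∈ K) (hPQ : P ≠ Q)
    (hK : CutConnOn G (K.erase P)) (hdP : dK G K P = 3) (hdQ : dK G K Q = 3)
    (hd : ∀ u ∈ K, u ≠ P → u ≠ Q → dK G K u = 2) : ∃ l z, IsTheta G K P Q l z := by
  obtain ⟨a, b, c, hab, hac, hbc, hfil⟩ := Finset.card_eq_three.1 hdP
  have hmem : ∀ t, (t ∈ K ∧ G.Adj P t) ↔ t = a ∨ t = b ∨ t = c := by
    intro t
    have := Finset.ext_iff.1 hfil t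
    simpa using this
  have ha := (hmem a).2 (Or.inl rfl)
  have hb := (hmem b).2 (Or.inr (Or.inl rfl))
  have hc := (hmem c).2 (Or.inr (Or.inr rfl))
  obtain ⟨l0, z0, l0p, z00, z01, z0Q, z0T, z0inj, z0nbr, z0adj, z0b, hT1⟩ :=
    exists_leg hK (Finset.Subset.refl _) hPK (by simp [hQK, hPQ.symm])
      (by simp [ha.1, ha.2.ne']) ha.2 hd
  set T1 := (K.erase P).filter (fun u => ∀ i, 0 < i → i < l0 → u ≠ z0 i) with hT1d
  have hT1K : T1 ⊆ K.erase P := Finset.filter_subset _ _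
  have hQ1 : Q ∈ T1 := by
    simp only [hT1d, Finset.mem_filter, Finset.mem_erase]
    exact ⟨⟨hPQ.symm, hQK⟩, fun i hi hi' => (z0T i hi hi').2.symm⟩
  have hb1 : b ∈ T1 := by
    simp only [hT1d, Finset.mem_filter, Finset.mem_erase]
    exact ⟨⟨hb.2.ne', hb.1⟩, fun i hi hi' => (z0b b hb.2 hab.symm i hi hi').symm⟩
  have hc1 : c ∈ T1 := by
    simp only [hT1d, Finset.mem_filter, Finset.mem_erase]
    exact ⟨⟨hc.2.ne', hc.1⟩, fun i hi hi' => (z0b c hc.2 hac.symm i hi hi').symm⟩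
  obtain ⟨l1, z1, l1p, z10, z11, z1Q, z1T, z1inj, z1nbr, z1adj, z1b, hT2⟩ :=
    exists_leg hT1 hT1K hPK hQ1 hb1 hb.2 hd
  set T2 := T1.filter (fun u => ∀ i, 0 < i → i < l1 → u ≠ z1 i) with hT2d
  have hT21 : T2 ⊆ T1 := Finset.filter_subset _ _
  have hQ2 : Q ∈ T2 := by
    simp only [hT2d, Finset.mem_filter]
    exact ⟨hQ1, fun i hi hi' => (z1T i hi hi').2.symm⟩
  have hc2 : c ∈ T2 := by
    simp only [hT2d, Finset.mem_filter]
    exact ⟨hc1, fun i hi hi' => (z1b c hc.2 hbc.symm i hi hi').symm⟩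
  obtain ⟨l2, z2, l2p, z20, z21, z2Q, z2T, z2inj, z2nbr, z2adj, z2b, hT3⟩ :=
    exists_leg hT2 (hT21.trans hT1K) hPK hQ2 hc2 hc.2 hd
  set T3 := T2.filter (fun u => ∀ i, 0 < i → i < l2 → u ≠ z2 i) with hT3d
  have hQ3 : Q ∈ T3 := by
    simp only [hT3d, Finset.mem_filter]
    exact ⟨hQ2, fun i hi hi' => (z2T i hi hi').2.symm⟩
  have d01 : ∀ i j, 0 < i → i < l0 → 0 < j → j < l1 → z0 i ≠ z1 j := by
    intro i j hi hi' hj hj' h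
    have := (z1T j hj hj').1
    simp only [hT1d, Finset.mem_filter] at this
    exact this.2 i hi hi' h.symm
  have d02 : ∀ i j, 0 < i → i < l0 → 0 < j → j < l2 → z0 i ≠ z2 j := by
    intro i j hi hi' hj hj' h
    have := hT21 (z2T j hj hj').1
    simp only [hT1d, Finset.mem_filter] at this
    exact this.2 i hi hi' h.symm
  have d12 : ∀ i j, 0 < i → i < l1 → 0 < j → j < l2 → z1 i ≠ z2 j := by
    intro i j hi hi' hj hj' h
    have := (z2T j hj hj').1
    simp only [hT2d, Finset.mem_filter] at this
    exact this.2 i hi hi' h.symm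
  have iK0 : ∀ i, 0 < i → i < l0 → z0 i ∈ K ∧ z0 i ≠ P := fun i hi hi' => by
    have := Finset.mem_erase.1 (z0T i hi hi').1; exact ⟨this.2, this.1⟩
  have iK1 : ∀ i, 0 < i → i < l1 → z1 i ∈ K ∧ z1 i ≠ P := fun i hi hi' => by
    have := Finset.mem_erase.1 (hT1K (z1T i hi hi').1); exact ⟨this.2, this.1⟩
  have iK2 : ∀ i, 0 < i → i < l2 → z2 i ∈ K ∧ z2 i ≠ P := fun i hi hi' => by
    have := Finset.mem_erase.1 (hT1K (hT21 (z2T i hi hi').1)); exact ⟨this.2, this.1⟩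
  -- at most one short arc
  have o01 : ¬ (l0 = 1 ∧ l1 = 1) := by
    rintro ⟨rfl, rfl⟩; rw [z01] at z0Q; rw [z11] at z1Q; exact hab (z0Q.trans z1Q.symm)
  have o02 : ¬ (l0 = 1 ∧ l2 = 1) := by
    rintro ⟨rfl, rfl⟩; rw [z01] at z0Q; rw [z21] at z2Q; exact hac (z0Q.trans z2Q.symm)
  have o12 : ¬ (l1 = 1 ∧ l2 = 1) := by
    rintro ⟨rfl, rfl⟩; rw [z11] at z1Q; rw [z21] at z2Q; exact hbc (z1Q.trans z2Q.symm)
  -- neighbours of Q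
  have e0 : z0 (l0 - 1) ∈ K ∧ G.Adj Q (z0 (l0 - 1)) := by
    constructor
    · by_cases h : l0 = 1
      · subst h; simpa [z00] using hPK
      · exact (iK0 _ (by omega) (by omega)).1
    · have := z0adj (l0 - 1) (by omega)
      rw [Nat.sub_add_cancel l0p, z0Q] at this
      exact this.symm
  have e1 : z1 (l1 - 1) ∈ K ∧ G.Adj Q (z1 (l1 - 1)) := by
    constructor
    · by_cases h : l1 = 1
      · subst h; simpa [z10] using hPK
      · exact (iK1 _ (by omega) (by omega)).1
    · have := z1adj (l1 - 1) (by omega)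
      rw [Nat.sub_add_cancel l1p, z1Q] at this
      exact this.symm
  have e2 : z2 (l2 - 1) ∈ K ∧ G.Adj Q (z2 (l2 - 1)) := by
    constructor
    · by_cases h : l2 = 1
      · subst h; simpa [z20] using hPK
      · exact (iK2 _ (by omega) (by omega)).1
    · have := z2adj (l2 - 1) (by omega)
      rw [Nat.sub_add_cancel l2p, z2Q] at this
      exact this.symm
  have n01 : z0 (l0 - 1) ≠ z1 (l1 - 1) := by
    by_cases h : l0 = 1
    · have := (iK1 (l1 - 1) (by omega) (by omega)).2
      rw [h]; simpa [z00] using this.symm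
    · by_cases h' : l1 = 1
      · have := (iK0 (l0 - 1) (by omega) (by omega)).2
        rw [h']; simpa [z10] using this
      · exact d01 _ _ (by omega) (by omega) (by omega) (by omega)
  have n02 : z0 (l0 - 1) ≠ z2 (l2 - 1) := by
    by_cases h : l0 = 1
    · have := (iK2 (l2 - 1) (by omega) (by omega)).2
      rw [h]; simpa [z00] using this.symm
    · by_cases h' : l2 = 1
      · have := (iK0 (l0 - 1) (by omega) (by omega)).2
        rw [h']; simpa [z20] using this
      · exact d02 _ _ (by omega) (by omega) (by omega) (by omega)
  have n12 : z1 (l1 - 1) ≠ z2 (l2 - 1) := by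
    by_cases h : l1 = 1
    · have := (iK2 (l2 - 1) (by omega) (by omega)).2
      rw [h]; simpa [z10] using this.symm
    · by_cases h' : l2 = 1
      · have := (iK1 (l1 - 1) (by omega) (by omega)).2
        rw [h']; simpa [z20] using this
      · exact d12 _ _ (by omega) (by omega) (by omega) (by omega)
  have hQn := nbr_three hdQ n01 n02 n12 e0.1 e1.1 e2.1 e0.2 e1.2 e2.2
  -- nothing else is left
  have hm3 : ∀ u, u ∈ T3 ↔ (u ∈ K ∧ u ≠ P ∧ (∀ i, 0 < i → i < l0 → u ≠ z0 i) ∧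
      (∀ i, 0 < i → i < l1 → u ≠ z1 i) ∧ (∀ i, 0 < i → i < l2 → u ≠ z2 i)) := by
    intro u
    simp only [hT3d, hT2d, hT1d, Finset.mem_filter, Finset.mem_erase]
    tauto
  have hT3Q := hT3 {Q} (by simpa using hQ3) (by simp) (by
    intro x hx y hy hyU hxy
    rw [Finset.mem_singleton] at hx; subst hx
    rw [hm3] at hy
    obtain ⟨hyK, hyP, h0, h1, h2⟩ := hy
    rcases (hQn y hyK).1 hxy with h | h | h
    · by_cases hl : l0 = 1
      · rw [hl] at h; simp [z00] at h; exact hyP h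
      · exact h0 (l0 - 1) (by omega) (by omega) h
    · by_cases hl : l1 = 1
      · rw [hl] at h; simp [z10] at h; exact hyP h
      · exact h1 (l1 - 1) (by omega) (by omega) h
    · by_cases hl : l2 = 1
      · rw [hl] at h; simp [z20] at h; exact hyP h
      · exact h2 (l2 - 1) (by omega) (by omega) h)
  refine ⟨![l0, l1, l2], ![z0, z1, z2], ?_⟩
  refine ⟨?_, ?_, ?_, ?_, hPK, hQK, hPQ, ?_, ?_, ?_, ?_, ?_, ?_, ?_, ?_⟩
  · intro s; fin_cases s <;> simpa
  · intro s t hst h h'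
    fin_cases s <;> fin_cases t <;> simp at hst h h' <;> first | omega | tauto
  · intro s; fin_cases s <;> simpa
  · intro s; fin_cases s <;> simpa
  · intro s i hi hi'
    fin_cases s
    · exact (iK0 i hi hi').1
    · exact (iK1 i hi hi').1
    · exact (iK2 i hi hi').1
  · intro s i hi hi'
    fin_cases s
    · exact (iK0 i hi hi').2
    · exact (iK1 i hi hi').2
    · exact (iK2 i hi hi').2
  · intro s i hi hi'
    fin_cases s
    · exact (z0T i hi hi').2
    · exact (z1T i hi hi').2
    · exact (z2T i hi hi').2
  · intro s i t j hi hi' hj hj' h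
    fin_cases s <;> fin_cases t
    · exact ⟨rfl, z0inj i j hi hi' hj hj' h⟩
    · exact absurd h (d01 i j hi hi' hj hj')
    · exact absurd h (d02 i j hi hi' hj hj')
    · exact absurd h.symm (d01 j i hj hj' hi hi')
    · exact ⟨rfl, z1inj i j hi hi' hj hj' h⟩
    · exact absurd h (d12 i j hi hi' hj hj')
    · exact absurd h.symm (d02 j i hj hj' hi hi')
    · exact absurd h.symm (d12 j i hj hj' hi hi')
    · exact ⟨rfl, z2inj i j hi hi' hj hj' h⟩
  · intro u hu
    by_contra hcon
    push Not at hcon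
    obtain ⟨h1, h2, h3⟩ := hcon
    have : u ∈ T3 := by
      rw [hm3]
      exact ⟨hu, h1, fun i hi hi' => h3 0 i hi hi', fun i hi hi' => h3 1 i hi hi',
        fun i hi hi' => h3 2 i hi hi'⟩
    rw [← hT3Q, Finset.mem_singleton] at this
    exact h2 this
  · intro s i hi hi'
    fin_cases s
    · exact z0nbr i hi hi'
    · exact z1nbr i hi hi'
    · exact z2nbr i hi hi'
  · intro u hu
    have := hmem u
    simp only [hu, true_and] at this
    rw [this, Fin.exists_fin_succ, Fin.exists_fin_two]
    simp [z01, z11, z21]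
  · intro u hu
    rw [hQn u hu, Fin.exists_fin_succ, Fin.exists_fin_two]
    simp

end Theta
end L2R

namespace L2R
set_option linter.unusedSectionVars false
open Polynomial
open scoped Classical

section Eval
variable {V : Type} [Fintype V] {G : SimpleGraph V}

theorem gf_stepA {K T A : Finset V} {u v : V} (hTK : T ⊆ K) (hu : u ∈ T) (huv : u ≠ v)
    (hA : ∀ t ∈ K, G.Adj u t ↔ t ∈ A) :
    gf G T u v = X * ∑ t ∈ A, gf G (T.erase u) t v := by
  rw [gf_step' G hu huv]
  congr 1
  have : (T.erase u).filter (fun y => G.Adj u y) ⊆ A := by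
    intro t ht
    simp only [Finset.mem_filter, Finset.mem_erase] at ht
    exact (hA t (hTK ht.1.2)).1 ht.2
  apply Finset.sum_subset this
  intro t ht hn
  apply gf_notMem
  intro ht'
  apply hn
  simp only [Finset.mem_filter]
  exact ⟨ht', (hA t (hTK (Finset.mem_erase.1 ht').2)).2 ht⟩

theorem gf_slide {K T : Finset V} {y : ℕ → V} {k : ℕ} {v : V} (hTK : T ⊆ K)
    (hn : ∀ i < k, ∀ u ∈ K, G.Adj (y (i + 1)) u ↔ u = y i ∨ u = y (i + 2))
    (hmem : ∀ i < k, y (i + 1) ∈ T) (h0 : y 0 ∉ T)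
    (hinj : ∀ i < k, ∀ j < k, i < j → y (i + 1) ≠ y (j + 1)) (hv : ∀ i < k, y (i + 1) ≠ v) :
    gf G T (y 1) v =
      X ^ k * gf G (T.filter (fun u => ∀ i < k, u ≠ y (i + 1))) (y (k + 1)) v := by
  induction k generalizing T y with
  | zero => simp
  | succ k ih =>
    have h1T : y 1 ∈ T := hmem 0 (by omega)
    have key : gf G T (y 1) v = X * gf G (T.erase (y 1)) (y 2) v := by
      rw [gf_stepA hTK h1T (hv 0 (by omega)) (A := {y 0, y 2})
        (by intro t ht; rw [hn 0 (by omega) t ht]; simp)]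
      by_cases h02 : y 0 = y 2
      · simp [h02]
      · rw [Finset.sum_pair h02, gf_notMem G (u := y 0) (by simp [h0]), zero_add]
    rw [key]
    have := ih (T := T.erase (y 1)) (y := fun i => y (i + 1))
      ((Finset.erase_subset _ _).trans hTK)
      (fun i hi u hu => hn (i + 1) (by omega) u hu)
      (fun i hi => by
        simp only [Finset.mem_erase]
        exact ⟨(hinj 0 (by omega) (i + 1) (by omega) (by omega)).symm, hmem (i + 1) (by omega)⟩)
      (by simp)
      (fun i hi j hj hij => hinj (i + 1) (by omega) (j + 1) (by omega) (by omega))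
      (fun i hi => hv (i + 1) (by omega))
    have this' : gf G (T.erase (y 1)) (y 2) v = _ := this
    rw [this', ← mul_assoc, ← pow_succ']
    congr 2
    ext u
    simp only [Finset.mem_filter, Finset.mem_erase]
    constructor
    · rintro ⟨⟨h1, h2⟩, h3⟩
      refine ⟨h2, fun i hi => ?_⟩
      rcases i with _ | i
      · exact h1
      · exact h3 i (by omega)
    · rintro ⟨h2, h3⟩
      exact ⟨⟨h3 0 (by omega), h2⟩, fun i hi => h3 (i + 1) (by omega)⟩

theorem IsCyc.ne {K : Finset V} {n : ℕ} {z : ℤ → V} (h : IsCyc G K n z) {a b : ℤ}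
    (h1 : a < b) (h2 : b < a + n) : z a ≠ z b := by
  intro he
  rw [h.eqv] at he
  obtain ⟨c, hc⟩ := he
  have hn : (0 : ℤ) < n := by have := h.three; omega
  have : c < 0 := by nlinarith
  have : -1 < c := by nlinarith
  omega

theorem gf_cyc {K : Finset V} {n : ℕ} {z : ℤ → V} (h : IsCyc G K n z) (a : ℤ) {d : ℕ}
    (hd : 0 < d) (hdn : d < n) :
    gf G K (z a) (z (a + d)) = X ^ d + X ^ (n - d) := by
  have h3 := h.three
  rw [gf_stepA (Finset.Subset.refl K) (h.mem a) (h.ne (by omega) (by omega))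
    (A := {z (a - 1), z (a + 1)}) (by intro t ht; rw [h.adj a t ht]; simp)]
  rw [Finset.sum_pair (h.ne (by omega) (by omega))]
  have s1 := gf_slide (G := G) (K := K) (T := K.erase (z a)) (y := fun t => z (a + t)) (k := d - 1)
    (v := z (a + d)) (Finset.erase_subset _ _)
    (by
      intro i hi u hu
      rw [h.adj _ u hu]
      push_cast
      rw [show a + (i + 1 : ℤ) - 1 = a + i by ring, show a + (i + 1 : ℤ) + 1 = a + (i + 2) by ring])
    (by
      intro i hi
      simp only [Finset.mem_erase]
      exact ⟨(h.ne (by push_cast; omega) (by push_cast; omega)).symm, h.mem _⟩)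
    (by simp)
    (by
      intro i hi j hj hij
      exact h.ne (by push_cast; omega) (by push_cast; omega))
    (by
      intro i hi
      exact h.ne (by push_cast; omega) (by push_cast; omega))
  have s2 := gf_slide (G := G) (K := K) (T := K.erase (z a)) (y := fun t => z (a - t))
    (k := n - d - 1)
    (v := z (a + d)) (Finset.erase_subset _ _)
    (by
      intro i hi u hu
      rw [h.adj _ u hu, or_comm]
      push_cast
      rw [show a - (i + 1 : ℤ) + 1 = a - i by ring, show a - (i + 1 : ℤ) - 1 = a - (i + 2) by ring])
    (by
      intro i hi
      simp only [Finset.mem_erase]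
      exact ⟨(h.ne (by push_cast; omega) (by push_cast; omega)), h.mem _⟩)
    (by simp)
    (by
      intro i hi j hj hij
      exact (h.ne (by push_cast; omega) (by push_cast; omega)).symm)
    (by
      intro i hi
      exact h.ne (by push_cast; omega) (by push_cast; omega))
  have e1 : z (a + ((d - 1 + 1 : ℕ) : ℤ)) = z (a + d) := by
    congr 2; omega
  have e2 : z (a - ((n - d - 1 + 1 : ℕ) : ℤ)) = z (a + d) := by
    rw [h.eqv]
    exact ⟨-1, by rw [show n - d - 1 + 1 = n - d by omega]; push_cast [hdn.le]; ring⟩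
  simp only [Nat.cast_one] at s1 s2
  rw [e1, gf_self] at s1
  · rw [e2, gf_self] at s2
    · rw [s1, s2, mul_one, mul_one, mul_add, ← pow_succ', ← pow_succ', add_comm]
      congr 2 <;> omega
    · simp only [Finset.mem_filter, Finset.mem_erase]
      refine ⟨⟨(h.ne (by omega) (by omega)).symm, h.mem _⟩, fun i hi => ?_⟩
      exact (h.ne (by push_cast; omega) (by push_cast; omega)).symm
  · simp only [Finset.mem_filter, Finset.mem_erase]
    refine ⟨⟨(h.ne (by omega) (by omega)).symm, h.mem _⟩, fun i hi => ?_⟩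
    exact (h.ne (by push_cast; omega) (by push_cast; omega)).symm

variable {K : Finset V} {P Q : V} {l : Fin 3 → ℕ} {z : Fin 3 → ℕ → V}

theorem IsTheta.slideDown (h : IsTheta G K P Q l z) {T : Finset V} (hT : T ⊆ K) {s : Fin 3}
    {i j : ℕ} {v : V} (hji : j < i) (hi : i ≤ l s) (h0 : z s i ∉ T)
    (hm : ∀ m, j < m → m < i → z s m ∈ T ∧ z s m ≠ v) :
    gf G T (z s (i - 1)) v = X ^ (i - 1 - j) *
      gf G (T.filter (fun u => ∀ m, j < m → m < i → u ≠ z s m)) (z s j) v := by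
  have := gf_slide (G := G) (K := K) (T := T) (y := fun t => z s (i - t)) (k := i - 1 - j)
    (v := v) hT
    (by
      intro a ha u hu
      rw [h.adj s _ (by omega) (by omega) u hu, or_comm]
      rw [show i - (a + 1) + 1 = i - a by omega, show i - (a + 1) - 1 = i - (a + 2) by omega])
    (by intro a ha; exact (hm _ (by omega) (by omega)).1)
    (by simpa using h0)
    (by
      intro a ha b hb hab he
      have := (h.inj s _ s _ (by omega) (by omega) (by omega) (by omega) he).2
      omega)
    (by intro a ha; exact (hm _ (by omega) (by omega)).2)
  rw [this]
  congr 1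
  rw [show i - (i - 1 - j + 1) = j by omega]
  congr 1
  ext u
  simp only [Finset.mem_filter]
  refine and_congr_right fun _ => ⟨fun hh m h1 h2 => ?_, fun hh a ha => hh _ (by omega) (by omega)⟩
  have := hh (i - 1 - m) (by omega)
  rwa [show i - (i - 1 - m + 1) = m by omega] at this

theorem IsTheta.hitDown (h : IsTheta G K P Q l z) {T : Finset V} (hT : T ⊆ K) {s : Fin 3}
    {i j : ℕ} (hj : 0 < j) (hji : j < i) (hi : i ≤ l s) (h0 : z s i ∉ T)
    (hm : ∀ m, j ≤ m → m < i → z s m ∈ T) :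
    gf G T (z s (i - 1)) (z s j) = X ^ (i - 1 - j) := by
  have hne : ∀ m, j < m → m < i → z s m ≠ z s j := fun m h1 h2 he => by
    have := (h.inj s _ s _ (by omega) (by omega) (by omega) (by omega) he).2
    omega
  rw [h.slideDown hT hji hi h0 (fun m h1 h2 => ⟨hm m h1.le h2, hne m h1 h2⟩), gf_self, mul_one]
  simp only [Finset.mem_filter]
  exact ⟨hm j le_rfl hji, fun m h1 h2 => (hne m h1 h2).symm⟩

theorem IsTheta.deadDown (h : IsTheta G K P Q l z) {T : Finset V} (hT : T ⊆ K) {s : Fin 3}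
    {i j : ℕ} {v : V} (hji : j < i) (hi : i ≤ l s) (h0 : z s i ∉ T)
    (hm : ∀ m, j < m → m < i → z s m ∈ T ∧ z s m ≠ v) (hd : z s j ∉ T) :
    gf G T (z s (i - 1)) v = 0 := by
  rw [h.slideDown hT hji hi h0 hm, gf_notMem, mul_zero]
  simp [hd]

theorem IsTheta.z1_ne (h : IsTheta G K P Q l z) {s t : Fin 3} (hst : s ≠ t) :
    z s 1 ≠ z t 1 := by
  have h1 := h.pos s
  have h2 := h.pos t
  have h3 := h.one s t hst
  intro he
  by_cases e1 : l s = 1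
  · have := h.zQ s
    rw [e1] at this
    rw [this] at he
    exact h.neQ t 1 (by omega) (by by_contra hh; exact h3 e1 (by omega)) he.symm
  · by_cases e2 : l t = 1
    · have := h.zQ t
      rw [e2] at this
      rw [this] at he
      exact h.neQ s 1 (by omega) (by omega) he
    · exact hst (h.inj s 1 t 1 (by omega) (by omega) (by omega) (by omega) he).1

theorem IsTheta.stepP (h : IsTheta G K P Q l z) {T : Finset V} (hT : T ⊆ K) (hP : P ∈ T) {v : V}
    (hv : P ≠ v) {s t r : Fin 3} (hst : s ≠ t) (hsr : s ≠ r) (htr : t ≠ r) :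
    gf G T P v = X * (gf G (T.erase P) (z s 1) v + gf G (T.erase P) (z t 1) v +
      gf G (T.erase P) (z r 1) v) := by
  rw [gf_stepA hT hP hv (A := {z s 1, z t 1, z r 1})]
  · rw [Finset.sum_insert, Finset.sum_pair (h.z1_ne htr), add_assoc]
    simp [h.z1_ne hst, h.z1_ne hsr]
  · intro u hu
    rw [h.adjP u hu]
    simp only [Finset.mem_insert, Finset.mem_singleton]
    constructor
    · rintro ⟨a, rfl⟩
      have : a = s ∨ a = t ∨ a = r := by omega
      rcases this with rfl | rfl | rfl <;> simp
    · rintro (h | h | h)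
      exacts [⟨s, h⟩, ⟨t, h⟩, ⟨r, h⟩]

theorem IsTheta.stepQ (h : IsTheta G K P Q l z) {T : Finset V} (hT : T ⊆ K) (hQ : Q ∈ T) {v : V}
    (hv : Q ≠ v) {s t r : Fin 3} (hst : s ≠ t) (hsr : s ≠ r) (htr : t ≠ r) :
    gf G T Q v = X * (gf G (T.erase Q) (z s (l s - 1)) v + gf G (T.erase Q) (z t (l t - 1)) v +
      gf G (T.erase Q) (z r (l r - 1)) v) :=
  h.rev.stepP hT hQ hv hst hsr htr

/-- From the pole `P`, run over the whole arc `t` and arrive at `Q`. -/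
theorem IsTheta.slideUpFull (h : IsTheta G K P Q l z) {T : Finset V} (hT : T ⊆ K) {t : Fin 3}
    {v : V} (h0 : P ∉ T) (hm : ∀ m, 0 < m → m < l t → z t m ∈ T ∧ z t m ≠ v) :
    gf G T (z t 1) v = X ^ (l t - 1) *
      gf G (T.filter (fun u => ∀ m, 0 < m → m < l t → u ≠ z t m)) Q v := by
  have hp := h.pos t
  have := h.rev.slideDown hT (s := t) (i := l t) (j := 0) (v := v) (by omega) le_rfl
    (by simpa [h.zP] using h0)
    (fun m h1 h2 => hm _ (by omega) (by omega))
  simp only [Nat.sub_zero, h.zQ] at this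
  rw [show l t - (l t - 1) = 1 by omega] at this
  rw [this]
  congr 2
  ext u
  simp only [Finset.mem_filter]
  refine and_congr_right fun _ => ⟨fun hh m h1 h2 => ?_, fun hh a ha hb => hh _ (by omega) (by omega)⟩
  have := hh (l t - m) (by omega) (by omega)
  rwa [show l t - (l t - m) = m by omega] at this

theorem IsTheta.hitUp (h : IsTheta G K P Q l z) {T : Finset V} (hT : T ⊆ K) {s : Fin 3}
    {i j : ℕ} (hij : i < j) (hj : j < l s) (h0 : z s i ∉ T)
    (hm : ∀ m, i < m → m ≤ j → z s m ∈ T) :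
    gf G T (z s (i + 1)) (z s j) = X ^ (j - i - 1) := by
  have := h.rev.hitDown hT (s := s) (i := l s - i) (j := l s - j) (by omega) (by omega) (by omega)
    (by rwa [show l s - (l s - i) = i by omega])
    (fun m h1 h2 => hm _ (by omega) (by omega))
  rw [show l s - (l s - i - 1) = i + 1 by omega, show l s - (l s - j) = j by omega] at this
  rw [this]
  congr 1; omega

theorem IsTheta.ne (h : IsTheta G K P Q l z) {s t : Fin 3} (hst : s ≠ t) {i j : ℕ} (hi : 0 < i)
    (hi' : i < l s) (hj : 0 < j) (hj' : j < l t) : z s i ≠ z t j := fun he =>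
  hst (h.inj s i t j hi hi' hj hj' he).1

theorem IsTheta.ne' (h : IsTheta G K P Q l z) {s : Fin 3} {i j : ℕ} (hi : 0 < i)
    (hi' : i < l s) (hj : 0 < j) (hj' : j < l s) (hij : i ≠ j) : z s i ≠ z s j := fun he =>
  hij (h.inj s i s j hi hi' hj hj' he).2

/-- Leave `z s i` downwards; arrive at `P` and continue. -/
theorem IsTheta.half (h : IsTheta G K P Q l z) {s t r : Fin 3} (hst : s ≠ t) (hsr : s ≠ r)
    (htr : t ≠ r) {i : ℕ} {v : V} (hi : 0 < i) (hi' : i < l s)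
    (hv : ∀ m, 0 < m → m ≤ i → z s m ≠ v) (hvP : P ≠ v) :
    gf G (K.erase (z s i)) (z s (i - 1)) v = X ^ i *
      (gf G ((K.filter (fun u => ∀ m, 0 < m → m ≤ i → u ≠ z s m)).erase P) (z t 1) v +
       gf G ((K.filter (fun u => ∀ m, 0 < m → m ≤ i → u ≠ z s m)).erase P) (z r 1) v) := by
  rw [h.slideDown (Finset.erase_subset _ _) (j := 0) hi hi'.le (by simp)
    (fun m h1 h2 => ⟨by
      simp only [Finset.mem_erase]
      exact ⟨h.ne' h1 (by omega) hi hi' (by omega), h.mem s m h1 (by omega)⟩,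
      hv m h1 h2.le⟩)]
  have eT : (K.erase (z s i)).filter (fun u => ∀ m, 0 < m → m < i → u ≠ z s m) =
      K.filter (fun u => ∀ m, 0 < m → m ≤ i → u ≠ z s m) := by
    ext u
    simp only [Finset.mem_filter, Finset.mem_erase]
    constructor
    · rintro ⟨⟨h1, h2⟩, h3⟩
      refine ⟨h2, fun m hm hm' => ?_⟩
      by_cases he : m = i
      · subst he; exact h1
      · exact h3 m hm (by omega)
    · rintro ⟨h2, h3⟩
      exact ⟨⟨h3 i hi le_rfl, h2⟩, fun m hm hm' => h3 m hm hm'.le⟩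
  rw [eT, h.zP, h.stepP (Finset.filter_subset _ _) _ hvP hst hsr htr]
  · rw [gf_notMem G (u := z s 1)]
    · rw [zero_add, ← mul_assoc, ← pow_succ]
      congr 2; omega
    · simp only [Finset.mem_erase, Finset.mem_filter, not_and, not_forall]
      intro _ _
      exact ⟨1, by omega, by omega, by simp⟩
  · simp only [Finset.mem_filter]
    exact ⟨h.PK, fun m h1 h2 => (h.neP s m h1 (by omega)).symm⟩

theorem IsTheta.half_diff (h : IsTheta G K P Q l z) {s t r : Fin 3} (hst : s ≠ t) (hsr : s ≠ r)
    (htr : t ≠ r) {i j : ℕ} (hi : 0 < i) (hi' : i < l s) (hj : 0 < j) (hj' : j < l t) :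
    gf G (K.erase (z s i)) (z s (i - 1)) (z t j) = X ^ (i + j - 1) +
      X ^ (i + l r + l t - j - 1) := by
  have hr := h.pos r
  rw [h.half hst hsr htr hi hi' (fun m h1 h2 => h.ne hst h1 (by omega) hj hj')
    (h.neP t j hj hj').symm]
  set T2 := (K.filter (fun u => ∀ m, 0 < m → m ≤ i → u ≠ z s m)).erase P with hT2
  have hT2K : T2 ⊆ K := (Finset.erase_subset _ _).trans (Finset.filter_subset _ _)
  have hP2 : P ∉ T2 := by simp [hT2]
  have mem2 : ∀ a m, a ≠ s → 0 < m → m < l a → z a m ∈ T2 := by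
    intro a m has h1 h2
    simp only [hT2, Finset.mem_erase, Finset.mem_filter]
    exact ⟨h.neP a m h1 h2, h.mem a m h1 h2, fun m' h3 h4 => h.ne has h1 h2 h3 (by omega)⟩
  have mem2s : ∀ m, i < m → m < l s → z s m ∈ T2 := by
    intro m h1 h2
    simp only [hT2, Finset.mem_erase, Finset.mem_filter]
    exact ⟨h.neP s m (by omega) h2, h.mem s m (by omega) h2,
      fun m' h3 h4 => h.ne' (by omega) h2 h3 (by omega) (by omega)⟩
  have notmem2s : z s i ∉ T2 := by
    simp only [hT2, Finset.mem_erase, Finset.mem_filter, not_and, not_forall]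
    intro _ _
    exact ⟨i, hi, le_rfl, by simp⟩
  have memQ : Q ∈ T2 := by
    simp only [hT2, Finset.mem_erase, Finset.mem_filter]
    exact ⟨h.PQ.symm, h.QK, fun m' h3 h4 => (h.neQ s m' h3 (by omega)).symm⟩
  rw [h.hitUp hT2K (i := 0) hj hj' (by simpa [h.zP] using hP2)
    (fun m h1 h2 => mem2 t m hst.symm h1 (by omega))]
  rw [h.slideUpFull hT2K (t := r) hP2
    (fun m h1 h2 => ⟨mem2 r m hsr.symm h1 h2, h.ne htr.symm h1 h2 hj hj'⟩)]
  set T3 := T2.filter (fun u => ∀ m, 0 < m → m < l r → u ≠ z r m) with hT3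
  have hT3K : T3 ⊆ K := (Finset.filter_subset _ _).trans hT2K
  rw [h.stepQ hT3K _ (h.neQ t j hj hj').symm hst hsr htr]
  · have e1 : gf G (T3.erase Q) (z s (l s - 1)) (z t j) = 0 := by
      apply h.deadDown ((Finset.erase_subset _ _).trans hT3K) (j := i) hi' le_rfl
      · simp [h.zQ]
      · intro m h1 h2
        refine ⟨?_, h.ne hst (by omega) h2 hj hj'⟩
        simp only [hT3, Finset.mem_erase, Finset.mem_filter]
        exact ⟨h.neQ s m (by omega) h2, mem2s m h1 h2,
          fun m' h3 h4 => h.ne hsr (by omega) h2 h3 h4⟩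
      · simp [hT3, notmem2s]
    have e2 : gf G (T3.erase Q) (z t (l t - 1)) (z t j) = X ^ (l t - 1 - j) := by
      apply h.hitDown ((Finset.erase_subset _ _).trans hT3K) hj hj' le_rfl
      · simp [h.zQ]
      · intro m h1 h2
        simp only [hT3, Finset.mem_erase, Finset.mem_filter]
        exact ⟨h.neQ t m (by omega) h2, mem2 t m hst.symm (by omega) h2,
          fun m' h3 h4 => h.ne htr (by omega) h2 h3 h4⟩
    have e3 : gf G (T3.erase Q) (z r (l r - 1)) (z t j) = 0 := by
      apply gf_notMem
      by_cases hl : l r = 1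
      · rw [hl, h.zP]; simp [hT3, hP2]
      · simp only [hT3, Finset.mem_erase, Finset.mem_filter, not_and, not_forall]
        intro _ _
        exact ⟨l r - 1, by omega, by omega, by simp⟩
    rw [e1, e2, e3, zero_add, add_zero, mul_add]
    rw [show i + j - 1 = i + (j - 0 - 1) by omega,
      show i + l r + l t - j - 1 = i + (l r - 1) + 1 + (l t - 1 - j) by omega]
    ring
  · simp only [hT3, Finset.mem_filter]
    exact ⟨memQ, fun m h1 h2 => (h.neQ r m h1 h2).symm⟩

theorem IsTheta.half_same (h : IsTheta G K P Q l z) {s t r : Fin 3} (hst : s ≠ t) (hsr : s ≠ r)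
    (htr : t ≠ r) {i j : ℕ} (hi : 0 < i) (hij : i < j) (hj' : j < l s) :
    gf G (K.erase (z s i)) (z s (i - 1)) (z s j) =
      X ^ (i + l t + l s - j - 1) + X ^ (i + l r + l s - j - 1) := by
  have hi' : i < l s := by omega
  have hj : 0 < j := by omega
  have hr := h.pos r
  have ht := h.pos t
  rw [h.half hst hsr htr hi hi' (fun m h1 h2 => h.ne' h1 (by omega) hj hj' (by omega))
    (h.neP s j hj hj').symm]
  set T2 := (K.filter (fun u => ∀ m, 0 < m → m ≤ i → u ≠ z s m)).erase P with hT2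
  have hT2K : T2 ⊆ K := (Finset.erase_subset _ _).trans (Finset.filter_subset _ _)
  have hP2 : P ∉ T2 := by simp [hT2]
  have mem2 : ∀ a m, a ≠ s → 0 < m → m < l a → z a m ∈ T2 := by
    intro a m has h1 h2
    simp only [hT2, Finset.mem_erase, Finset.mem_filter]
    exact ⟨h.neP a m h1 h2, h.mem a m h1 h2, fun m' h3 h4 => h.ne has h1 h2 h3 (by omega)⟩
  have mem2s : ∀ m, i < m → m < l s → z s m ∈ T2 := by
    intro m h1 h2
    simp only [hT2, Finset.mem_erase, Finset.mem_filter]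
    exact ⟨h.neP s m (by omega) h2, h.mem s m (by omega) h2,
      fun m' h3 h4 => h.ne' (by omega) h2 h3 (by omega) (by omega)⟩
  have memQ : Q ∈ T2 := by
    simp only [hT2, Finset.mem_erase, Finset.mem_filter]
    exact ⟨h.PQ.symm, h.QK, fun m' h3 h4 => (h.neQ s m' h3 (by omega)).symm⟩
  have main : ∀ t r, s ≠ t → s ≠ r → t ≠ r →
      gf G T2 (z t 1) (z s j) = X ^ (l t - 1) * (X * X ^ (l s - 1 - j)) := by
    intro t r hst hsr htr
    rw [h.slideUpFull hT2K (t := t) hP2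
      (fun m h1 h2 => ⟨mem2 t m hst.symm h1 h2, h.ne hst.symm h1 h2 hj hj'⟩)]
    set T3 := T2.filter (fun u => ∀ m, 0 < m → m < l t → u ≠ z t m) with hT3
    have hT3K : T3 ⊆ K := (Finset.filter_subset _ _).trans hT2K
    have ht := h.pos t
    have hr := h.pos r
    congr 1
    rw [h.stepQ hT3K _ (h.neQ s j hj hj').symm hst hsr htr]
    · have e1 : gf G (T3.erase Q) (z s (l s - 1)) (z s j) = X ^ (l s - 1 - j) := by
        apply h.hitDown ((Finset.erase_subset _ _).trans hT3K) hj hj' le_rfl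
        · simp [h.zQ]
        · intro m h1 h2
          simp only [hT3, Finset.mem_erase, Finset.mem_filter]
          exact ⟨h.neQ s m (by omega) h2, mem2s m (by omega) h2,
            fun m' h3 h4 => h.ne hst (by omega) h2 h3 h4⟩
      have e2 : gf G (T3.erase Q) (z r (l r - 1)) (z s j) = 0 := by
        apply h.deadDown ((Finset.erase_subset _ _).trans hT3K) (j := 0) (by omega) le_rfl
        · simp [h.zQ]
        · intro m h1 h2
          refine ⟨?_, h.ne hsr.symm (by omega) h2 hj hj'⟩
          simp only [hT3, Finset.mem_erase, Finset.mem_filter]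
          exact ⟨h.neQ r m (by omega) h2, mem2 r m hsr.symm h1 h2,
            fun m' h3 h4 => h.ne htr.symm (by omega) h2 h3 h4⟩
        · simp [hT3, h.zP, hP2]
      have e3 : gf G (T3.erase Q) (z t (l t - 1)) (z s j) = 0 := by
        apply gf_notMem
        by_cases hl : l t = 1
        · rw [hl, h.zP]; simp [hT3, hP2]
        · simp only [hT3, Finset.mem_erase, Finset.mem_filter, not_and, not_forall]
          intro _ _
          exact ⟨l t - 1, by omega, by omega, by simp⟩
      rw [e1, e2, e3, add_zero, add_zero]
    · simp only [hT3, Finset.mem_filter]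
      exact ⟨memQ, fun m h1 h2 => (h.neQ t m h1 h2).symm⟩
  rw [main t r hst hsr htr, main r t hsr hst htr.symm]
  rw [show i + l t + l s - j - 1 = i + (l t - 1) + (l s - 1 - j) + 1 by omega,
    show i + l r + l s - j - 1 = i + (l r - 1) + (l s - 1 - j) + 1 by omega]
  ring

/-- Vertices on the same arc. -/
theorem IsTheta.gf_same (h : IsTheta G K P Q l z) {s t r : Fin 3} (hst : s ≠ t) (hsr : s ≠ r)
    (htr : t ≠ r) {i j : ℕ} (hi : 0 < i) (hij : i < j) (hj' : j < l s) :
    gf G K (z s i) (z s j) =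
      X ^ (j - i) + X ^ (i + l t + l s - j) + X ^ (i + l r + l s - j) := by
  have hne : z s (i - 1) ≠ z s (i + 1) := by
    by_cases h1 : i = 1
    · subst h1
      rw [Nat.sub_self, h.zP]
      exact (h.neP s 2 (by omega) (by omega)).symm
    · exact h.ne' (by omega) (by omega) (by omega) (by omega) (by omega)
  rw [gf_stepA (Finset.Subset.refl K) (h.mem s i hi (by omega))
    (h.ne' hi (by omega) (by omega) hj' (by omega)) (A := {z s (i - 1), z s (i + 1)})
    (by intro u hu; rw [h.adj s i hi (by omega) u hu]; simp), Finset.sum_pair hne,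
    h.half_same hst hsr htr hi hij hj',
    h.hitUp (Finset.erase_subset _ _) hij hj' (by simp) (by
      intro m h1 h2
      simp only [Finset.mem_erase]
      exact ⟨h.ne' (by omega) (by omega) (by omega) (by omega) (by omega),
        h.mem s m (by omega) (by omega)⟩)]
  have ht := h.pos t
  have hr := h.pos r
  obtain ⟨m0, g0⟩ : ∃ m, j - i = m + 1 := ⟨j - i - 1, by omega⟩
  obtain ⟨m1, g1⟩ : ∃ m, i + l t + l s - j = m + 1 := ⟨i + l t + l s - j - 1, by omega⟩
  obtain ⟨m2, g2⟩ : ∃ m, i + l r + l s - j = m + 1 := ⟨i + l r + l s - j - 1, by omega⟩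
  rw [g0, g1, g2]
  simp only [Nat.add_sub_cancel]
  ring

/-- Vertices on different arcs. -/
theorem IsTheta.gf_diff (h : IsTheta G K P Q l z) {s t r : Fin 3} (hst : s ≠ t) (hsr : s ≠ r)
    (htr : t ≠ r) {i j : ℕ} (hi : 0 < i) (hi' : i < l s) (hj : 0 < j) (hj' : j < l t) :
    gf G K (z s i) (z t j) =
      X ^ (i + j) + X ^ (i + l r + l t - j) + X ^ (l s + l t - i - j) + X ^ (l s - i + l r + j) := by
  have hne : z s (i - 1) ≠ z s (i + 1) := by
    by_cases h1 : i = 1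
    · subst h1
      rw [Nat.sub_self, h.zP]
      by_cases h2 : l s = 2
      · have := h.zQ s
        rw [h2] at this
        rw [this]; exact h.PQ
      · exact (h.neP s 2 (by omega) (by omega)).symm
    · by_cases h2 : i + 1 = l s
      · rw [h2, h.zQ]; exact h.neQ s _ (by omega) (by omega)
      · exact h.ne' (by omega) (by omega) (by omega) (by omega) (by omega)
  have r1 := h.rev.half_diff hst hsr htr (i := l s - i) (j := l t - j) (by omega) (by omega)
    (by omega) (by omega)
  rw [show l s - (l s - i) = i by omega, show l t - (l t - j) = j by omega,
    show l s - (l s - i - 1) = i + 1 by omega] at r1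
  rw [gf_stepA (Finset.Subset.refl K) (h.mem s i hi (by omega))
    (h.ne hst hi hi' hj hj') (A := {z s (i - 1), z s (i + 1)})
    (by intro u hu; rw [h.adj s i hi (by omega) u hu]; simp), Finset.sum_pair hne,
    h.half_diff hst hsr htr hi hi' hj hj', r1]
  have hr := h.pos r
  obtain ⟨m0, g0⟩ : ∃ m, i + j = m + 1 := ⟨i + j - 1, by omega⟩
  obtain ⟨m1, g1⟩ : ∃ m, i + l r + l t - j = m + 1 := ⟨i + l r + l t - j - 1, by omega⟩
  obtain ⟨m2, g2⟩ : ∃ m, l s + l t - i - j = m + 1 := ⟨l s + l t - i - j - 1, by omega⟩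
  obtain ⟨m3, g3⟩ : ∃ m, l s - i + l r + j = m + 1 := ⟨l s - i + l r + j - 1, by omega⟩
  rw [show l s - i + (l t - j) = l s + l t - i - j by omega,
    show l s - i + l r + l t - (l t - j) = l s - i + l r + j by omega, g0, g1, g2, g3]
  simp only [Nat.add_sub_cancel]
  ring

end Eval
end L2R

namespace L2R
set_option linter.unusedSectionVars false
open Polynomial
open scoped Classical

section Net
variable {V : Type} [Fintype V] {G : SimpleGraph V} {Λ : Type} {leaf : Λ → V}

/-- The properties of a nondegenerate level-2 network used in the argument. -/
structure Net (G : SimpleGraph V) (leaf : Λ → V) : Prop where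
  conn : CutConn G
  inj : Function.Injective leaf
  deg1 : ∀ x, (Finset.univ.filter (G.Adj (leaf x))).card = 1
  deg3 : ∀ u, u ∉ Set.range leaf → (Finset.univ.filter (G.Adj u)).card = 3
  lev : ∀ w, 2 ≤ (cls G w).card → (∀ u ∈ cls G w, dK G (cls G w) u = 2) ∨
    ∃ P Q, P ∈ cls G w ∧ Q ∈ cls G w ∧ P ≠ Q ∧ dK G (cls G w) P = 3 ∧
      dK G (cls G w) Q = 3 ∧ ∀ u ∈ cls G w, u ≠ P → u ≠ Q → dK G (cls G w) u = 2

theorem Net.deg (hN : Net G leaf) (u : V) : (Finset.univ.filter (G.Adj u)).card ≤ 3 := by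
  by_cases h : u ∈ Set.range leaf
  · obtain ⟨x, rfl⟩ := h
    rw [hN.deg1]; omega
  · rw [hN.deg3 u h]

structure Slots (G : SimpleGraph V) (leaf : Λ → V) (S₀ : Finset V) (w : V) (ι : Type)
    (S : ι → Finset V) (d c : ι → V) : Prop where
  part : ∀ σ, RPart G S₀ (cls G w) (S σ) (d σ) (c σ)
  disj : ∀ σ τ, σ ≠ τ → Disjoint (S σ) (S τ)
  cover : ∀ u ∈ S₀, u ∈ cls G w ∨ ∃ σ, u ∈ S σ
  nl : ∀ x, leaf x ∉ cls G w

noncomputable def slotSet (G : SimpleGraph V) (w : V) : Finset V :=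
  (cls G w).filter (fun c => c ≠ w ∧ dK G (cls G w) c = 2)

theorem mem_slotSet {w c : V} :
    c ∈ slotSet G w ↔ c ∈ cls G w ∧ c ≠ w ∧ dK G (cls G w) c = 2 := by
  simp [slotSet]

theorem outer_count (hN : Net G leaf) {K : Finset V} {c : V} (hd : 2 ≤ dK G K c) :
    dK G K c + (Finset.univ.filter (fun d => G.Adj c d ∧ d ∉ K)).card = 3 := by
  have hnl : c ∉ Set.range leaf := by
    rintro ⟨x, rfl⟩
    have h1 := hN.deg1 x
    have : dK G K (leaf x) ≤ 1 := by
      rw [← h1]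
      apply Finset.card_le_card
      intro t ht
      simp only [Finset.mem_filter] at ht
      simp [ht.2]
    omega
  have h3 := hN.deg3 c hnl
  rw [← h3, dK, ← Finset.card_union_of_disjoint]
  · congr 1
    ext t
    simp only [Finset.mem_union, Finset.mem_filter, Finset.mem_univ, true_and]
    tauto
  · rw [Finset.disjoint_left]
    intro t ht ht'
    simp only [Finset.mem_filter, Finset.mem_univ, true_and] at ht ht'
    exact ht'.2 ht.1

theorem not_leaf (hN : Net G leaf) {w : V} (hK : 2 ≤ (cls G w).card) (x : Λ) :
    leaf x ∉ cls G w := by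
  intro hx
  have h2 := two_le_dK hN.conn hK hx
  have : dK G (cls G w) (leaf x) ≤ 1 := by
    rw [← hN.deg1 x]
    apply Finset.card_le_card
    intro t ht
    simp only [Finset.mem_filter] at ht
    simp [ht.2]
  omega

variable {S₀ : Finset V} {w v : V}

theorem dis_outer {K S : Finset V} {d c : V} (h : Part G K S d c) : d ∉ K := fun hd =>
  h.dis d hd h.side.din

theorem root_dK (hN : Net G leaf) (h₀ : IsSide G S₀ w v) (hK : 2 ≤ (cls G w).card) :
    dK G (cls G w) w = 2 := by
  have h2 := two_le_dK hN.conn hK (self_mem_cls w)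
  have h3 := outer_count hN h2
  have : 0 < (Finset.univ.filter (fun d => G.Adj w d ∧ d ∉ cls G w)).card := by
    rw [Finset.card_pos]
    exact ⟨v, by simp [h₀.adj, dis_outer (outer_part h₀)]⟩
  omega

theorem exists_slots (hN : Net G leaf) (h₀ : IsSide G S₀ w v) (hK : 2 ≤ (cls G w).card) :
    ∃ S d, Slots G leaf S₀ w {c // c ∈ slotSet G w} S d (fun σ => σ.1) := by
  have key : ∀ σ : {c // c ∈ slotSet G w}, ∃ S d, RPart G S₀ (cls G w) S d σ.1 := by
    rintro ⟨c, hc⟩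
    rw [mem_slotSet] at hc
    have := outer_count hN (c := c) (K := cls G w) (by omega)
    obtain ⟨d, hd⟩ : (Finset.univ.filter (fun d => G.Adj c d ∧ d ∉ cls G w)).Nonempty := by
      rw [← Finset.card_pos]; omega
    simp only [Finset.mem_filter, Finset.mem_univ, true_and] at hd
    obtain ⟨S, hS⟩ := part_of_edge hc.1 hd.2 hd.1
    exact ⟨S, d, rpart_of_part hN.conn h₀ hS (fun h => hc.2.1 h.2)⟩
  choose S d hp using key
  refine ⟨S, d, hp, ?_, ?_, not_leaf hN hK⟩
  · intro σ τ hne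
    exact (hp σ).toPart.disjoint hN.conn (hp τ).toPart (fun h => hne (Subtype.ext h.2))
  · intro u hu
    rcases rpart_cover hN.conn h₀ hu with h | ⟨S', d', c', h', hu'⟩
    · exact Or.inl h
    · right
      have h2 := two_le_dK hN.conn hK h'.cK
      have h3 := outer_count hN h2
      have hd' : d' ∈ Finset.univ.filter (fun d => G.Adj c' d ∧ d ∉ cls G w) := by
        simp [h'.side.adj.symm, dis_outer h'.toPart]
      have hpos := Finset.card_pos.2 ⟨_, hd'⟩
      have hcw : c' ≠ w := by
        rintro rfl
        have : ({v, d'} : Finset V) ⊆ Finset.univ.filter (fun d => G.Adj c' d ∧ d ∉ cls G c') := by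
          intro t ht
          simp only [Finset.mem_insert, Finset.mem_singleton] at ht
          rcases ht with rfl | rfl
          · simp [h₀.adj, dis_outer (outer_part h₀)]
          · exact hd'
        have := Finset.card_le_card this
        rw [Finset.card_pair (h'.ne h₀).symm] at this
        omega
      have hc' : c' ∈ slotSet G w := by
        rw [mem_slotSet]; exact ⟨h'.cK, hcw, by omega⟩
      refine ⟨⟨c', hc'⟩, ?_⟩
      have hone : (Finset.univ.filter (fun d => G.Adj c' d ∧ d ∉ cls G w)).card ≤ 1 := by omega
      have hp' := hp ⟨c', hc'⟩
      have : d' = d ⟨c', hc'⟩ := Finset.card_le_one.1 hone _ hd' _ (by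
        simp [hp'.side.adj.symm, dis_outer hp'.toPart])
      subst this
      rw [← h'.toPart.eq hN.conn hp'.toPart]
      exact hu'

set_option maxHeartbeats 1000000 in
theorem classify (hN : Net G leaf) (h₀ : IsSide G S₀ w v) :
    (∃ x, w = leaf x ∧ S₀ = {w}) ∨
    (cls G w = {w} ∧ ∃ S d, Slots G leaf S₀ w Bool S d (fun _ => w)) ∨
    ((∃ S d, Slots G leaf S₀ w {c // c ∈ slotSet G w} S d (fun σ => σ.1)) ∧
      ((∃ n z, IsCyc G (cls G w) n z ∧ z 0 = w) ∨
       ∃ P Q l z p, IsTheta G (cls G w) P Q l z ∧ 0 < p ∧ p < l 0 ∧ z 0 p = w)) := by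
  by_cases hK : 2 ≤ (cls G w).card
  · right; right
    refine ⟨exists_slots hN h₀ hK, ?_⟩
    rcases hN.lev w hK with h | ⟨P, Q, hP, hQ, hPQ, dP, dQ, hd⟩
    · left
      exact exists_cyc (self_mem_cls w) (cls_erase_cutConnOn hN.conn hN.deg (self_mem_cls w)) h
    · right
      obtain ⟨l, z, ht⟩ := exists_theta hP hQ hPQ (cls_erase_cutConnOn hN.conn hN.deg hP) dP dQ hd
      have hw2 := root_dK hN h₀ hK
      rcases ht.cover w (self_mem_cls w) with h | h | ⟨s, i, hi, hi', h⟩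
      · rw [← h] at dP; omega
      · rw [← h] at dQ; omega
      · have hp := ht.perm (Equiv.swap 0 s)
        refine ⟨P, Q, fun a => l (Equiv.swap 0 s a), fun a => z (Equiv.swap 0 s a), i, hp, hi,
          ?_, ?_⟩
        · show i < l (Equiv.swap 0 s 0)
          rw [Equiv.swap_apply_left]; exact hi'
        · show z (Equiv.swap 0 s 0) i = w
          rw [Equiv.swap_apply_left]; exact h.symm
  · have hK1 : cls G w = {w} := by
      have h1 : (cls G w).card ≤ 1 := by omega
      apply Finset.eq_singleton_iff_unique_mem.2
      exact ⟨self_mem_cls w, fun u hu => Finset.card_le_one.1 h1 u hu w (self_mem_cls w)⟩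
    by_cases hl : w ∈ Set.range leaf
    · left
      obtain ⟨x, rfl⟩ := hl
      refine ⟨x, rfl, ?_⟩
      have h1 := hN.deg1 x
      ext u
      simp only [Finset.mem_singleton]
      refine ⟨fun hu => ?_, fun hu => hu ▸ h₀.din⟩
      rcases rpart_cover hN.conn h₀ hu with h | ⟨S, d, c, h, hu'⟩
      · rw [hK1] at h; simpa using h
      · exfalso
        have hc := h.cK
        rw [hK1, Finset.mem_singleton] at hc
        subst hc
        exact h.ne h₀ (Finset.card_le_one.1 h1.le d (by simp [h.side.adj.symm]) v
          (by simp [h₀.adj]))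
    · right; left
      refine ⟨hK1, ?_⟩
      have h3 := hN.deg3 w hl
      have hv : v ∈ Finset.univ.filter (G.Adj w) := by simp [h₀.adj]
      have h2 : ((Finset.univ.filter (G.Adj w)).erase v).card = 2 := by
        rw [Finset.card_erase_of_mem hv, h3]
      obtain ⟨d1, d2, hne, he⟩ := Finset.card_eq_two.1 h2
      have hmem : ∀ t, (t ≠ v ∧ G.Adj w t) ↔ t = d1 ∨ t = d2 := by
        intro t
        have : t ∈ (Finset.univ.filter (G.Adj w)).erase v ↔ t ∈ ({d1, d2} : Finset V) := by rw [he]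
        simpa using this
      have key : ∀ b : Bool, ∃ S, RPart G S₀ (cls G w) S (if b then d1 else d2) w := by
        intro b
        have h1 := (hmem (if b then d1 else d2)).2 (by cases b <;> simp)
        obtain ⟨S, hS⟩ := part_of_edge (self_mem_cls w) (d := if b then d1 else d2)
          (by rw [hK1, Finset.mem_singleton]; exact h1.2.ne') h1.2
        exact ⟨S, rpart_of_part hN.conn h₀ hS (fun h => h1.1 h.1)⟩
      choose S hS using key
      refine ⟨S, fun b => if b then d1 else d2, hS, ?_, ?_, ?_⟩
      · intro σ τ hst
        apply (hS σ).toPart.disjoint hN.conn (hS τ).toPart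
        rintro ⟨h, -⟩
        cases σ <;> cases τ <;> simp_all
      · intro u hu
        rcases rpart_cover hN.conn h₀ hu with h | ⟨S', d, c, h, hu'⟩
        · exact Or.inl h
        · right
          have hc := h.cK
          rw [hK1, Finset.mem_singleton] at hc
          subst hc
          rcases (hmem d).1 ⟨h.ne h₀, h.side.adj.symm⟩ with rfl | rfl
          · refine ⟨true, ?_⟩
            have := hS true
            simp only [if_true] at this
            rwa [← h.toPart.eq hN.conn this.toPart]
          · refine ⟨false, ?_⟩
            have := hS false
            simp only [Bool.false_eq_true, if_false] at this
            rwa [← h.toPart.eq hN.conn this.toPart]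
      · intro x hx
        rw [hK1, Finset.mem_singleton] at hx
        exact hl ⟨x, hx⟩

end Net
end L2R

namespace L2R
set_option linter.unusedSectionVars false
open Polynomial
open scoped Classical

section Vals
variable {V : Type} [Fintype V] {G : SimpleGraph V}

theorem gf_iso {V' : Type} [Fintype V'] {G' : SimpleGraph V'} {φ : V → V'} {S : Finset V}
    {S' : Finset V'} (hb : Set.BijOn φ S S')
    (hadj : ∀ a ∈ S, ∀ b ∈ S, G.Adj a b ↔ G'.Adj (φ a) (φ b)) {u v : V} (hu : u ∈ S)
    (hv : v ∈ S) : gf G S u v = gf G' S' (φ u) (φ v) := by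
  induction hn : S.card generalizing S S' u with
  | zero => rw [Finset.card_eq_zero.mp hn] at hu; simp at hu
  | succ n ih =>
    have hu' : φ u ∈ S' := hb.mapsTo hu
    by_cases huv : u = v
    · subst huv; rw [gf_self G hu, gf_self G' hu']
    · have huv' : φ u ≠ φ v := fun h => huv (hb.injOn hu hv h)
      rw [gf_step' G hu huv, gf_step' G' hu' huv']
      congr 1
      have hb' : Set.BijOn φ (S.erase u) (S'.erase (φ u)) := by
        refine ⟨?_, ?_, ?_⟩
        · intro t ht
          simp only [Finset.coe_erase, Set.mem_diff, Finset.mem_coe, Set.mem_singleton_iff] at ht ⊢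
          exact ⟨hb.mapsTo ht.1, fun h => ht.2 (hb.injOn ht.1 hu h)⟩
        · exact hb.injOn.mono (by simp)
        · intro t ht
          simp only [Finset.coe_erase, Set.mem_diff, Finset.mem_coe, Set.mem_singleton_iff] at ht
          obtain ⟨a, ha, rfl⟩ := hb.surjOn ht.1
          refine ⟨a, ?_, rfl⟩
          simp only [Finset.coe_erase, Set.mem_diff, Finset.mem_coe, Set.mem_singleton_iff]
          exact ⟨ha, fun h => ht.2 (by rw [h])⟩
      have hm : ∀ t ∈ S.erase u, φ t ∈ S'.erase (φ u) := fun t ht => hb'.mapsTo ht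
      refine Finset.sum_bij (fun a _ => φ a) ?_ ?_ ?_ ?_
      · intro a ha
        simp only [Finset.mem_filter] at ha ⊢
        exact ⟨hm a ha.1, (hadj u hu a (Finset.mem_of_mem_erase ha.1)).1 ha.2⟩
      · intro a ha b hb2 h
        simp only [Finset.mem_filter] at ha hb2
        exact hb'.injOn (by exact_mod_cast ha.1) (by exact_mod_cast hb2.1) h
      · intro t ht
        simp only [Finset.mem_filter] at ht
        obtain ⟨a, ha, rfl⟩ := hb'.surjOn (show t ∈ ((S'.erase (φ u) : Finset V') : Set V') by
          exact_mod_cast ht.1)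
        have ha' : a ∈ S.erase u := by exact_mod_cast ha
        refine ⟨a, ?_, rfl⟩
        simp only [Finset.mem_filter]
        exact ⟨ha', (hadj u hu a (Finset.mem_of_mem_erase ha')).2 ht.2⟩
      · intro a ha
        simp only [Finset.mem_filter] at ha
        by_cases hve : v ∈ S.erase u
        · exact ih hb' (fun x hx y hy => hadj x (Finset.mem_of_mem_erase hx) y
            (Finset.mem_of_mem_erase hy)) ha.1 hve (by rw [Finset.card_erase_of_mem hu, hn]; rfl)
        · exact absurd (Finset.mem_erase.2 ⟨Ne.symm huv, hv⟩) hve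

variable {K : Finset V}

theorem IsCyc.idx {n : ℕ} {z : ℤ → V} (h : IsCyc G K n z) {u : V} (hu : u ∈ K) (h0 : u ≠ z 0) :
    ∃ i : ℕ, 0 < i ∧ i < n ∧ u = z i := by
  obtain ⟨a, rfl⟩ := h.cover u hu
  have hn : (0 : ℤ) < n := by have := h.three; omega
  have h1 := Int.emod_nonneg a hn.ne'
  have h2 := Int.emod_lt_of_pos a hn
  have h3 : z a = z (a % n) := by
    rw [h.eqv]; exact Int.dvd_self_sub_emod
  refine ⟨(a % n).toNat, ?_, by omega, by rw [Int.toNat_of_nonneg h1, h3]⟩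
  by_contra hc
  apply h0
  rw [h3]
  congr 1; omega

theorem IsCyc.dK {n : ℕ} {z : ℤ → V} (h : IsCyc G K n z) (a : ℤ) : dK G K (z a) = 2 := by
  have h3 := h.three
  have : K.filter (G.Adj (z a)) = {z (a - 1), z (a + 1)} := by
    ext t
    simp only [Finset.mem_filter, Finset.mem_insert, Finset.mem_singleton]
    constructor
    · rintro ⟨h1, h2⟩; exact (h.adj a t h1).1 h2
    · intro h1
      have ht : t ∈ K := by rcases h1 with rfl | rfl <;> exact h.mem _
      exact ⟨ht, (h.adj a t ht).2 h1⟩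
  rw [L2R.dK, this, Finset.card_pair (h.ne (by omega) (by omega))]

theorem gf_cyc' {n : ℕ} {z : ℤ → V} (h : IsCyc G K n z) {i j : ℕ} (hij : i < j) (hj : j < n) :
    gf G K (z i) (z j) = X ^ (j - i) + X ^ (n - (j - i)) := by
  have := gf_cyc h i (d := j - i) (by omega) (by omega)
  rwa [show (i : ℤ) + ((j - i : ℕ) : ℤ) = j by omega] at this

theorem cyc_val {n : ℕ} {z : ℤ → V} (h : IsCyc G K n z) {i j : ℕ} (hi : i < n) (hij : i ≠ j)
    (hj : j < n) : (gf G K (z i) (z j)).eval 1 = 2 := by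
  rcases lt_or_gt_of_ne hij with h1 | h1
  · rw [gf_cyc' h h1 hj]; norm_num
  · rw [gf_symm, gf_cyc' h h1 hi]; norm_num

variable {P Q : V} {l : Fin 3 → ℕ} {z : Fin 3 → ℕ → V}

theorem others (s : Fin 3) : ∃ t r : Fin 3, s ≠ t ∧ s ≠ r ∧ t ≠ r := by
  fin_cases s
  · exact ⟨1, 2, by decide⟩
  · exact ⟨0, 2, by decide⟩
  · exact ⟨0, 1, by decide⟩

theorem third {s t : Fin 3} (h : s ≠ t) : ∃ r : Fin 3, s ≠ r ∧ t ≠ r := by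
  revert s t; decide

theorem IsTheta.same_val (h : IsTheta G K P Q l z) {s : Fin 3} {i j : ℕ} (hi : 0 < i)
    (hi' : i < l s) (hj : 0 < j) (hj' : j < l s) (hij : i ≠ j) :
    (gf G K (z s i) (z s j)).eval 1 = 3 := by
  obtain ⟨t, r, h1, h2, h3⟩ := others s
  rcases lt_or_gt_of_ne hij with hh | hh
  · rw [h.gf_same h1 h2 h3 hi hh hj']; norm_num
  · rw [gf_symm, h.gf_same h1 h2 h3 hj hh hi']; norm_num

theorem IsTheta.diff_val (h : IsTheta G K P Q l z) {s t : Fin 3} {i j : ℕ} (hi : 0 < i)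
    (hi' : i < l s) (hj : 0 < j) (hj' : j < l t) (hst : s ≠ t) :
    (gf G K (z s i) (z t j)).eval 1 = 4 := by
  obtain ⟨r, h2, h3⟩ := third hst
  rw [h.gf_diff hst h2 h3 hi hi' hj hj']; norm_num

theorem IsTheta.val (h : IsTheta G K P Q l z) {s t : Fin 3} {i j : ℕ} (hi : 0 < i)
    (hi' : i < l s) (hj : 0 < j) (hj' : j < l t) (hne : z s i ≠ z t j) :
    (gf G K (z s i) (z t j)).eval 1 = if s = t then 3 else 4 := by
  split_ifs with hst
  · subst hst
    exact h.same_val hi hi' hj hj' (fun e => hne (by rw [e]))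
  · exact h.diff_val hi hi' hj hj' hst

theorem IsTheta.dKint (h : IsTheta G K P Q l z) {s : Fin 3} {i : ℕ} (hi : 0 < i) (hi' : i < l s) :
    dK G K (z s i) = 2 := by
  have hne : z s (i - 1) ≠ z s (i + 1) := by
    by_cases h1 : i = 1
    · subst h1
      rw [Nat.sub_self, h.zP]
      by_cases h2 : l s = 2
      · have := h.zQ s
        rw [h2] at this
        rw [this]; exact h.PQ
      · exact (h.neP s 2 (by omega) (by omega)).symm
    · by_cases h2 : i + 1 = l s
      · rw [h2, h.zQ]; exact h.neQ s _ (by omega) (by omega)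
      · exact h.ne' (by omega) (by omega) (by omega) (by omega) (by omega)
  have hm : ∀ m, m ≤ l s → z s m ∈ K := by
    intro m hm
    by_cases h1 : m = 0
    · rw [h1, h.zP]; exact h.PK
    · by_cases h2 : m = l s
      · rw [h2, h.zQ]; exact h.QK
      · exact h.mem s m (by omega) (by omega)
  have : K.filter (G.Adj (z s i)) = {z s (i - 1), z s (i + 1)} := by
    ext t
    simp only [Finset.mem_filter, Finset.mem_insert, Finset.mem_singleton]
    constructor
    · rintro ⟨h1, h2⟩; exact (h.adj s i hi hi' t h1).1 h2
    · intro h1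
      have ht : t ∈ K := by rcases h1 with rfl | rfl <;> exact hm _ (by omega)
      exact ⟨ht, (h.adj s i hi hi' t ht).2 h1⟩
  rw [dK, this, Finset.card_pair hne]

theorem IsTheta.z1K (h : IsTheta G K P Q l z) (s : Fin 3) : z s 1 ∈ K := by
  have := h.pos s
  by_cases h1 : l s = 1
  · have := h.zQ s
    rw [h1] at this
    rw [this]; exact h.QK
  · exact h.mem s 1 (by omega) (by omega)

theorem IsTheta.dKP (h : IsTheta G K P Q l z) : dK G K P = 3 := by
  have : K.filter (G.Adj P) = {z 0 1, z 1 1, z 2 1} := by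
    ext t
    simp only [Finset.mem_filter, Finset.mem_insert, Finset.mem_singleton]
    constructor
    · rintro ⟨h1, h2⟩
      obtain ⟨s, rfl⟩ := (h.adjP t h1).1 h2
      fin_cases s <;> simp
    · intro h1
      have : ∃ s, t = z s 1 := by
        rcases h1 with h1 | h1 | h1
        exacts [⟨0, h1⟩, ⟨1, h1⟩, ⟨2, h1⟩]
      have ht : t ∈ K := by obtain ⟨s, rfl⟩ := this; exact h.z1K s
      exact ⟨ht, (h.adjP t ht).2 this⟩
  rw [dK, this, Finset.card_eq_three]
  exact ⟨_, _, _, h.z1_ne (by decide), h.z1_ne (by decide), h.z1_ne (by decide), rfl⟩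

/-- The degree-two vertices of a theta are the interior vertices of the arcs. -/
theorem IsTheta.idx (h : IsTheta G K P Q l z) {u : V} (hu : u ∈ K) (hd : L2R.dK G K u = 2) :
    ∃ s i, 0 < i ∧ i < l s ∧ u = z s i := by
  rcases h.cover u hu with rfl | rfl | h1
  · rw [h.dKP] at hd; omega
  · rw [h.rev.dKP] at hd; omega
  · exact h1

theorem IsTheta.offroot (h : IsTheta G K P Q l z) (s : Fin 3) :
    ∃ t i, s ≠ t ∧ 0 < i ∧ i < l t := by
  obtain ⟨t, r, h1, h2, h3⟩ := others s
  have ht := h.pos t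
  have hr := h.pos r
  by_cases hl : l t = 1
  · refine ⟨r, 1, h2, by omega, ?_⟩
    by_contra hc
    exact h.one t r h3 hl (by omega)
  · exact ⟨t, 1, h1, by omega, by omega⟩

/-- Numerical constraints on a nontrivial core. -/
structure Big (G : SimpleGraph V) (w : V) : Prop where
  two : ∀ c ∈ slotSet G w, 2 ≤ (gf G (cls G w) w c).eval 1
  lt : ∀ c ∈ slotSet G w, ∀ c' ∈ slotSet G w, c ≠ c' → (gf G (cls G w) c c').eval 1 <
    (gf G (cls G w) w c).eval 1 * (gf G (cls G w) w c').eval 1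
  ndvd : ∃ c ∈ slotSet G w, ¬ (3 : ℤ) ∣ (gf G (cls G w) w c).eval 1

/-- Values for a cycle core. -/
structure CycV (G : SimpleGraph V) (w : V) : Prop where
  f : ∀ c ∈ slotSet G w, (gf G (cls G w) w c).eval 1 = 2
  F : ∀ c ∈ slotSet G w, ∀ c' ∈ slotSet G w, c ≠ c' → (gf G (cls G w) c c').eval 1 = 2
  ex : ∃ c ∈ slotSet G w, ∃ c' ∈ slotSet G w, c ≠ c'

/-- Values for a theta core. -/
structure ThV (G : SimpleGraph V) (w : V) : Prop where
  f : ∀ c ∈ slotSet G w, (gf G (cls G w) w c).eval 1 = 3 ∨ (gf G (cls G w) w c).eval 1 = 4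
  F : ∀ c ∈ slotSet G w, ∀ c' ∈ slotSet G w, c ≠ c' → (gf G (cls G w) c c').eval 1 = 3 ∨
    (gf G (cls G w) c c').eval 1 = 4
  ex : ∃ c ∈ slotSet G w, (gf G (cls G w) w c).eval 1 = 4

variable {w : V}

theorem cycV {n : ℕ} {z : ℤ → V} (h : IsCyc G (cls G w) n z) (h0 : z 0 = w) : CycV G w := by
  have hi : ∀ c ∈ slotSet G w, ∃ i : ℕ, 0 < i ∧ i < n ∧ c = z i := by
    intro c hc
    rw [mem_slotSet] at hc
    exact h.idx hc.1 (by rw [h0]; exact hc.2.1)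
  have hs : ∀ i : ℕ, 0 < i → i < n → z i ∈ slotSet G w := by
    intro i h1 h2
    rw [mem_slotSet]
    refine ⟨h.mem _, ?_, h.dK _⟩
    rw [← h0]
    exact (h.ne (by omega) (by omega)).symm
  have h3 := h.three
  refine ⟨?_, ?_, ⟨z (1 : ℕ), hs 1 (by omega) (by omega), z (2 : ℕ), hs 2 (by omega) (by omega),
    h.ne (by norm_num) (by push_cast; omega)⟩⟩
  · intro c hc
    obtain ⟨i, h1, h2, rfl⟩ := hi c hc
    have := cyc_val h (i := 0) (j := i) (by omega) (by omega) h2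
    rwa [Nat.cast_zero, h0] at this
  · intro c hc c' hc' hne
    obtain ⟨i, h1, h2, rfl⟩ := hi c hc
    obtain ⟨j, h4, h5, rfl⟩ := hi c' hc'
    exact cyc_val h h2 (fun e => hne (by rw [e])) h5

theorem thV {p : ℕ} (h : IsTheta G (cls G w) P Q l z) (hp : 0 < p) (hp' : p < l 0)
    (h0 : z 0 p = w) : ThV G w := by
  have hi : ∀ c ∈ slotSet G w, ∃ s i, 0 < i ∧ i < l s ∧ c = z s i := by
    intro c hc
    rw [mem_slotSet] at hc
    exact h.idx hc.1 hc.2.2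
  refine ⟨?_, ?_, ?_⟩
  · intro c hc
    obtain ⟨s, i, h1, h2, rfl⟩ := hi c hc
    rw [mem_slotSet] at hc
    have := h.val hp hp' h1 h2 (by rw [h0]; exact hc.2.1.symm)
    rw [h0] at this
    rw [this]
    split_ifs <;> simp
  · intro c hc c' hc' hne
    obtain ⟨s, i, h1, h2, rfl⟩ := hi c hc
    obtain ⟨t, j, h3, h4, rfl⟩ := hi c' hc'
    rw [h.val h1 h2 h3 h4 hne]
    split_ifs <;> simp
  · obtain ⟨t, i, h1, h2, h3⟩ := h.offroot 0
    have hne : z t i ≠ w := by rw [← h0]; exact (h.ne h1 hp hp' h2 h3).symm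
    refine ⟨z t i, mem_slotSet.2 ⟨h.mem t i h2 h3, hne, h.dKint h2 h3⟩, ?_⟩
    have := h.diff_val hp hp' h2 h3 h1
    rwa [h0] at this

theorem CycV.big (h : CycV G w) : Big G w := by
  obtain ⟨c, hc, c', hc', hne⟩ := h.ex
  refine ⟨fun c hc => (h.f c hc).ge, fun c hc c' hc' hne => ?_, c, hc, ?_⟩
  · rw [h.f c hc, h.f c' hc', h.F c hc c' hc' hne]; norm_num
  · rw [h.f c hc]; norm_num

theorem ThV.big (h : ThV G w) : Big G w := by
  obtain ⟨c, hc, h4⟩ := h.ex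
  refine ⟨fun c hc => ?_, fun c hc c' hc' hne => ?_, c, hc, ?_⟩
  · rcases h.f c hc with e | e <;> rw [e] <;> norm_num
  · rcases h.f c hc with e | e <;> rcases h.f c' hc' with e' | e' <;>
      rcases h.F c hc c' hc' hne with e'' | e'' <;> rw [e, e', e''] <;> norm_num
  · rw [h4]; norm_num

end Vals
end L2R

namespace L2R
set_option linter.unusedSectionVars false
open Polynomial
open scoped Classical

section Good
variable {V : Type} [Fintype V] {G : SimpleGraph V} {Λ : Type} {leaf : Λ → V}

/-- Properties of the generating functions on a rooted side. -/
structure Good (G : SimpleGraph V) (leaf : Λ → V) (S : Finset V) (w : V) : Prop where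
  ex : ∃ x, leaf x ∈ S ∧ ¬ (3 : ℤ) ∣ (gf G S w (leaf x)).eval 1
  one : ∀ x, leaf x ∈ S → 1 ≤ (gf G S w (leaf x)).eval 1
  le : ∀ x y, leaf x ∈ S → leaf y ∈ S → x ≠ y →
    (gf G Finset.univ (leaf x) (leaf y)).eval 1 ≤
      (gf G S w (leaf x)).eval 1 * (gf G S w (leaf y)).eval 1
  eq : ∀ x y, leaf x ∈ S → leaf y ∈ S → x ≠ y →
    (gf G Finset.univ (leaf x) (leaf y)).eval 1 =
      (gf G S w (leaf x)).eval 1 * (gf G S w (leaf y)).eval 1 →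
    ∃ k, gf G Finset.univ (leaf x) (leaf y) * X ^ k = gf G S w (leaf x) * gf G S w (leaf y)

variable {S₀ : Finset V} {w v : V} {ι : Type} {S : ι → Finset V} {d c : ι → V}

theorem Slots.slot (hs : Slots G leaf S₀ w ι S d c) {x : Λ} (hx : leaf x ∈ S₀) :
    ∃ σ, leaf x ∈ S σ := (hs.cover _ hx).resolve_left (hs.nl x)

theorem Slots.h_eq (hs : Slots G leaf S₀ w ι S d c) (h₀ : IsSide G S₀ w v) {x : Λ} {σ : ι}
    (hx : leaf x ∈ S σ) : gf G S₀ w (leaf x) = gf G (cls G w) w (c σ) * X *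
      gf G (S σ) (d σ) (leaf x) := gf_root h₀ (hs.part σ) hx

theorem Slots.h_val (hs : Slots G leaf S₀ w ι S d c) (h₀ : IsSide G S₀ w v) {x : Λ} {σ : ι}
    (hx : leaf x ∈ S σ) : (gf G S₀ w (leaf x)).eval 1 = (gf G (cls G w) w (c σ)).eval 1 *
      (gf G (S σ) (d σ) (leaf x)).eval 1 := by
  rw [hs.h_eq h₀ hx]; simp

theorem Slots.P_eq (hs : Slots G leaf S₀ w ι S d c) {x y : Λ} {σ τ : ι} (hst : σ ≠ τ)
    (hx : leaf x ∈ S σ) (hy : leaf y ∈ S τ) : gf G Finset.univ (leaf x) (leaf y) =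
      gf G (cls G w) (c σ) (c τ) * (X * gf G (S σ) (d σ) (leaf x)) *
        (X * gf G (S τ) (d τ) (leaf y)) :=
  gf_pair (hs.part σ).toPart (hs.part τ).toPart (hs.disj σ τ hst) hx hy

theorem Slots.P_val (hs : Slots G leaf S₀ w ι S d c) {x y : Λ} {σ τ : ι} (hst : σ ≠ τ)
    (hx : leaf x ∈ S σ) (hy : leaf y ∈ S τ) : (gf G Finset.univ (leaf x) (leaf y)).eval 1 =
      (gf G (cls G w) (c σ) (c τ)).eval 1 * (gf G (S σ) (d σ) (leaf x)).eval 1 *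
        (gf G (S τ) (d τ) (leaf y)).eval 1 := by
  rw [hs.P_eq hst hx hy]; simp

theorem slot_step (hs : Slots G leaf S₀ w ι S d c) (h₀ : IsSide G S₀ w v)
    (ih : ∀ σ, Good G leaf (S σ) (d σ))
    (hnd : ∃ σ, ¬ (3 : ℤ) ∣ (gf G (cls G w) w (c σ)).eval 1)
    (hv : ((∀ σ, gf G (cls G w) w (c σ) = 1) ∧ ∀ σ τ, σ ≠ τ → gf G (cls G w) (c σ) (c τ) = 1) ∨
      ((∀ σ, 2 ≤ (gf G (cls G w) w (c σ)).eval 1) ∧ ∀ σ τ, σ ≠ τ →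
        (gf G (cls G w) (c σ) (c τ)).eval 1 <
        (gf G (cls G w) w (c σ)).eval 1 * (gf G (cls G w) w (c τ)).eval 1)) :
    Good G leaf S₀ w := by
  have hf1 : ∀ σ, 1 ≤ (gf G (cls G w) w (c σ)).eval 1 := by
    intro σ
    rcases hv with hv | hv
    · rw [hv.1]; simp
    · have := hv.1 σ; omega
  refine ⟨?_, ?_, ?_, ?_⟩
  · obtain ⟨σ, hσ⟩ := hnd
    obtain ⟨x, hx, h3⟩ := (ih σ).ex
    refine ⟨x, (hs.part σ).sub hx, ?_⟩
    rw [hs.h_val h₀ hx]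
    intro hd
    rcases Int.prime_three.dvd_or_dvd hd with h | h
    · exact hσ h
    · exact h3 h
  · intro x hx
    obtain ⟨σ, hσ⟩ := hs.slot hx
    rw [hs.h_val h₀ hσ]
    have h1 := (ih σ).one x hσ
    have h2 := hf1 σ
    nlinarith
  · intro x y hx hy hne
    obtain ⟨σ, hσ⟩ := hs.slot hx
    obtain ⟨τ, hτ⟩ := hs.slot hy
    have h1 := (ih σ).one x hσ
    have h2 := (ih τ).one y hτ
    rw [hs.h_val h₀ hσ, hs.h_val h₀ hτ]
    have f1 := hf1 σ
    have f2 := hf1 τ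
    by_cases hst : σ = τ
    · subst hst
      have h3 := (ih σ).le x y hσ hτ hne
      have : 0 < (gf G (S σ) (d σ) (leaf x)).eval 1 * (gf G (S σ) (d σ) (leaf y)).eval 1 := by
        positivity
      have hq := mul_le_mul f1 f1 (by norm_num) (by omega)
      nlinarith [mul_le_mul_of_nonneg_right hq this.le]
    · rw [hs.P_val hst hσ hτ]
      have : 0 < (gf G (S σ) (d σ) (leaf x)).eval 1 * (gf G (S τ) (d τ) (leaf y)).eval 1 := by
        positivity
      have hF : (gf G (cls G w) (c σ) (c τ)).eval 1 ≤
        (gf G (cls G w) w (c σ)).eval 1 * (gf G (cls G w) w (c τ)).eval 1 := by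
        rcases hv with hv | hv
        · rw [hv.1, hv.1, hv.2 _ _ hst]; simp
        · exact (hv.2 σ τ hst).le
      nlinarith
  · intro x y hx hy hne heq
    obtain ⟨σ, hσ⟩ := hs.slot hx
    obtain ⟨τ, hτ⟩ := hs.slot hy
    have h1 := (ih σ).one x hσ
    have h2 := (ih τ).one y hτ
    rw [hs.h_val h₀ hσ, hs.h_val h₀ hτ] at heq
    rw [hs.h_eq h₀ hσ, hs.h_eq h₀ hτ]
    by_cases hst : σ = τ
    · subst hst
      have h3 := (ih σ).le x y hσ hτ hne
      have : 0 < (gf G (S σ) (d σ) (leaf x)).eval 1 * (gf G (S σ) (d σ) (leaf y)).eval 1 := by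
        positivity
      rcases hv with hv | hv
      · rw [hv.1] at heq ⊢
        obtain ⟨k, hk⟩ := (ih σ).eq x y hσ hτ hne (by rw [heq]; simp)
        refine ⟨k + 2, ?_⟩
        rw [pow_add, ← mul_assoc, hk]; ring
      · exfalso
        have f1 := hv.1 σ
        have hq := mul_le_mul f1 f1 (by norm_num) (by omega)
        nlinarith [mul_le_mul_of_nonneg_right hq this.le]
    · rw [hs.P_val hst hσ hτ] at heq
      have : 0 < (gf G (S σ) (d σ) (leaf x)).eval 1 * (gf G (S τ) (d τ) (leaf y)).eval 1 := by
        positivity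
      rcases hv with hv | hv
      · refine ⟨0, ?_⟩
        rw [hs.P_eq hst hσ hτ, hv.1, hv.1, hv.2 _ _ hst]; ring
      · exfalso
        have := hv.2 σ τ hst
        nlinarith

theorem node_vals : gf G (cls G w) w w = 1 := gf_self G (self_mem_cls w)

theorem good (hN : Net G leaf) (h₀ : IsSide G S₀ w v) : Good G leaf S₀ w := by
  induction hn : S₀.card using Nat.strong_induction_on generalizing S₀ w v with
  | _ n ih =>
  subst hn
  have ih' : ∀ S d c, RPart G S₀ (cls G w) S d c → Good G leaf S d := fun S d c h =>
    ih _ (h.card_lt h₀) h.side rfl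
  rcases classify hN h₀ with ⟨x, rfl, rfl⟩ | ⟨h1, S, d, hs⟩ | ⟨⟨S, d, hs⟩, hct⟩
  · have hu : ∀ y, leaf y ∈ ({leaf x} : Finset V) → y = x := by
      intro y hy; exact hN.inj (by simpa using hy)
    refine ⟨⟨x, by simp, ?_⟩, ?_, ?_, ?_⟩
    · rw [gf_self G (by simp)]; norm_num
    · intro y hy
      rw [hu y hy, gf_self G (by simp)]; norm_num
    · intro y y' hy hy' hne
      exact absurd ((hu y hy).trans (hu y' hy').symm) hne
    · intro y y' hy hy' hne
      exact absurd ((hu y hy).trans (hu y' hy').symm) hne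
  · have hw := node_vals (G := G) (w := w)
    refine slot_step hs h₀ (fun σ => ih' _ _ _ (hs.part σ)) ⟨true, by rw [hw]; norm_num⟩
      (Or.inl ⟨fun _ => hw, fun _ _ _ => hw⟩)
  · have hb : Big G w := by
      rcases hct with ⟨n, z, hc, h0⟩ | ⟨P, Q, l, z, p, ht, hp, hp', h0⟩
      · exact (cycV hc h0).big
      · exact (thV ht hp hp' h0).big
    obtain ⟨c, hc, h3⟩ := hb.ndvd
    exact slot_step hs h₀ (fun σ => ih' _ _ _ (hs.part σ)) ⟨⟨c, hc⟩, h3⟩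
      (Or.inr ⟨fun σ => hb.two _ σ.2, fun σ τ hst => hb.lt _ σ.2 _ τ.2
        (fun e => hst (Subtype.ext e))⟩)

end Good
end L2R

namespace L2R
set_option linter.unusedSectionVars false
open Polynomial
open scoped Classical

section Glue
variable {V : Type} [Fintype V] {G : SimpleGraph V} {Λ : Type} {leaf : Λ → V}
  {V' : Type} [Fintype V'] {G' : SimpleGraph V'} {leaf' : Λ → V'}

/-- Isomorphism of cores. -/
structure CoreMap (G : SimpleGraph V) (G' : SimpleGraph V') (K : Finset V) (K' : Finset V')
    (φ : V → V') : Prop where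
  bij : Set.BijOn φ K K'
  adj : ∀ a ∈ K, ∀ b ∈ K, G.Adj a b ↔ G'.Adj (φ a) (φ b)

/-- Isomorphism of rooted sides. -/
def SIso (G : SimpleGraph V) (leaf : Λ → V) (G' : SimpleGraph V') (leaf' : Λ → V')
    (S : Finset V) (S' : Finset V') (d : V) (d' : V') : Prop :=
  ∃ φ : V → V', CoreMap G G' S S' φ ∧ φ d = d' ∧ ∀ x, leaf x ∈ S → φ (leaf x) = leaf' x

variable {S₀ : Finset V} {w v : V} {ι : Type} {S : ι → Finset V} {d c : ι → V}
  {S₀' : Finset V'} {w' v' : V'} {ι' : Type} {S' : ι' → Finset V'} {d' c' : ι' → V'}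

theorem Slots.uniq (hs : Slots G leaf S₀ w ι S d c) {u : V} {σ τ : ι} (h1 : u ∈ S σ)
    (h2 : u ∈ S τ) : σ = τ := by
  by_contra hne
  exact Finset.disjoint_left.1 (hs.disj σ τ hne) h1 h2

theorem Slots.adjKS (hs : Slots G leaf S₀ w ι S d c) {k u : V} (hk : k ∈ cls G w) {σ : ι}
    (hu : u ∈ S σ) : G.Adj k u ↔ k = c σ ∧ u = d σ := by
  constructor
  · intro h
    have := (hs.part σ).side.only u hu k ((hs.part σ).dis k hk) h.symm
    exact ⟨this.2, this.1⟩
  · rintro ⟨rfl, rfl⟩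
    exact (hs.part σ).side.adj.symm

theorem Slots.adjSS (hs : Slots G leaf S₀ w ι S d c) {t u : V} {σ τ : ι} (hst : σ ≠ τ)
    (ht : t ∈ S σ) (hu : u ∈ S τ) : ¬ G.Adj t u := by
  intro h
  have h2 : u ∉ S σ := fun h' => hst (hs.uniq h' hu)
  have := (hs.part σ).side.only t ht u h2 h
  exact (hs.part τ).dis (c σ) (hs.part σ).cK (this.2 ▸ hu)

theorem glue (hs : Slots G leaf S₀ w ι S d c) (hs' : Slots G' leaf' S₀' w' ι' S' d' c')
    (h₀ : IsSide G S₀ w v) (h₀' : IsSide G' S₀' w' v') (β : ι ≃ ι') {φ₀ : V → V'}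
    (hφ : CoreMap G G' (cls G w) (cls G' w') φ₀) (hw : φ₀ w = w')
    (hc : ∀ σ, φ₀ (c σ) = c' (β σ))
    (hi : ∀ σ, SIso G leaf G' leaf' (S σ) (S' (β σ)) (d σ) (d' (β σ))) :
    SIso G leaf G' leaf' S₀ S₀' w w' := by
  choose ψ hψ hψd hψl using hi
  let φ : V → V' := fun u => if h : ∃ σ, u ∈ S σ then ψ h.choose u else φ₀ u
  have eS : ∀ σ, ∀ u ∈ S σ, φ u = ψ σ u := by
    intro σ u hu
    have h : ∃ σ, u ∈ S σ := ⟨σ, hu⟩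
    have : h.choose = σ := hs.uniq h.choose_spec hu
    simp only [φ, dif_pos h, this]
  have eK : ∀ u ∈ cls G w, φ u = φ₀ u := by
    intro u hu
    have h : ¬ ∃ σ, u ∈ S σ := fun ⟨σ, h⟩ => (hs.part σ).dis u hu h
    simp only [φ, dif_neg h]
  have mS : ∀ σ, ∀ u ∈ S σ, φ u ∈ S' (β σ) := by
    intro σ u hu
    rw [eS σ u hu]; exact (hψ σ).bij.mapsTo hu
  have mK : ∀ u ∈ cls G w, φ u ∈ cls G' w' := by
    intro u hu
    rw [eK u hu]; exact hφ.bij.mapsTo hu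
  have ks : ∀ u ∈ cls G w, ∀ σ, ∀ t ∈ S σ, φ u ≠ φ t := by
    intro u hu σ t ht e
    exact (hs'.part (β σ)).dis _ (mK u hu) (e ▸ mS σ t ht)
  have ss : ∀ σ τ, ∀ u ∈ S σ, ∀ t ∈ S τ, φ u = φ t → σ = τ := by
    intro σ τ u hu t ht e
    exact β.injective (hs'.uniq (mS σ u hu) (e ▸ mS τ t ht))
  refine ⟨φ, ⟨⟨?_, ?_, ?_⟩, ?_⟩, ?_, ?_⟩
  · intro u hu
    rcases hs.cover u hu with h | ⟨σ, h⟩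
    · exact cls_sub_side h₀' (mK u h)
    · exact (hs'.part _).sub (mS σ u h)
  · intro u hu t ht e
    rcases hs.cover u hu with h | ⟨σ, h⟩
    · rcases hs.cover t ht with h' | ⟨τ, h'⟩
      · rw [eK u h, eK t h'] at e
        exact hφ.bij.injOn h h' e
      · exact absurd e (ks u h τ t h')
    · rcases hs.cover t ht with h' | ⟨τ, h'⟩
      · exact absurd e.symm (ks t h' σ u h)
      · have := ss σ τ u h t h' e
        subst this
        rw [eS σ u h, eS σ t h'] at e
        exact (hψ σ).bij.injOn h h' e
  · intro u hu
    rcases hs'.cover u hu with h | ⟨σ, h⟩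
    · obtain ⟨a, ha, rfl⟩ := hφ.bij.surjOn h
      exact ⟨a, cls_sub_side h₀ ha, eK a ha⟩
    · obtain ⟨τ, rfl⟩ := β.surjective σ
      obtain ⟨a, ha, rfl⟩ := (hψ τ).bij.surjOn h
      exact ⟨a, (hs.part τ).sub ha, eS τ a ha⟩
  · intro u hu t ht
    rcases hs.cover u hu with h | ⟨σ, h⟩
    · rcases hs.cover t ht with h' | ⟨τ, h'⟩
      · rw [eK u h, eK t h']; exact hφ.adj u h t h'
      · rw [hs.adjKS h h', hs'.adjKS (mK u h) (mS τ t h'), eK u h, eS τ t h', ← hc, ← hψd]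
        constructor
        · rintro ⟨rfl, rfl⟩; exact ⟨rfl, rfl⟩
        · rintro ⟨h1, h2⟩
          exact ⟨hφ.bij.injOn h (hs.part τ).cK h1, (hψ τ).bij.injOn h' (hs.part τ).side.din h2⟩
    · rcases hs.cover t ht with h' | ⟨τ, h'⟩
      · rw [G.adj_comm, G'.adj_comm, hs.adjKS h' h, hs'.adjKS (mK t h') (mS σ u h), eK t h',
          eS σ u h, ← hc, ← hψd]
        constructor
        · rintro ⟨rfl, rfl⟩; exact ⟨rfl, rfl⟩
        · rintro ⟨h1, h2⟩
          exact ⟨hφ.bij.injOn h' (hs.part σ).cK h1, (hψ σ).bij.injOn h (hs.part σ).side.din h2⟩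
      · by_cases hst : σ = τ
        · subst hst
          rw [eS σ u h, eS σ t h']; exact (hψ σ).adj u h t h'
        · exact iff_of_false (hs.adjSS hst h h')
            (hs'.adjSS (fun e => hst (β.injective e)) (mS σ u h) (mS τ t h'))
  · rw [eK w (self_mem_cls w), hw]
  · intro x hx
    obtain ⟨σ, hσ⟩ := hs.slot hx
    rw [eS σ _ hσ]; exact hψl σ x hσ

/-- Matching of slots. -/
theorem match_slots (hs : Slots G leaf S₀ w ι S d c) (hs' : Slots G' leaf' S₀' w' ι' S' d' c')
    (hY : ∀ x, leaf x ∈ S₀ ↔ leaf' x ∈ S₀')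
    (ex : ∀ σ, ∃ x, leaf x ∈ S σ) (ex' : ∀ σ, ∃ x, leaf' x ∈ S' σ)
    (hsame : ∀ x y σ τ σ' τ', leaf x ∈ S σ → leaf y ∈ S τ → leaf' x ∈ S' σ' → leaf' y ∈ S' τ' →
      (σ = τ ↔ σ' = τ')) :
    ∃ β : ι ≃ ι', ∀ x σ, leaf x ∈ S σ ↔ leaf' x ∈ S' (β σ) := by
  choose r hr using ex
  choose r' hr' using ex'
  have a1 : ∀ σ, ∃ σ', leaf' (r σ) ∈ S' σ' := fun σ =>
    hs'.slot ((hY _).1 ((hs.part σ).sub (hr σ)))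
  have a2 : ∀ σ, ∃ σ', leaf (r' σ) ∈ S σ' := fun σ =>
    hs.slot ((hY _).2 ((hs'.part σ).sub (hr' σ)))
  choose f hf using a1
  choose g hg using a2
  have b1 : ∀ x σ, leaf x ∈ S σ → leaf' x ∈ S' (f σ) := by
    intro x σ hx
    obtain ⟨τ, hτ⟩ := hs'.slot ((hY _).1 ((hs.part σ).sub hx))
    have := (hsame x (r σ) σ σ τ (f σ) hx (hr σ) hτ (hf σ)).1 rfl
    rwa [← this]
  have b2 : ∀ x σ, leaf' x ∈ S' σ → leaf x ∈ S (g σ) := by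
    intro x σ hx
    obtain ⟨τ, hτ⟩ := hs.slot ((hY _).2 ((hs'.part σ).sub hx))
    have := (hsame x (r' σ) τ (g σ) σ σ hτ (hg σ) hx (hr' σ)).2 rfl
    rwa [← this]
  have gf' : ∀ σ, g (f σ) = σ := fun σ => hs.uniq (b2 _ _ (b1 _ _ (hr σ))) (hr σ)
  refine ⟨⟨f, g, gf', fun σ => hs'.uniq (b1 _ _ (b2 _ _ (hr' σ))) (hr' σ)⟩, fun x σ =>
    ⟨b1 x σ, fun h => ?_⟩⟩
  have := b2 x _ h
  simpa [gf'] using this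

end Glue
end L2R

namespace L2R
set_option linter.unusedSectionVars false
open Polynomial
open scoped Classical

section Mom

/-- The operator `X d/dX`. -/
noncomputable def dd (p : ℤ[X]) : ℤ[X] := X * derivative p
noncomputable def m0 (p : ℤ[X]) : ℤ := p.eval 1
noncomputable def m1 (p : ℤ[X]) : ℤ := (dd p).eval 1
noncomputable def m2 (p : ℤ[X]) : ℤ := (dd (dd p)).eval 1
noncomputable def m3 (p : ℤ[X]) : ℤ := (dd (dd (dd p))).eval 1

theorem dd_add (p q : ℤ[X]) : dd (p + q) = dd p + dd q := by simp [dd, mul_add]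
theorem dd_mul (p q : ℤ[X]) : dd (p * q) = dd p * q + p * dd q := by
  simp only [dd, derivative_mul]; ring
theorem dd_pow (n : ℕ) : dd (X ^ n) = (n : ℤ[X]) * X ^ n := by
  rcases n with _ | n
  · simp [dd]
  · simp only [dd, derivative_X_pow, Nat.add_sub_cancel, map_natCast]
    ring
theorem dd_cast (n : ℕ) (p : ℤ[X]) : dd ((n : ℤ[X]) * p) = n * dd p := by
  simp [dd, derivative_mul]; ring

theorem m0_add (p q : ℤ[X]) : m0 (p + q) = m0 p + m0 q := by simp [m0]
theorem m1_add (p q : ℤ[X]) : m1 (p + q) = m1 p + m1 q := by simp [m1, dd_add]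
theorem m2_add (p q : ℤ[X]) : m2 (p + q) = m2 p + m2 q := by simp [m2, dd_add]
theorem m3_add (p q : ℤ[X]) : m3 (p + q) = m3 p + m3 q := by simp [m3, dd_add]
theorem m0_pow (n : ℕ) : m0 (X ^ n) = 1 := by simp [m0]
theorem m1_pow (n : ℕ) : m1 (X ^ n) = n := by simp [m1, dd_pow]
theorem m2_pow (n : ℕ) : m2 (X ^ n) = (n : ℤ) ^ 2 := by simp [m2, dd_pow, dd_cast]; ring
theorem m3_pow (n : ℕ) : m3 (X ^ n) = (n : ℤ) ^ 3 := by simp [m3, dd_pow, dd_cast]; ring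
theorem m0_mul (p q : ℤ[X]) : m0 (p * q) = m0 p * m0 q := by simp [m0]
theorem m1_mul (p q : ℤ[X]) : m1 (p * q) = m1 p * m0 q + m0 p * m1 q := by
  simp [m1, m0, dd_mul]
theorem m2_mul (p q : ℤ[X]) : m2 (p * q) = m2 p * m0 q + 2 * m1 p * m1 q + m0 p * m2 q := by
  simp [m2, m1, m0, dd_mul, dd_add]; ring
theorem m3_mul (p q : ℤ[X]) : m3 (p * q) =
    m3 p * m0 q + 3 * m2 p * m1 q + 3 * m1 p * m2 q + m0 p * m3 q := by
  simp [m3, m2, m1, m0, dd_mul, dd_add]; ring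

end Mom

section CycRigid
variable {V : Type} [Fintype V] {G : SimpleGraph V} {V' : Type} [Fintype V'] {G' : SimpleGraph V'}
  {K : Finset V} {K' : Finset V'}

theorem cyc_moms {n : ℕ} {z : ℤ → V} (h : IsCyc G K n z) {i j : ℕ} (hij : i < j) (hj : j < n) :
    m0 (gf G K (z i) (z j)) = 2 ∧ m1 (gf G K (z i) (z j)) = n ∧
    m2 (gf G K (z i) (z j)) = ((j : ℤ) - i) ^ 2 + (n - ((j : ℤ) - i)) ^ 2 := by
  rw [gf_cyc' h hij hj, m0_add, m1_add, m2_add]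
  simp only [m0_pow, m1_pow, m2_pow]
  have e1 : ((j - i : ℕ) : ℤ) = (j : ℤ) - i := by omega
  have e2 : ((n - (j - i) : ℕ) : ℤ) = (n : ℤ) - ((j : ℤ) - i) := by omega
  rw [e1, e2]
  refine ⟨by norm_num, by ring, rfl⟩

theorem cyc_coreMap {n : ℕ} {z : ℤ → V} {z' : ℤ → V'} (h : IsCyc G K n z)
    (h' : IsCyc G' K' n z') {ε : ℤ} (hε : ε = 1 ∨ ε = -1) :
    ∃ φ, CoreMap G G' K K' φ ∧ ∀ a, φ (z a) = z' (ε * a) := by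
  have hε2 : ε * ε = 1 := by rcases hε with rfl | rfl <;> norm_num
  have hex : ∀ u : V, ∃ a : ℤ, u ∈ K → u = z a := by
    intro u
    by_cases hu : u ∈ K
    · obtain ⟨a, ha⟩ := h.cover u hu
      exact ⟨a, fun _ => ha⟩
    · exact ⟨0, fun hh => absurd hh hu⟩
  choose ix hix using hex
  have hφ : ∀ a, z' (ε * ix (z a)) = z' (ε * a) := by
    intro a
    rw [h'.eqv, ← mul_sub]
    exact Dvd.dvd.mul_left ((h.eqv _ _).1 (hix (z a) (h.mem a)).symm) _
  refine ⟨fun u => z' (ε * ix u), ⟨⟨fun u _ => h'.mem _, ?_, ?_⟩, ?_⟩, hφ⟩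
  · intro u hu t ht e
    obtain ⟨a, rfl⟩ := h.cover u hu
    obtain ⟨b, rfl⟩ := h.cover t ht
    simp only [hφ] at e
    rw [h'.eqv, ← mul_sub] at e
    rw [h.eqv]
    have := Dvd.dvd.mul_left e ε
    rwa [← mul_assoc, hε2, one_mul] at this
  · intro u hu
    obtain ⟨a, rfl⟩ := h'.cover u hu
    refine ⟨z (ε * a), h.mem _, ?_⟩
    show z' (ε * ix (z (ε * a))) = z' a
    rw [hφ, ← mul_assoc, hε2, one_mul]
  · intro u hu t ht
    obtain ⟨a, rfl⟩ := h.cover u hu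
    obtain ⟨b, rfl⟩ := h.cover t ht
    simp only [hφ]
    rw [h.adj a _ (h.mem b), h'.adj _ _ (h'.mem _), h.eqv, h.eqv, h'.eqv, h'.eqv]
    rcases hε with rfl | rfl
    · simp
    · rw [or_comm]
      apply or_congr
      · rw [← dvd_neg]; ring_nf
      · rw [← dvd_neg]; ring_nf

theorem cyc_rigid {n n' : ℕ} {z : ℤ → V} {z' : ℤ → V'} (h : IsCyc G K n z)
    (h' : IsCyc G' K' n' z') {β : V → V'}
    (hm : ∀ u ∈ K, u ≠ z 0 → β u ∈ K' ∧ β u ≠ z' 0)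
    (hinj : ∀ u ∈ K, u ≠ z 0 → ∀ t ∈ K, t ≠ z 0 → u ≠ t → β u ≠ β t)
    (hstar : ∀ u ∈ K, u ≠ z 0 → ∀ t ∈ K, t ≠ z 0 → u ≠ t →
      gf G K u t * gf G' K' (z' 0) (β u) * gf G' K' (z' 0) (β t) =
      gf G' K' (β u) (β t) * gf G K (z 0) u * gf G K (z 0) t) :
    ∃ φ, CoreMap G G' K K' φ ∧ φ (z 0) = z' 0 ∧ ∀ u ∈ K, u ≠ z 0 → φ u = β u := by
  have h3 := h.three
  have hz0 : ∀ i : ℕ, 0 < i → i < n → z i ≠ z 0 := fun i h1 h2 =>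
    (h.ne (by omega) (by omega)).symm
  have hb : ∀ i : ℕ, ∃ j : ℕ, 0 < i → i < n → 0 < j ∧ j < n' ∧ β (z i) = z' j := by
    intro i
    by_cases hi : 0 < i ∧ i < n
    · have := hm (z i) (h.mem _) (hz0 i hi.1 hi.2)
      obtain ⟨j, hj⟩ := h'.idx this.1 this.2
      exact ⟨j, fun _ _ => hj⟩
    · exact ⟨0, fun h1 h2 => absurd ⟨h1, h2⟩ hi⟩
  choose b hb using hb
  have st : ∀ i j : ℕ, 0 < i → i < j → j < n → b i ≠ b j ∧
      gf G K (z i) (z j) * gf G' K' (z' (0 : ℕ)) (z' (b i)) * gf G' K' (z' (0 : ℕ)) (z' (b j)) =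
      gf G' K' (z' (b i)) (z' (b j)) * gf G K (z (0 : ℕ)) (z i) * gf G K (z (0 : ℕ)) (z j) := by
    intro i j h1 h2 h4
    have hne : z i ≠ z j := h.ne (by omega) (by omega)
    have bi := hb i h1 (by omega)
    have bj := hb j (by omega) h4
    have := hstar _ (h.mem i) (hz0 i h1 (by omega)) _ (h.mem j) (hz0 j (by omega) h4) hne
    rw [bi.2.2, bj.2.2] at this
    refine ⟨fun e => ?_, by simpa using this⟩
    apply hinj _ (h.mem i) (hz0 i h1 (by omega)) _ (h.mem j) (hz0 j (by omega) h4) hne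
    rw [bi.2.2, bj.2.2, e]
  have hnn : n' = n := by
    obtain ⟨hne, hs⟩ := st 1 2 (by omega) (by omega) (by omega)
    have b1 := hb 1 (by omega) (by omega)
    have b2 := hb 2 (by omega) (by omega)
    have q1 := cyc_moms h (i := 1) (j := 2) (by omega) (by omega)
    have q2 := cyc_moms h (i := 0) (j := 2) (by omega) (by omega)
    have q3 := cyc_moms h (i := 0) (j := 1) (by omega) (by omega)
    have q4 := cyc_moms h' (i := 0) (j := b 1) (by omega) (by omega)
    have q5 := cyc_moms h' (i := 0) (j := b 2) (by omega) (by omega)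
    have q6 : m0 (gf G' K' (z' (b 1)) (z' (b 2))) = 2 ∧ m1 (gf G' K' (z' (b 1)) (z' (b 2))) = n' := by
      rcases lt_or_gt_of_ne hne with hh | hh
      · have := cyc_moms h' hh b2.2.1
        exact ⟨this.1, this.2.1⟩
      · rw [gf_symm]
        have := cyc_moms h' hh b1.2.1
        exact ⟨this.1, this.2.1⟩
    have := congrArg m1 hs
    simp only [m1_mul, m0_mul] at this
    rw [q1.1, q1.2.1, q2.1, q2.2.1, q3.1, q3.2.1, q4.1, q4.2.1, q5.1, q5.2.1, q6.1, q6.2] at this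
    omega
  subst hnn
  have num : ∀ i j : ℕ, 0 < i → i < j → j < n' →
      (b i < b j ∧ (i : ℤ) * (n' - j) = b i * (n' - b j)) ∨
      (b j < b i ∧ (i : ℤ) * (n' - j) = b j * (n' - b i)) := by
    intro i j h1 h2 h4
    obtain ⟨hne, hs⟩ := st i j h1 h2 h4
    have b1 := hb i (by omega) (by omega)
    have b2 := hb j (by omega) (by omega)
    have q1 := cyc_moms h h2 h4
    have q2 := cyc_moms h (i := 0) (j := j) (by omega) (by omega)
    have q3 := cyc_moms h (i := 0) (j := i) (by omega) (by omega)
    have q4 := cyc_moms h' (i := 0) (j := b i) (by omega) (by omega)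
    have q5 := cyc_moms h' (i := 0) (j := b j) (by omega) (by omega)
    have := congrArg m2 hs
    simp only [m2_mul, m1_mul, m0_mul] at this
    rcases lt_or_gt_of_ne hne with hh | hh
    · left
      refine ⟨hh, ?_⟩
      have q6 := cyc_moms h' hh b2.2.1
      rw [q1.1, q1.2.1, q1.2.2, q2.1, q2.2.1, q2.2.2, q3.1, q3.2.1, q3.2.2, q4.1, q4.2.1, q4.2.2,
        q5.1, q5.2.1, q5.2.2, q6.1, q6.2.1, q6.2.2] at this
      push_cast at this
      have h16 : (16 : ℤ) * (i * (n' - j)) = 16 * (b i * (n' - b j)) := by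
        linear_combination this
      linarith
    · right
      refine ⟨hh, ?_⟩
      have q6 := cyc_moms h' hh b1.2.1
      rw [gf_symm G' K' (z' (b i)) (z' (b j))] at this
      rw [q1.1, q1.2.1, q1.2.2, q2.1, q2.2.1, q2.2.2, q3.1, q3.2.1, q3.2.2, q4.1, q4.2.1, q4.2.2,
        q5.1, q5.2.1, q5.2.2, q6.1, q6.2.1, q6.2.2] at this
      push_cast at this
      have h16 : (16 : ℤ) * (i * (n' - j)) = 16 * (b j * (n' - b i)) := by
        linear_combination this
      linarith
  have b1 := hb 1 (by omega) (by omega)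
  have bl := hb (n' - 1) (by omega) (by omega)
  have hend : b 1 = 1 ∨ b 1 = n' - 1 := by
    have e : (1 : ℤ) * (n' - ((n' - 1 : ℕ) : ℤ)) = 1 := by omega
    rcases num 1 (n' - 1) (by omega) (by omega) (by omega) with ⟨-, hh⟩ | ⟨-, hh⟩
    · left
      rw [Nat.cast_one, e] at hh
      have := Int.eq_one_or_neg_one_of_mul_eq_one hh.symm
      omega
    · right
      rw [Nat.cast_one, e, mul_comm] at hh
      have := Int.eq_one_or_neg_one_of_mul_eq_one hh.symm
      omega
  have fin : ∃ ε : ℤ, (ε = 1 ∨ ε = -1) ∧ ∀ i : ℕ, 0 < i → i < n' → z' (b i) = z' (ε * i) := by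
    rcases hend with he | he
    · refine ⟨1, Or.inl rfl, fun i h1 h2 => ?_⟩
      by_cases hi : i = 1
      · rw [hi, he]; simp
      · have bi := hb i h1 h2
        rcases num 1 i (by omega) (by omega) h2 with ⟨-, hh⟩ | ⟨hh, -⟩
        · rw [he] at hh
          push_cast at hh
          congr 1; omega
        · omega
    · refine ⟨-1, Or.inr rfl, fun i h1 h2 => ?_⟩
      rw [h'.eqv]
      by_cases hi : i = 1
      · rw [hi, he]
        exact ⟨1, by push_cast; omega⟩
      · have bi := hb i h1 h2
        rcases num 1 i (by omega) (by omega) h2 with ⟨hh, -⟩ | ⟨-, hh⟩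
        · omega
        · rw [he] at hh
          have e : (n' : ℤ) - ((n' - 1 : ℕ) : ℤ) = 1 := by omega
          rw [e] at hh
          exact ⟨1, by push_cast at hh; omega⟩
  obtain ⟨ε, hε, hbε⟩ := fin
  obtain ⟨φ, hφ, hφz⟩ := cyc_coreMap h h' hε
  refine ⟨φ, hφ, by rw [hφz]; simp, fun u hu hu0 => ?_⟩
  obtain ⟨i, h1, h2, rfl⟩ := h.idx hu hu0
  rw [hφz, (hb i h1 h2).2.2, hbε i h1 h2]

end CycRigid
end L2R

namespace L2R
set_option linter.unusedSectionVars false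
open Polynomial
open scoped Classical

section ThetaMap
variable {V : Type} [Fintype V] {G : SimpleGraph V} {V' : Type} [Fintype V'] {G' : SimpleGraph V'}
  {K : Finset V} {K' : Finset V'} {P Q : V} {P' Q' : V'} {l : Fin 3 → ℕ}
  {z : Fin 3 → ℕ → V} {z' : Fin 3 → ℕ → V'}

theorem sum3 (l : Fin 3 → ℕ) {s t r : Fin 3} (hst : s ≠ t) (hsr : s ≠ r) (htr : t ≠ r) :
    l 0 + l 1 + l 2 = l s + l t + l r := by
  fin_cases s <;> fin_cases t <;> fin_cases r <;> simp at * <;> omega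

/-- Coincidences of coordinates on a theta. -/
theorem IsTheta.eqv (h : IsTheta G K P Q l z) {s t : Fin 3} {i j : ℕ} (hi : i ≤ l s)
    (hj : j ≤ l t) :
    z s i = z t j ↔ (i = 0 ∧ j = 0) ∨ (i = l s ∧ j = l t) ∨ (s = t ∧ i = j) := by
  have p1 := h.pos s
  have p2 := h.pos t
  constructor
  · intro e
    rcases Nat.eq_zero_or_pos i with rfl | hi0
    · rw [h.zP] at e
      rcases Nat.eq_zero_or_pos j with rfl | hj0
      · exact Or.inl ⟨rfl, rfl⟩
      · rcases hj.lt_or_eq with hj1 | rfl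
        · exact absurd e.symm (h.neP t j hj0 hj1)
        · rw [h.zQ] at e; exact absurd e h.PQ
    · rcases hi.lt_or_eq with hi1 | rfl
      · rcases Nat.eq_zero_or_pos j with rfl | hj0
        · rw [h.zP] at e; exact absurd e (h.neP s i hi0 hi1)
        · rcases hj.lt_or_eq with hj1 | rfl
          · exact Or.inr (Or.inr (h.inj _ _ _ _ hi0 hi1 hj0 hj1 e))
          · rw [h.zQ] at e; exact absurd e (h.neQ s i hi0 hi1)
      · rw [h.zQ] at e
        rcases Nat.eq_zero_or_pos j with rfl | hj0
        · rw [h.zP] at e; exact absurd e.symm h.PQ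
        · rcases hj.lt_or_eq with hj1 | rfl
          · exact absurd e.symm (h.neQ t j hj0 hj1)
          · exact Or.inr (Or.inl ⟨rfl, rfl⟩)
  · rintro (⟨rfl, rfl⟩ | ⟨rfl, rfl⟩ | ⟨rfl, rfl⟩)
    · rw [h.zP, h.zP]
    · rw [h.zQ, h.zQ]
    · rfl

theorem IsTheta.memK (h : IsTheta G K P Q l z) {s : Fin 3} {i : ℕ} (hi : i ≤ l s) : z s i ∈ K := by
  rcases Nat.eq_zero_or_pos i with rfl | hi0
  · rw [h.zP]; exact h.PK
  · rcases hi.lt_or_eq with hi1 | rfl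
    · exact h.mem s i hi0 hi1
    · rw [h.zQ]; exact h.QK

theorem IsTheta.coord (h : IsTheta G K P Q l z) {u : V} (hu : u ∈ K) :
    ∃ a : Fin 3 × ℕ, a.2 ≤ l a.1 ∧ u = z a.1 a.2 := by
  rcases h.cover u hu with rfl | rfl | ⟨s, i, h1, h2, h3⟩
  · exact ⟨(0, 0), Nat.zero_le _, (h.zP 0).symm⟩
  · exact ⟨(0, l 0), le_refl _, (h.zQ 0).symm⟩
  · exact ⟨(s, i), h2.le, h3⟩

theorem IsTheta.eqv2 (h : IsTheta G K P Q l z) (h' : IsTheta G' K' P' Q' l z')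
    {s t : Fin 3} {i j : ℕ} (hi : i ≤ l s) (hj : j ≤ l t) :
    z s i = z t j ↔ z' s i = z' t j := by
  rw [h.eqv hi hj, h'.eqv hi hj]

theorem IsTheta.adj2 (h : IsTheta G K P Q l z) (h' : IsTheta G' K' P' Q' l z')
    {s t : Fin 3} {i j : ℕ} (hi : i ≤ l s) (hj : j ≤ l t) :
    G.Adj (z s i) (z t j) ↔ G'.Adj (z' s i) (z' t j) := by
  rcases Nat.eq_zero_or_pos i with rfl | hi0
  · rw [h.zP, h'.zP, h.adjP _ (h.memK hj), h'.adjP _ (h'.memK hj)]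
    exact exists_congr fun r => h.eqv2 h' hj (h.pos r)
  · rcases hi.lt_or_eq with hi1 | rfl
    · rw [h.adj s i hi0 hi1 _ (h.memK hj), h'.adj s i hi0 hi1 _ (h'.memK hj),
        h.eqv2 h' hj (by omega), h.eqv2 h' hj (by omega)]
    · rw [h.zQ, h'.zQ, h.adjQ _ (h.memK hj), h'.adjQ _ (h'.memK hj)]
      exact exists_congr fun r => h.eqv2 h' hj (Nat.sub_le _ _)

theorem theta_coreMap (h : IsTheta G K P Q l z) (h' : IsTheta G' K' P' Q' l z') :
    ∃ φ, CoreMap G G' K K' φ ∧ ∀ s i, i ≤ l s → φ (z s i) = z' s i := by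
  have hc : ∀ u, ∃ a : Fin 3 × ℕ, u ∈ K → a.2 ≤ l a.1 ∧ u = z a.1 a.2 := by
    intro u
    by_cases hu : u ∈ K
    · obtain ⟨a, ha⟩ := h.coord hu
      exact ⟨a, fun _ => ha⟩
    · exact ⟨(0, 0), fun hh => absurd hh hu⟩
  choose c hc using hc
  have key : ∀ s i, i ≤ l s → z' (c (z s i)).1 (c (z s i)).2 = z' s i := by
    intro s i hi
    have := hc (z s i) (h.memK hi)
    exact ((h.eqv2 h' hi this.1).1 this.2).symm
  refine ⟨fun u => z' (c u).1 (c u).2, ⟨⟨?_, ?_, ?_⟩, ?_⟩, key⟩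
  · intro u hu
    exact h'.memK (hc u hu).1
  · intro u hu t ht e
    have h1 := hc u hu
    have h2 := hc t ht
    rw [h1.2, h2.2]
    exact (h.eqv2 h' h1.1 h2.1).2 e
  · intro u hu
    obtain ⟨a, ha, rfl⟩ := h'.coord hu
    exact ⟨z a.1 a.2, h.memK ha, key _ _ ha⟩
  · intro u hu t ht
    have h1 := hc u hu
    have h2 := hc t ht
    have := h.adj2 h' h1.1 h2.1
    rwa [← h1.2, ← h2.2] at this

/-- Value on a single arc, through the index distance only. -/
theorem IsTheta.same_dist (h : IsTheta G K P Q l z) (h' : IsTheta G' K' P' Q' l z') {s : Fin 3}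
    {i j i' j' : ℕ} (hi : 0 < i) (hi1 : i < l s) (hj : 0 < j) (hj1 : j < l s) (hij : i ≠ j)
    (hi' : 0 < i') (hi1' : i' < l s) (hj' : 0 < j') (hj1' : j' < l s)
    (hd : |(i : ℤ) - j| = |(i' : ℤ) - j'|) :
    gf G K (z s i) (z s j) = gf G' K' (z' s i') (z' s j') := by
  obtain ⟨t, r, hst, hsr, htr⟩ := others s
  have go : ∀ {V : Type} [Fintype V] {G : SimpleGraph V} {K : Finset V} {P Q : V}
      {z : Fin 3 → ℕ → V} (_ : IsTheta G K P Q l z) {i j : ℕ}, 0 < i → i < l s → 0 < j → j < l s →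
      i ≠ j → gf G K (z s i) (z s j) = X ^ (|(i : ℤ) - j|.toNat) +
        X ^ (l t + l s - |(i : ℤ) - j|.toNat) + X ^ (l r + l s - |(i : ℤ) - j|.toNat) := by
    intro V _ G K P Q z h i j hi hi1 hj hj1 hij
    rcases lt_or_gt_of_ne hij with hh | hh
    · rw [h.gf_same hst hsr htr hi hh hj1]
      rw [abs_of_neg (by omega)]
      have e1 : (-((i : ℤ) - j)).toNat = j - i := by omega
      rw [e1]
      have e2 : i + l t + l s - j = l t + l s - (j - i) := by omega
      have e3 : i + l r + l s - j = l r + l s - (j - i) := by omega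
      rw [e2, e3]
    · rw [gf_symm, h.gf_same hst hsr htr hj hh hi1]
      rw [abs_of_pos (by omega)]
      have e1 : ((i : ℤ) - j).toNat = i - j := by omega
      rw [e1]
      have e2 : j + l t + l s - i = l t + l s - (i - j) := by omega
      have e3 : j + l r + l s - i = l r + l s - (i - j) := by omega
      rw [e2, e3]
  have hij' : i' ≠ j' := by
    rintro rfl
    rw [sub_self, abs_zero, abs_eq_zero] at hd
    omega
  rw [go h hi hi1 hj hj1 hij, go h' hi' hi1' hj' hj1' hij', hd]

theorem IsTheta.same_moms (h : IsTheta G K P Q l z) {s : Fin 3}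
    {i j : ℕ} (hi : 0 < i) (hi1 : i < l s) (hj : 0 < j) (hj1 : j < l s) (hij : i ≠ j) :
    m0 (gf G K (z s i) (z s j)) = 3 ∧
    m1 (gf G K (z s i) (z s j)) = l 0 + l 1 + l 2 + l s - |(i : ℤ) - j| := by
  have go : ∀ i j : ℕ, 0 < i → i < j → j < l s → m0 (gf G K (z s i) (z s j)) = 3 ∧
    m1 (gf G K (z s i) (z s j)) = l 0 + l 1 + l 2 + l s - |(i : ℤ) - j| := by
    intro i j hi hij hj
    obtain ⟨t, r, hst, hsr, htr⟩ := others s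
    have hL : l 0 + l 1 + l 2 = l s + l t + l r := sum3 l hst hsr htr
    rw [h.gf_same hst hsr htr hi hij hj, abs_of_neg (by omega)]
    simp only [m0_add, m1_add, m0_pow, m1_pow]
    refine ⟨by norm_num, ?_⟩
    zify at hL
    rw [hL]
    omega
  rcases lt_or_gt_of_ne hij with hh | hh
  · exact go i j hi hh hj1
  · rw [gf_symm, abs_sub_comm]
    exact go j i hj hh hi1

theorem IsTheta.diff_moms (h : IsTheta G K P Q l z) {s t r : Fin 3} (hst : s ≠ t) (hsr : s ≠ r)
    (htr : t ≠ r) {i j : ℕ} (hi : 0 < i) (hi1 : i < l s) (hj : 0 < j) (hj1 : j < l t) :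
    m0 (gf G K (z s i) (z t j)) = 4 ∧
    m1 (gf G K (z s i) (z t j)) = 2 * (l s + l t + l r) ∧
    m2 (gf G K (z s i) (z t j)) = (i + j) ^ 2 + (i + l r + l t - j) ^ 2 + (l s + l t - i - j) ^ 2 +
      (l s - i + l r + j) ^ 2 ∧
    m3 (gf G K (z s i) (z t j)) = (i + j) ^ 3 + (i + l r + l t - j) ^ 3 + (l s + l t - i - j) ^ 3 +
      (l s - i + l r + j) ^ 3 := by
  rw [h.gf_diff hst hsr htr hi hi1 hj hj1]
  have e1 : ((i + l r + l t - j : ℕ) : ℤ) = i + l r + l t - j := by omega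
  have e2 : ((l s + l t - i - j : ℕ) : ℤ) = l s + l t - i - j := by omega
  have e3 : ((l s - i + l r + j : ℕ) : ℤ) = l s - i + l r + j := by omega
  have e4 : ((i + j : ℕ) : ℤ) = i + j := by omega
  simp only [m0_add, m1_add, m2_add, m3_add, m0_pow, m1_pow, m2_pow, m3_pow, e1, e2, e3, e4]
  exact ⟨by norm_num, by ring, trivial, trivial⟩

end ThetaMap
end L2R

namespace L2R
set_option linter.unusedSectionVars false
open Polynomial
open scoped Classical

section ThetaRigid
variable {V : Type} [Fintype V] {G : SimpleGraph V} {V' : Type} [Fintype V'] {G' : SimpleGraph V'}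
  {K : Finset V} {K' : Finset V'} {P Q : V} {P' Q' : V'} {l : Fin 3 → ℕ}
  {z : Fin 3 → ℕ → V} {z' : Fin 3 → ℕ → V'}

theorem isometry_interval {n : ℕ} {b : ℕ → ℕ} (hb : ∀ i, 0 < i → i < n → 0 < b i ∧ b i < n)
    (hd : ∀ i j, 0 < i → i < n → 0 < j → j < n → |(i : ℤ) - j| = |(b i : ℤ) - b j|) :
    (∀ i, 0 < i → i < n → b i = i) ∨ (∀ i, 0 < i → i < n → b i = n - i) := by
  by_cases hn : 1 < n
  · have b1 := hb 1 (by omega) hn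
    have b2 := hb (n - 1) (by omega) (by omega)
    have hh := hd 1 (n - 1) (by omega) hn (by omega) (by omega)
    have key : b 1 = 1 ∨ b 1 = n - 1 := by
      rw [abs_sub_comm, abs_of_nonneg (by omega)] at hh
      rcases abs_cases ((b 1 : ℤ) - b (n - 1)) with h1 | h1 <;> omega
    rcases key with h1 | h1
    · left
      intro i hi hi'
      have := hd 1 i (by omega) hn hi hi'
      have := hb i hi hi'
      rcases abs_cases ((b 1 : ℤ) - b i) with h3 | h3 <;>
        rcases abs_cases (((1 : ℕ) : ℤ) - i) with h2 | h2 <;> omega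
    · right
      intro i hi hi'
      have := hd 1 i (by omega) hn hi hi'
      have := hb i hi hi'
      rcases abs_cases ((b 1 : ℤ) - b i) with h3 | h3 <;>
        rcases abs_cases (((1 : ℕ) : ℤ) - i) with h2 | h2 <;> omega
  · left
    intro i hi hi'
    omega

/-- Arithmetic data for matching two thetas with arcs already identified. -/
structure TStar (G : SimpleGraph V) (K : Finset V) (G' : SimpleGraph V') (K' : Finset V')
    (l : Fin 3 → ℕ) (z : Fin 3 → ℕ → V) (z' : Fin 3 → ℕ → V') (b : Fin 3 → ℕ → ℕ) (p : ℕ) :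
    Prop where
  p0 : 0 < p
  p1 : p < l 0
  b0 : ∀ s i, 0 < i → i < l s → 0 < b s i
  b1 : ∀ s i, 0 < i → i < l s → b s i < l s
  inj : ∀ s i j, 0 < i → i < l s → 0 < j → j < l s → i ≠ j → b s i ≠ b s j
  star : ∀ s i t j, 0 < i → i < l s → 0 < j → j < l t → (s, i) ≠ (t, j) → (s, i) ≠ (0, p) →
    (t, j) ≠ (0, p) →
    gf G K (z s i) (z t j) * gf G' K' (z' 0 (b 0 p)) (z' s (b s i)) *
      gf G' K' (z' 0 (b 0 p)) (z' t (b t j)) =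
    gf G' K' (z' s (b s i)) (z' t (b t j)) * gf G K (z 0 p) (z s i) * gf G K (z 0 p) (z t j)

theorem TStar.isom (T : TStar G K G' K' l z z' b p) (h : IsTheta G K P Q l z)
    (h' : IsTheta G' K' P' Q' l z') (s : Fin 3) (i j : ℕ) (hi : 0 < i) (hi1 : i < l s)
    (hj : 0 < j) (hj1 : j < l s) : |(i : ℤ) - j| = |(b s i : ℤ) - b s j| := by
  have hp := T.p0
  have hp1 := T.p1
  have hb0 := T.b0
  have hb1 := T.b1
  -- distance to the root on arc zero
  have root : ∀ i, 0 < i → i < l 0 → i ≠ p → |(p : ℤ) - i| = |(b 0 p : ℤ) - b 0 i| := by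
    intro i hi hi1 hip
    obtain ⟨t, j, h0t, hj, hj1⟩ := h.offroot 0
    obtain ⟨r, h0r, htr⟩ := third h0t
    have st := T.star 0 i t j hi hi1 hj hj1 (by simp [h0t]) (by simp [hip]) (by simp [h0t.symm])
    have q1 := h.diff_moms h0t h0r htr hi hi1 hj hj1
    have q2 := h'.diff_moms h0t h0r htr (hb0 0 i hi hi1) (hb1 0 i hi hi1) (hb0 t j hj hj1)
      (hb1 t j hj hj1)
    have q3 := h.diff_moms h0t h0r htr hp hp1 hj hj1
    have q4 := h'.diff_moms h0t h0r htr (hb0 0 p hp hp1) (hb1 0 p hp hp1) (hb0 t j hj hj1)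
      (hb1 t j hj hj1)
    have q5 := h.same_moms hp hp1 hi hi1 hip.symm
    have q6 := h'.same_moms (hb0 0 p hp hp1) (hb1 0 p hp hp1) (hb0 0 i hi hi1) (hb1 0 i hi hi1)
      (T.inj 0 p i hp hp1 hi hi1 hip.symm)
    have := congrArg m1 st
    simp only [m1_mul, m0_mul] at this
    rw [q1.1, q1.2.1, q2.1, q2.2.1, q3.1, q3.2.1, q4.1, q4.2.1, q5.1, q5.2, q6.1, q6.2] at this
    linarith
  by_cases hij : i = j
  · subst hij; simp
  have q1 := h.same_moms hi hi1 hj hj1 hij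
  have q2 := h'.same_moms (hb0 s i hi hi1) (hb1 s i hi hi1) (hb0 s j hj hj1) (hb1 s j hj hj1)
      (T.inj s i j hi hi1 hj hj1 hij)
  by_cases hs : s = 0
  · subst hs
    by_cases hip : i = p
    · subst hip
      exact root j hj hj1 (Ne.symm hij)
    by_cases hjp : j = p
    · subst hjp
      rw [abs_sub_comm, root i hi hi1 hij, abs_sub_comm]
    have st := T.star 0 i 0 j hi hi1 hj hj1 (by simp [hij]) (by simp [hip]) (by simp [hjp])
    have q3 := h.same_moms hp hp1 hi hi1 (Ne.symm hip)
    have q4 := h'.same_moms (hb0 0 p hp hp1) (hb1 0 p hp hp1) (hb0 0 i hi hi1) (hb1 0 i hi hi1)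
      (T.inj 0 p i hp hp1 hi hi1 (Ne.symm hip))
    have q5 := h.same_moms hp hp1 hj hj1 (Ne.symm hjp)
    have q6 := h'.same_moms (hb0 0 p hp hp1) (hb1 0 p hp hp1) (hb0 0 j hj hj1) (hb1 0 j hj hj1)
      (T.inj 0 p j hp hp1 hj hj1 (Ne.symm hjp))
    have r1 := root i hi hi1 hip
    have r2 := root j hj hj1 hjp
    have := congrArg m1 st
    simp only [m1_mul, m0_mul] at this
    rw [q1.1, q1.2, q2.1, q2.2, q3.1, q3.2, q4.1, q4.2, q5.1, q5.2, q6.1, q6.2] at this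
    linarith
  · have h0t : (0 : Fin 3) ≠ s := Ne.symm hs
    obtain ⟨r, h0r, htr⟩ := third h0t
    have st := T.star s i s j hi hi1 hj hj1 (by simp [hij]) (by simp [hs]) (by simp [hs])
    have q3 := h.diff_moms h0t h0r htr hp hp1 hi hi1
    have q4 := h'.diff_moms h0t h0r htr (hb0 0 p hp hp1) (hb1 0 p hp hp1) (hb0 s i hi hi1)
      (hb1 s i hi hi1)
    have q5 := h.diff_moms h0t h0r htr hp hp1 hj hj1
    have q6 := h'.diff_moms h0t h0r htr (hb0 0 p hp hp1) (hb1 0 p hp hp1) (hb0 s j hj hj1)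
      (hb1 s j hj hj1)
    have := congrArg m1 st
    simp only [m1_mul, m0_mul] at this
    rw [q1.1, q1.2, q2.1, q2.2, q3.1, q3.2.1, q4.1, q4.2.1, q5.1, q5.2.1, q6.1, q6.2.1] at this
    linarith

/-- Each arc is preserved or reversed. -/
theorem TStar.signs (T : TStar G K G' K' l z z' b p) (h : IsTheta G K P Q l z)
    (h' : IsTheta G' K' P' Q' l z') (s : Fin 3) :
    ∃ ε : ℤ, (ε = 1 ∨ ε = -1) ∧
      ∀ i, 0 < i → i < l s → 2 * (b s i : ℤ) - l s = ε * (2 * i - l s) := by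
  rcases isometry_interval (n := l s) (b := b s)
    (fun i h1 h2 => ⟨T.b0 s i h1 h2, T.b1 s i h1 h2⟩) (T.isom h h' s) with hh | hh
  · exact ⟨1, Or.inl rfl, fun i h1 h2 => by rw [hh i h1 h2]; ring⟩
  · refine ⟨-1, Or.inr rfl, fun i h1 h2 => ?_⟩
    rw [hh i h1 h2]
    have : ((l s - i : ℕ) : ℤ) = l s - i := by omega
    rw [this]; ring

theorem gf_diff_ne (h : IsTheta G K P Q l z) {s t : Fin 3} {i j : ℕ} (hi : 0 < i)
    (hi' : i < l s) (hj : 0 < j) (hj' : j < l t) (hst : s ≠ t) : gf G K (z s i) (z t j) ≠ 0 := by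
  intro e
  have := h.diff_val hi hi' hj hj' hst
  rw [e] at this
  simp at this

theorem gf_same_ne (h : IsTheta G K P Q l z) {s : Fin 3} {i j : ℕ} (hi : 0 < i)
    (hi' : i < l s) (hj : 0 < j) (hj' : j < l s) (hij : i ≠ j) : gf G K (z s i) (z s j) ≠ 0 := by
  intro e
  have := h.same_val hi hi' hj hj' hij
  rw [e] at this
  simp at this

/-- The sign of arc `t` agrees with that of arc `0` when arc `0` has another vertex. -/
theorem TStar.sign_long (T : TStar G K G' K' l z z' b p) (h : IsTheta G K P Q l z)
    (h' : IsTheta G' K' P' Q' l z') {t : Fin 3} (h0t : 0 ≠ t) {i j : ℕ} (hi : 0 < i)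
    (hi1 : i < l 0) (hip : i ≠ p) (hj : 0 < j) (hj1 : j < l t) {ε η : ℤ}
    (he : ε = 1 ∨ ε = -1) (hn : η = 1 ∨ η = -1)
    (hε : ∀ i, 0 < i → i < l 0 → 2 * (b 0 i : ℤ) - l 0 = ε * (2 * i - l 0))
    (hη : ∀ i, 0 < i → i < l t → 2 * (b t i : ℤ) - l t = η * (2 * i - l t)) :
    2 * (b t j : ℤ) - l t = ε * (2 * j - l t) := by
  have hp := T.p0
  have hp1 := T.p1
  have hb0 := T.b0
  have hb1 := T.b1
  obtain ⟨r, h0r, htr⟩ := third h0t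
  have st := T.star 0 i t j hi hi1 hj hj1 (by simp [h0t]) (by simp [hip]) (by simp [h0t.symm])
  have e1 := h.same_dist h' hp hp1 hi hi1 (Ne.symm hip) (hb0 0 p hp hp1) (hb1 0 p hp hp1)
    (hb0 0 i hi hi1) (hb1 0 i hi hi1) (T.isom h h' 0 p i hp hp1 hi hi1)
  have hne := gf_same_ne h hp hp1 hi hi1 (Ne.symm hip)
  rw [← e1] at st
  have st2 : gf G K (z 0 i) (z t j) * gf G' K' (z' 0 (b 0 p)) (z' t (b t j)) =
      gf G' K' (z' 0 (b 0 i)) (z' t (b t j)) * gf G K (z 0 p) (z t j) := by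
    apply mul_right_cancel₀ hne
    linear_combination st
  have q1 := h.diff_moms h0t h0r htr hi hi1 hj hj1
  have q2 := h'.diff_moms h0t h0r htr (hb0 0 i hi hi1) (hb1 0 i hi hi1) (hb0 t j hj hj1)
    (hb1 t j hj hj1)
  have q3 := h.diff_moms h0t h0r htr hp hp1 hj hj1
  have q4 := h'.diff_moms h0t h0r htr (hb0 0 p hp hp1) (hb1 0 p hp hp1) (hb0 t j hj hj1)
    (hb1 t j hj hj1)
  have k2 := congrArg m2 st2
  have k3 := congrArg m3 st2
  simp only [m3_mul, m2_mul, m1_mul, m0_mul] at k2 k3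
  rw [q1.1, q1.2.1, q1.2.2.1, q2.1, q2.2.1, q2.2.2.1, q3.1, q3.2.1, q3.2.2.1, q4.1, q4.2.1,
    q4.2.2.1] at k2 k3
  rw [q1.2.2.2, q2.2.2.2, q3.2.2.2, q4.2.2.2] at k3
  have u1 := hε i hi hi1
  have u2 := hε p hp hp1
  have u3 := hη j hj hj1
  have hr : (l r : ℤ) ≠ 0 := by have := h.pos r; omega
  generalize (l 0 : ℤ) = a at *
  generalize (l t : ℤ) = c at *
  generalize (l r : ℤ) = d at *
  generalize (b 0 i : ℤ) = bi at *
  generalize (b 0 p : ℤ) = bp at *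
  generalize (b t j : ℤ) = bj at *
  have k4 : d * ((2 * i - a) * (2 * j - c) + (2 * bp - a) * (2 * bj - c)
      - (2 * bi - a) * (2 * bj - c) - (2 * p - a) * (2 * j - c)) = 0 := by
    have : 12 * (d * ((2 * i - a) * (2 * j - c) + (2 * bp - a) * (2 * bj - c)
      - (2 * bi - a) * (2 * bj - c) - (2 * p - a) * (2 * j - c))) = 0 := by
      linear_combination 3 * (a + c + d) * k2 - k3
    linarith
  have k5 := (mul_eq_zero.1 k4).resolve_left hr
  rw [u1, u2, u3] at k5
  rw [u3]
  have hU : 2 * ((i : ℤ) - p) ≠ 0 := by omega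
  have k6 : 2 * ((i : ℤ) - p) * ((2 * j - c) * (1 - ε * η)) = 0 := by linear_combination k5
  have k7 := (mul_eq_zero.1 k6).resolve_left hU
  rcases mul_eq_zero.1 k7 with k8 | k8
  · rw [k8]; ring
  · have : η = ε := by
      rcases he with rfl | rfl <;> rcases hn with rfl | rfl <;> omega
    rw [this]

/-- Values seen from the middle of an arc of length two. -/
theorem IsTheta.mid (h : IsTheta G K P Q l z) (h' : IsTheta G' K' P' Q' l z') {s t : Fin 3}
    (hst : s ≠ t) (hl : l s = 2) {j j' : ℕ} (hj : 0 < j) (hj1 : j < l t)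
    (hjj : j' = j ∨ j' = l t - j) :
    gf G K (z s 1) (z t j) = gf G' K' (z' s 1) (z' t j') := by
  obtain ⟨r, hsr, htr⟩ := third hst
  rcases hjj with rfl | rfl
  · rw [h.gf_diff hst hsr htr one_pos (by omega) hj hj1,
      h'.gf_diff hst hsr htr one_pos (by omega) hj hj1]
  · rw [h.gf_diff hst hsr htr one_pos (by omega) hj hj1,
      h'.gf_diff hst hsr htr one_pos (by omega) (by omega) (by omega), hl]
    have e1 : 1 + l r + l t - (l t - j) = 1 + l r + j := by omega
    have e2 : 2 + l t - 1 - (l t - j) = 1 + j := by omega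
    have e3 : 2 - 1 + l r + (l t - j) = 1 + l r + l t - j := by omega
    have e4 : 2 + l t - 1 - j = 1 + (l t - j) := by omega
    rw [e1, e2, e3, e4]
    ring

/-- Two arcs away from the root, when the root arc has length two. -/
theorem TStar.sign_short (T : TStar G K G' K' l z z' b p) (h : IsTheta G K P Q l z)
    (h' : IsTheta G' K' P' Q' l z') (hl : l 0 = 2) {s t : Fin 3} (h0s : 0 ≠ s) (h0t : 0 ≠ t)
    (hst : s ≠ t) {i j : ℕ} (hi : 0 < i)
    (hi1 : i < l s) (hj : 0 < j) (hj1 : j < l t) :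
    (2 * (i : ℤ) - l s) * (2 * j - l t) = (2 * (b s i : ℤ) - l s) * (2 * b t j - l t) := by
  have hp := T.p0
  have hp1 := T.p1
  have hb0 := T.b0
  have hb1 := T.b1
  have st := T.star s i t j hi hi1 hj hj1 (by simp [hst]) (by simp [h0s.symm]) (by simp [h0t.symm])
  have hp2 : p = 1 := by omega
  have hbp : b 0 p = 1 := by have := hb0 0 p hp hp1; have := hb1 0 p hp hp1; omega
  have alt : ∀ t i, 0 < i → i < l t → b t i = i ∨ b t i = l t - i := by
    intro t i h1 h2
    obtain ⟨ε, he, hε⟩ := T.signs h h' t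
    have := hε i h1 h2
    rcases he with rfl | rfl <;> omega
  rw [hbp, hp2] at st
  rw [← h.mid h' h0s hl hi hi1 (alt s i hi hi1), ← h.mid h' h0t hl hj hj1 (alt t j hj hj1)] at st
  have n1 := gf_diff_ne h one_pos (by omega : 1 < l 0) hi hi1 h0s
  have n2 := gf_diff_ne h one_pos (by omega : 1 < l 0) hj hj1 h0t
  have st2 := mul_right_cancel₀ n1 (mul_right_cancel₀ n2 st)
  have q1 := h.diff_moms hst h0s.symm h0t.symm hi hi1 hj hj1
  have q2 := h'.diff_moms hst h0s.symm h0t.symm (hb0 s i hi hi1) (hb1 s i hi hi1) (hb0 t j hj hj1)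
    (hb1 t j hj hj1)
  have k2 := congrArg m2 st2
  have k3 := congrArg m3 st2
  rw [q1.2.2.1, q2.2.2.1] at k2
  rw [q1.2.2.2, q2.2.2.2] at k3
  rw [hl] at k2 k3
  have : 12 * ((2 * (i : ℤ) - l s) * (2 * j - l t)) =
      12 * ((2 * (b s i : ℤ) - l s) * (2 * b t j - l t)) := by
    push_cast at k2 k3
    linear_combination 3 * (l s + l t + 2) * k2 - 2 * k3
  linarith

/-- A common orientation of the three arcs. -/
theorem TStar.orient (T : TStar G K G' K' l z z' b p) (h : IsTheta G K P Q l z)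
    (h' : IsTheta G' K' P' Q' l z') :
    ∃ ε : ℤ, (ε = 1 ∨ ε = -1) ∧
      ∀ s i, 0 < i → i < l s → 2 * (b s i : ℤ) - l s = ε * (2 * i - l s) := by
  obtain ⟨ε0, he0, hε0⟩ := T.signs h h' 0
  obtain ⟨ε1, he1, hε1⟩ := T.signs h h' 1
  obtain ⟨ε2, he2, hε2⟩ := T.signs h h' 2
  have hp := T.p0
  have hp1 := T.p1
  by_cases hl : l 0 = 2
  · have z0 : ∀ ε : ℤ, ∀ i, 0 < i → i < l 0 → 2 * (b 0 i : ℤ) - l 0 = ε * (2 * i - l 0) := by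
      intro ε i h1 h2
      have := hε0 i h1 h2
      have e : 2 * (i : ℤ) - l 0 = 0 := by omega
      rw [e] at this ⊢
      rw [this]; ring
    by_cases hee : ε1 = ε2
    · subst hee
      refine ⟨ε1, he1, fun s => ?_⟩
      fin_cases s
      exacts [z0 _, hε1, hε2]
    · by_cases hV : ∀ j, 0 < j → j < l 2 → 2 * (j : ℤ) - l 2 = 0
      · refine ⟨ε1, he1, fun s => ?_⟩
        fin_cases s
        · exact z0 _
        · exact hε1
        · intro i h1 h2
          have := hε2 i h1 h2
          have e := hV i h1 h2
          simp only [Fin.reduceFinMk] at *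
          rw [e] at this ⊢
          rw [this]; ring
      · push Not at hV
        obtain ⟨j, hj, hj1, hVj⟩ := hV
        refine ⟨ε2, he2, fun s => ?_⟩
        fin_cases s
        · exact z0 _
        · intro i h1 h2
          have k := T.sign_short h h' hl (s := 1) (t := 2) (by decide) (by decide) (by decide)
            h1 h2 hj hj1
          have a1 := hε1 i h1 h2
          have a2 := hε2 j hj hj1
          simp only [Fin.reduceFinMk, Fin.mk_one] at *
          rw [a1, a2] at k
          have k6 : (2 * (j : ℤ) - l 2) * ((2 * (i : ℤ) - l 1) * (1 - ε1 * ε2)) = 0 := by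
            linear_combination k
          have k7 := (mul_eq_zero.1 k6).resolve_left hVj
          rcases mul_eq_zero.1 k7 with k8 | k8
          · rw [k8] at a1 ⊢; rw [a1]; ring
          · exfalso
            rcases he1 with rfl | rfl <;> rcases he2 with rfl | rfl <;> omega
        · exact hε2
  · obtain ⟨i, hi, hi1, hip⟩ : ∃ i, 0 < i ∧ i < l 0 ∧ i ≠ p := by
      by_cases hp2 : p = 1
      · exact ⟨2, by omega, by omega, by omega⟩
      · exact ⟨1, by omega, by omega, by omega⟩
    refine ⟨ε0, he0, fun s j hj hj1 => ?_⟩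
    by_cases hs : s = 0
    · subst hs; exact hε0 j hj hj1
    · obtain ⟨η, hn, hη⟩ := T.signs h h' s
      exact T.sign_long h h' (Ne.symm hs) hi hi1 hip hj hj1 he0 hn hε0 hη

theorem TStar.coreMap (T : TStar G K G' K' l z z' b p) (h : IsTheta G K P Q l z)
    (h' : IsTheta G' K' P' Q' l z') :
    ∃ φ, CoreMap G G' K K' φ ∧ ∀ s i, 0 < i → i < l s → φ (z s i) = z' s (b s i) := by
  obtain ⟨ε, he, hε⟩ := T.orient h h'
  rcases he with rfl | rfl
  · obtain ⟨φ, h1, h2⟩ := theta_coreMap h h'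
    refine ⟨φ, h1, fun s i hi hi1 => ?_⟩
    rw [h2 s i hi1.le]
    congr 1
    have := hε s i hi hi1
    omega
  · obtain ⟨φ, h1, h2⟩ := theta_coreMap h h'.rev
    refine ⟨φ, h1, fun s i hi hi1 => ?_⟩
    rw [h2 s i hi1.le]
    congr 1
    have := hε s i hi hi1
    omega

theorem third_unique : ∀ s s' r r' : Fin 3, s ≠ 0 → s' ≠ 0 → r ≠ 0 → r ≠ s → r' ≠ 0 → r' ≠ s' →
    Equiv.swap s s' r = r' := by decide

theorem inj_interval_le {n m : ℕ} {b : ℕ → ℕ} (hm : 1 ≤ m)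
    (hb : ∀ i, 0 < i → i < n → 0 < b i ∧ b i < m)
    (hi : ∀ i j, 0 < i → i < n → 0 < j → j < n → i ≠ j → b i ≠ b j) : n ≤ m := by
  have := Finset.card_le_card_of_injOn (s := Finset.Ioo 0 n) (t := Finset.Ioo 0 m) b
    (by intro i h; simpa using hb i (by simpa using (Finset.mem_Ioo.1 h).1) (Finset.mem_Ioo.1 h).2)
    (by
      intro i h j h2 e
      have h := Finset.mem_Ioo.1 (Finset.mem_coe.1 h)
      have h2 := Finset.mem_Ioo.1 (Finset.mem_coe.1 h2)
      by_contra hne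
      exact hi i j h.1 h.2 h2.1 h2.2 hne e)
  simp only [Nat.card_Ioo] at this
  omega

/-- Arc matching. -/
theorem theta_arcs {l' : Fin 3 → ℕ} (h : IsTheta G K P Q l z) (h' : IsTheta G' K' P' Q' l' z')
    {p p' : ℕ} (hp : 0 < p) (hp1 : p < l 0) (hp' : 0 < p') (hp1' : p' < l' 0) {β : V → V'}
    (hβ : ∀ u ∈ K, dK G K u = 2 → β u ∈ K' ∧ dK G' K' (β u) = 2)
    (hβw : β (z 0 p) = z' 0 p')
    (hinj : ∀ u ∈ K, dK G K u = 2 → ∀ t ∈ K, dK G K t = 2 → u ≠ t → β u ≠ β t)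
    (hval : ∀ u ∈ K, dK G K u = 2 → ∀ t ∈ K, dK G K t = 2 → u ≠ t →
      (gf G K u t).eval 1 = (gf G' K' (β u) (β t)).eval 1) :
    ∃ e : Equiv.Perm (Fin 3), e 0 = 0 ∧ ∀ s i, 0 < i → i < l s →
      ∃ j, 0 < j ∧ j < l' (e s) ∧ β (z s i) = z' (e s) j := by
  have key : ∀ s i t j s' i' t' j', 0 < i → i < l s → 0 < j → j < l t → 0 < i' → i' < l' s' →
      0 < j' → j' < l' t' → β (z s i) = z' s' i' → β (z t j) = z' t' j' → (s = t ↔ s' = t') := by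
    intro s i t j s' i' t' j' h1 h2 h3 h4 h5 h6 h7 h8 e1 e2
    by_cases hne : z s i = z t j
    · have a1 := (h.inj _ _ _ _ h1 h2 h3 h4 hne).1
      rw [hne, e2] at e1
      have a2 := (h'.inj _ _ _ _ h7 h8 h5 h6 e1).1
      exact ⟨fun _ => a2.symm, fun _ => a1⟩
    · have v := hval _ (h.mem _ _ h1 h2) (h.dKint h1 h2) _ (h.mem _ _ h3 h4) (h.dKint h3 h4) hne
      have ne' := hinj _ (h.mem _ _ h1 h2) (h.dKint h1 h2) _ (h.mem _ _ h3 h4) (h.dKint h3 h4) hne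
      rw [e1, e2] at v ne'
      rw [h.val h1 h2 h3 h4 hne, h'.val h5 h6 h7 h8 ne'] at v
      by_cases a : s = t <;> by_cases a' : s' = t' <;> simp [a, a'] at v ⊢
  have im : ∀ s i, 0 < i → i < l s → ∃ s' i', 0 < i' ∧ i' < l' s' ∧ β (z s i) = z' s' i' := by
    intro s i h1 h2
    have := hβ _ (h.mem _ _ h1 h2) (h.dKint h1 h2)
    exact h'.idx this.1 this.2
  obtain ⟨s, i, h0s, hi, hi1⟩ := h.offroot 0
  obtain ⟨s', i', hi', hi1', e⟩ := im s i hi hi1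
  have h0s' : (0 : Fin 3) ≠ s' := by
    intro hh
    exact h0s ((key 0 p s i 0 p' s' i' hp hp1 hi hi1 hp' hp1' hi' hi1' hβw e).2 hh)
  refine ⟨Equiv.swap s s', Equiv.swap_apply_of_ne_of_ne h0s h0s', fun r j hj hj1 => ?_⟩
  obtain ⟨r', j', hj', hj1', e2⟩ := im r j hj hj1
  have hr : Equiv.swap s s' r = r' := by
    by_cases hr0 : r = 0
    · subst hr0
      rw [Equiv.swap_apply_of_ne_of_ne h0s h0s']
      exact (key 0 p 0 j 0 p' r' j' hp hp1 hj hj1 hp' hp1' hj' hj1' hβw e2).1 rfl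
    by_cases hrs : r = s
    · subst hrs
      rw [Equiv.swap_apply_left]
      exact (key r i r j s' i' r' j' hi hi1 hj hj1 hi' hi1' hj' hj1' e e2).1 rfl
    apply third_unique s s' r r' h0s.symm h0s'.symm hr0 hrs
    · intro hh
      exact hr0 ((key 0 p r j 0 p' r' j' hp hp1 hj hj1 hp' hp1' hj' hj1' hβw e2).2 hh.symm).symm
    · intro hh
      exact hrs ((key s i r j s' i' r' j' hi hi1 hj hj1 hi' hi1' hj' hj1' e e2).2 hh.symm).symm
  exact ⟨j', hj', by rw [hr]; exact hj1', by rw [hr]; exact e2⟩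

theorem theta_rigid {l' : Fin 3 → ℕ} (h : IsTheta G K P Q l z) (h' : IsTheta G' K' P' Q' l' z')
    {p p' : ℕ} (hp : 0 < p) (hp1 : p < l 0) (hp' : 0 < p') (hp1' : p' < l' 0) {β : V → V'}
    (hβ : ∀ u ∈ K, dK G K u = 2 → β u ∈ K' ∧ dK G' K' (β u) = 2)
    (hβw : β (z 0 p) = z' 0 p')
    (hinj : ∀ u ∈ K, dK G K u = 2 → ∀ t ∈ K, dK G K t = 2 → u ≠ t → β u ≠ β t)
    (hsurj : ∀ u ∈ K', dK G' K' u = 2 → ∃ t ∈ K, dK G K t = 2 ∧ β t = u)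
    (hval : ∀ u ∈ K, dK G K u = 2 → ∀ t ∈ K, dK G K t = 2 → u ≠ t →
      (gf G K u t).eval 1 = (gf G' K' (β u) (β t)).eval 1)
    (hstar : ∀ u ∈ K, dK G K u = 2 → u ≠ z 0 p → ∀ t ∈ K, dK G K t = 2 → t ≠ z 0 p → u ≠ t →
      gf G K u t * gf G' K' (z' 0 p') (β u) * gf G' K' (z' 0 p') (β t) =
      gf G' K' (β u) (β t) * gf G K (z 0 p) u * gf G K (z 0 p) t) :
    ∃ φ, CoreMap G G' K K' φ ∧ ∀ u ∈ K, dK G K u = 2 → φ u = β u := by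
  obtain ⟨e, he0, he⟩ := theta_arcs h h' hp hp1 hp' hp1' hβ hβw hinj hval
  have h'' := h'.perm e
  have hb : ∀ s i, ∃ j, 0 < i → i < l s → 0 < j ∧ j < l' (e s) ∧ β (z s i) = z' (e s) j := by
    intro s i
    by_cases hh : 0 < i ∧ i < l s
    · obtain ⟨j, hj⟩ := he s i hh.1 hh.2
      exact ⟨j, fun _ _ => hj⟩
    · exact ⟨0, fun a1 a2 => absurd ⟨a1, a2⟩ hh⟩
  choose b hb using hb
  have binj : ∀ s i j, 0 < i → i < l s → 0 < j → j < l s → i ≠ j → b s i ≠ b s j := by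
    intro s i j h1 h2 h3 h4 hne hh
    have := hinj _ (h.mem _ _ h1 h2) (h.dKint h1 h2) _ (h.mem _ _ h3 h4) (h.dKint h3 h4)
      (h.ne' h1 h2 h3 h4 hne)
    rw [(hb s i h1 h2).2.2, (hb s j h3 h4).2.2, hh] at this
    exact this rfl
  have hl : l = fun s => l' (e s) := by
    funext s
    apply le_antisymm
    · exact inj_interval_le (h''.pos s) (fun i h1 h2 => ⟨(hb s i h1 h2).1, (hb s i h1 h2).2.1⟩)
        (binj s)
    · have hc : ∀ j, ∃ i, 0 < j → j < l' (e s) → 0 < i ∧ i < l s ∧ b s i = j := by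
        intro j
        by_cases hh : 0 < j ∧ j < l' (e s)
        · obtain ⟨t, htK, htd, ht⟩ := hsurj _ (h''.mem s j hh.1 hh.2) (h''.dKint hh.1 hh.2)
          obtain ⟨r, i, hi, hi1, rfl⟩ := h.idx htK htd
          have q := hb r i hi hi1
          rw [q.2.2] at ht
          obtain ⟨a1, a2⟩ := h''.inj r _ s _ q.1 q.2.1 hh.1 hh.2 ht
          subst a1
          exact ⟨i, fun _ _ => ⟨hi, hi1, a2⟩⟩
        · exact ⟨0, fun a1 a2 => absurd ⟨a1, a2⟩ hh⟩
      choose c hc using hc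
      refine inj_interval_le (b := c) (h.pos s)
        (fun i h1 h2 => ⟨(hc i h1 h2).1, (hc i h1 h2).2.1⟩) ?_
      intro i j h1 h2 h3 h4 hne hh
      apply hne
      rw [← (hc i h1 h2).2.2, ← (hc j h3 h4).2.2, hh]
  have hbl : ∀ s i, 0 < i → i < l s → 0 < b s i ∧ b s i < l s ∧ β (z s i) = z' (e s) (b s i) := by
    intro s i h1 h2
    have := hb s i h1 h2
    refine ⟨this.1, ?_, this.2.2⟩
    rw [hl]; exact this.2.1
  have hbp : z' 0 p' = z' (e 0) (b 0 p) := by rw [← hβw, (hbl 0 p hp hp1).2.2]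
  rw [← hl] at h''
  have T : TStar G K G' K' l z (fun s => z' (e s)) b p := by
    refine ⟨hp, hp1, fun s i h1 h2 => (hbl s i h1 h2).1, fun s i h1 h2 => (hbl s i h1 h2).2.1,
      binj, ?_⟩
    intro s i t j h1 h2 h3 h4 n1 n2 n3
    have zne : ∀ s i t j, 0 < i → i < l s → 0 < j → j < l t → (s, i) ≠ (t, j) → z s i ≠ z t j := by
      intro s i t j h1 h2 h3 h4 hne hh
      obtain ⟨a1, a2⟩ := h.inj _ _ _ _ h1 h2 h3 h4 hh
      exact hne (by rw [a1, a2])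
    have := hstar _ (h.mem _ _ h1 h2) (h.dKint h1 h2) (zne _ _ _ _ h1 h2 hp hp1 n2)
      _ (h.mem _ _ h3 h4) (h.dKint h3 h4) (zne _ _ _ _ h3 h4 hp hp1 n3) (zne _ _ _ _ h1 h2 h3 h4 n1)
    rw [(hbl s i h1 h2).2.2, (hbl t j h3 h4).2.2, hbp] at this
    exact this
  obtain ⟨φ, hφ, hz⟩ := T.coreMap h h''
  refine ⟨φ, hφ, fun u hu hd => ?_⟩
  obtain ⟨s, i, hi, hi1, rfl⟩ := h.idx hu hd
  rw [hz s i hi hi1, (hbl s i hi hi1).2.2]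

end ThetaRigid
end L2R

namespace L2R
set_option linter.unusedSectionVars false
open Polynomial
open scoped Classical

section Main
variable {V : Type} [Fintype V] {G : SimpleGraph V} {Λ : Type} {leaf : Λ → V}
  {V' : Type} [Fintype V'] {G' : SimpleGraph V'} {leaf' : Λ → V'}
  {S₀ : Finset V} {w v : V} {ι : Type} {S : ι → Finset V} {d c : ι → V}
  {S₀' : Finset V'} {w' v' : V'} {ι' : Type} {S' : ι' → Finset V'} {d' c' : ι' → V'}

/-- The data attached to two rooted sides agree. -/
structure SameData (G : SimpleGraph V) (leaf : Λ → V) (S₀ : Finset V) (w : V)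
    (G' : SimpleGraph V') (leaf' : Λ → V') (S₀' : Finset V') (w' : V') : Prop where
  Y : ∀ x, leaf x ∈ S₀ ↔ leaf' x ∈ S₀'
  h : ∀ x, leaf x ∈ S₀ → gf G S₀ w (leaf x) = gf G' S₀' w' (leaf' x)
  P : ∀ x y, gf G Finset.univ (leaf x) (leaf y) = gf G' Finset.univ (leaf' x) (leaf' y)

theorem SameData.symm (D : SameData G leaf S₀ w G' leaf' S₀' w') :
    SameData G' leaf' S₀' w' G leaf S₀ w :=
  ⟨fun x => (D.Y x).symm, fun x hx => (D.h x ((D.Y x).2 hx)).symm, fun x y => (D.P x y).symm⟩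

theorem Slots.ex (hs : Slots G leaf S₀ w ι S d c) (hN : Net G leaf) (σ : ι) :
    ∃ x, leaf x ∈ S σ ∧ ¬ (3 : ℤ) ∣ (gf G (S σ) (d σ) (leaf x)).eval 1 :=
  (good hN (hs.part σ).side).ex

theorem Slots.g_ne (hs : Slots G leaf S₀ w ι S d c) (hN : Net G leaf) {σ : ι} {x : Λ}
    (hx : leaf x ∈ S σ) : gf G (S σ) (d σ) (leaf x) ≠ 0 := by
  intro e
  have := (good hN (hs.part σ).side).one x hx
  rw [e] at this
  simp at this

theorem Slots.f_ne (hs : Slots G leaf S₀ w ι S d c) (hN : Net G leaf) (h₀ : IsSide G S₀ w v)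
    (σ : ι) : gf G (cls G w) w (c σ) ≠ 0 := by
  intro e
  obtain ⟨x, hx, -⟩ := hs.ex hN σ
  have := (good hN h₀).one x ((hs.part σ).sub hx)
  rw [hs.h_eq h₀ hx, e] at this
  simp at this

theorem finish (hN : Net G leaf) (h₀ : IsSide G S₀ w v) (h₀' : IsSide G' S₀' w' v')
    (hs : Slots G leaf S₀ w ι S d c) (hs' : Slots G' leaf' S₀' w' ι' S' d' c')
    (D : SameData G leaf S₀ w G' leaf' S₀' w')
    (ih : ∀ S d c S' d' c', S.card < S₀.card → IsSide G S d c → IsSide G' S' d' c' →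
      SameData G leaf S d G' leaf' S' d' → SIso G leaf G' leaf' S S' d d')
    (β : ι ≃ ι') (hβ : ∀ x σ, leaf x ∈ S σ ↔ leaf' x ∈ S' (β σ)) {φ₀ : V → V'}
    (hφ : CoreMap G G' (cls G w) (cls G' w') φ₀) (hw : φ₀ w = w')
    (hc : ∀ σ, φ₀ (c σ) = c' (β σ)) :
    SIso G leaf G' leaf' S₀ S₀' w w' := by
  refine glue hs hs' h₀ h₀' β hφ hw hc fun σ => ?_
  refine ih _ _ _ _ _ _ ((hs.part σ).card_lt h₀) (hs.part σ).side (hs'.part (β σ)).side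
    ⟨fun x => hβ x σ, fun x hx => ?_, D.P⟩
  have e1 := gf_iso hφ.bij hφ.adj (self_mem_cls w) (hs.part σ).cK
  rw [hw, hc] at e1
  have e2 := D.h x ((hs.part σ).sub hx)
  rw [hs.h_eq h₀ hx, hs'.h_eq h₀' ((hβ x σ).1 hx), ← e1] at e2
  exact mul_left_cancel₀ (mul_ne_zero (hs.f_ne hN h₀ σ) X_ne_zero) e2

theorem star (hN : Net G leaf) (hN' : Net G' leaf') (h₀ : IsSide G S₀ w v)
    (h₀' : IsSide G' S₀' w' v')
    (hs : Slots G leaf S₀ w ι S d c) (hs' : Slots G' leaf' S₀' w' ι' S' d' c')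
    (D : SameData G leaf S₀ w G' leaf' S₀' w')
    (β : ι ≃ ι') (hβ : ∀ x σ, leaf x ∈ S σ ↔ leaf' x ∈ S' (β σ)) {σ τ : ι} (hst : σ ≠ τ) :
    gf G (cls G w) (c σ) (c τ) * gf G' (cls G' w') w' (c' (β σ)) *
      gf G' (cls G' w') w' (c' (β τ)) =
    gf G' (cls G' w') (c' (β σ)) (c' (β τ)) * gf G (cls G w) w (c σ) * gf G (cls G w) w (c τ) := by
  obtain ⟨x, hx, -⟩ := hs.ex hN σ
  obtain ⟨y, hy, -⟩ := hs.ex hN τ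
  have hx' := (hβ x σ).1 hx
  have hy' := (hβ y τ).1 hy
  have e1 := hs.P_eq hst hx hy
  have e2 := hs'.P_eq (fun e => hst (β.injective e)) hx' hy'
  have e3 := D.h x ((hs.part σ).sub hx)
  have e4 := D.h y ((hs.part τ).sub hy)
  rw [D.P, e2] at e1
  rw [hs.h_eq h₀ hx, hs'.h_eq h₀' hx'] at e3
  rw [hs.h_eq h₀ hy, hs'.h_eq h₀' hy'] at e4
  have n1 := hs.g_ne hN hx
  have n2 := hs.g_ne hN hy
  have n3 := hs'.g_ne hN' hx'
  have n4 := hs'.g_ne hN' hy'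
  have nX : (X : ℤ[X]) ≠ 0 := X_ne_zero
  generalize gf G (S σ) (d σ) (leaf x) = a at *
  generalize gf G (S τ) (d τ) (leaf y) = b at *
  generalize gf G' (S' (β σ)) (d' (β σ)) (leaf' x) = a' at *
  generalize gf G' (S' (β τ)) (d' (β τ)) (leaf' y) = b' at *
  generalize gf G (cls G w) (c σ) (c τ) = F at *
  generalize gf G' (cls G' w') (c' (β σ)) (c' (β τ)) = F' at *
  generalize gf G (cls G w) w (c σ) = f1 at *
  generalize gf G (cls G w) w (c τ) = f2 at *
  generalize gf G' (cls G' w') w' (c' (β σ)) = f1' at *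
  generalize gf G' (cls G' w') w' (c' (β τ)) = f2' at *
  have nn : X * X * (a * b * (a' * b')) * (X * X) ≠ 0 :=
    mul_ne_zero (mul_ne_zero (mul_ne_zero nX nX) (mul_ne_zero (mul_ne_zero n1 n2)
      (mul_ne_zero n3 n4))) (mul_ne_zero nX nX)
  apply mul_right_cancel₀ nn
  calc F * f1' * f2' * (X * X * (a * b * (a' * b')) * (X * X))
      = (F * (X * a) * (X * b)) * (f1' * X * a') * (f2' * X * b') := by ring
    _ = (F' * (X * a') * (X * b')) * (f1 * X * a) * (f2 * X * b) := by rw [← e1, ← e3, ← e4]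
    _ = _ := by ring

theorem exists_match (hN : Net G leaf) (hN' : Net G' leaf')
    (hs : Slots G leaf S₀ w ι S d c) (hs' : Slots G' leaf' S₀' w' ι' S' d' c')
    (D : SameData G leaf S₀ w G' leaf' S₀' w') (R R' : Λ → Λ → Prop)
    (hR : ∀ x y, leaf x ∈ S₀ → leaf y ∈ S₀ → (R x y ↔ R' x y))
    (h1 : ∀ x y σ τ, x ≠ y → leaf x ∈ S σ → leaf y ∈ S τ → (R x y ↔ σ ≠ τ))
    (h2 : ∀ x y σ τ, x ≠ y → leaf' x ∈ S' σ → leaf' y ∈ S' τ → (R' x y ↔ σ ≠ τ)) :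
    ∃ β : ι ≃ ι', ∀ x σ, leaf x ∈ S σ ↔ leaf' x ∈ S' (β σ) := by
  refine match_slots hs hs' D.Y (fun σ => (hs.ex hN σ).imp fun _ h => h.1)
    (fun σ => (hs'.ex hN' σ).imp fun _ h => h.1) ?_
  intro x y σ τ σ' τ' hx hy hx' hy'
  by_cases hxy : x = y
  · subst hxy
    exact ⟨fun _ => hs'.uniq hx' hy', fun _ => hs.uniq hx hy⟩
  · have a1 := h1 x y σ τ hxy hx hy
    have a2 := h2 x y σ' τ' hxy hx' hy'
    rw [hR x y ((hs.part σ).sub hx) ((hs.part τ).sub hy), a2] at a1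
    exact (not_iff_not.1 a1).symm

/-- Abbreviations for the values at one. -/
noncomputable def hv (G : SimpleGraph V) (leaf : Λ → V) (S₀ : Finset V) (w : V) (x : Λ) : ℤ :=
  (gf G S₀ w (leaf x)).eval 1

noncomputable def Pv (G : SimpleGraph V) (leaf : Λ → V) (x y : Λ) : ℤ :=
  (gf G Finset.univ (leaf x) (leaf y)).eval 1

/-- The four kinds of rooted sides. -/
def KLeaf (leaf : Λ → V) (S₀ : Finset V) (w : V) : Prop := ∃ x, w = leaf x ∧ S₀ = {w}

def KNode (G : SimpleGraph V) (leaf : Λ → V) (S₀ : Finset V) (w : V) : Prop :=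
  cls G w = {w} ∧ ∃ S d, Slots G leaf S₀ w Bool S d (fun _ => w)

def KCyc (G : SimpleGraph V) (leaf : Λ → V) (S₀ : Finset V) (w : V) : Prop :=
  (∃ S d, Slots G leaf S₀ w {c // c ∈ slotSet G w} S d (fun σ => σ.1)) ∧
  ∃ n z, IsCyc G (cls G w) n z ∧ z 0 = w

def KTheta (G : SimpleGraph V) (leaf : Λ → V) (S₀ : Finset V) (w : V) : Prop :=
  (∃ S d, Slots G leaf S₀ w {c // c ∈ slotSet G w} S d (fun σ => σ.1)) ∧
  ∃ P Q l z p, IsTheta G (cls G w) P Q l z ∧ 0 < p ∧ p < l 0 ∧ z 0 p = w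

theorem kinds (hN : Net G leaf) (h₀ : IsSide G S₀ w v) : KLeaf leaf S₀ w ∨ KNode G leaf S₀ w ∨
    KCyc G leaf S₀ w ∨ KTheta G leaf S₀ w := by
  rcases classify hN h₀ with h | h | ⟨h, h1 | h1⟩
  · exact Or.inl h
  · exact Or.inr (Or.inl h)
  · exact Or.inr (Or.inr (Or.inl ⟨h, h1⟩))
  · exact Or.inr (Or.inr (Or.inr ⟨h, h1⟩))

theorem leaf_single (hN : Net G leaf) (h : KLeaf leaf S₀ w) {x y : Λ} (hx : leaf x ∈ S₀)
    (hy : leaf y ∈ S₀) : x = y := by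
  obtain ⟨z, rfl, rfl⟩ := h
  apply hN.inj
  rw [Finset.mem_singleton] at hx hy
  rw [hx, hy]

theorem leaf_one (h : KLeaf leaf S₀ w) : ∃ x, leaf x ∈ S₀ ∧ hv G leaf S₀ w x = 1 := by
  obtain ⟨z, rfl, rfl⟩ := h
  exact ⟨z, by simp, by rw [hv, gf_self G (by simp)]; simp⟩

/-- Node values. -/
theorem node_iff (hN : Net G leaf) (h₀ : IsSide G S₀ w v) {S : Bool → Finset V} {d : Bool → V}
    (hs : Slots G leaf S₀ w Bool S d (fun _ => w)) (x y : Λ) (σ τ : Bool) (hxy : x ≠ y)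
    (hx : leaf x ∈ S σ) (hy : leaf y ∈ S τ) :
    gf G Finset.univ (leaf x) (leaf y) = gf G S₀ w (leaf x) * gf G S₀ w (leaf y) ↔ σ ≠ τ := by
  rw [hs.h_eq h₀ hx, hs.h_eq h₀ hy]
  simp only [node_vals, one_mul]
  constructor
  · rintro e rfl
    have g := good hN (hs.part σ).side
    obtain ⟨k, hk⟩ := g.eq x y hx hy hxy (by rw [e]; simp)
    rw [e] at hk
    have n1 := hs.g_ne hN hx
    have n2 := hs.g_ne hN hy
    have : gf G (S σ) (d σ) (leaf x) * gf G (S σ) (d σ) (leaf y) * X ^ (k + 2) =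
      gf G (S σ) (d σ) (leaf x) * gf G (S σ) (d σ) (leaf y) * 1 := by
      rw [mul_one]
      nth_rewrite 2 [← hk]
      ring
    have := mul_left_cancel₀ (mul_ne_zero n1 n2) this
    have := congrArg m1 this
    rw [m1_pow] at this
    simp [m1, dd] at this
    omega
  · intro hst
    rw [hs.P_eq hst hx hy, node_vals, one_mul]

theorem node_pair (hN : Net G leaf) (h₀ : IsSide G S₀ w v) (h : KNode G leaf S₀ w) :
    ∃ x y, x ≠ y ∧ leaf x ∈ S₀ ∧ leaf y ∈ S₀ ∧ Pv G leaf x y = hv G leaf S₀ w x * hv G leaf S₀ w y := by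
  obtain ⟨-, S, d, hs⟩ := h
  obtain ⟨x, hx, -⟩ := hs.ex hN true
  obtain ⟨y, hy, -⟩ := hs.ex hN false
  have hxy : x ≠ y := by rintro rfl; exact absurd (hs.uniq hx hy) (by simp)
  refine ⟨x, y, hxy, (hs.part _).sub hx, (hs.part _).sub hy, ?_⟩
  have := (node_iff hN h₀ hs x y _ _ hxy hx hy).2 (by simp)
  rw [Pv, hv, hv, this, eval_mul]

theorem same_le (hN : Net G leaf) (hs : Slots G leaf S₀ w ι S d c) {x y : Λ} {σ : ι} (hxy : x ≠ y)
    (hx : leaf x ∈ S σ) (hy : leaf y ∈ S σ) : Pv G leaf x y ≤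
      (gf G (S σ) (d σ) (leaf x)).eval 1 * (gf G (S σ) (d σ) (leaf y)).eval 1 :=
  (good hN (hs.part σ).side).le x y hx hy hxy

theorem g_pos (hN : Net G leaf) (hs : Slots G leaf S₀ w ι S d c) {x : Λ} {σ : ι}
    (hx : leaf x ∈ S σ) : 1 ≤ (gf G (S σ) (d σ) (leaf x)).eval 1 :=
  (good hN (hs.part σ).side).one x hx

/-- Cycle values. -/
theorem cyc_same (hN : Net G leaf) (h₀ : IsSide G S₀ w v) (hV : CycV G w)
    {S : {c // c ∈ slotSet G w} → Finset V} {d : {c // c ∈ slotSet G w} → V}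
    (hs : Slots G leaf S₀ w {c // c ∈ slotSet G w} S d (fun σ => σ.1)) (x y : Λ)
    (σ : {c // c ∈ slotSet G w}) (hxy : x ≠ y) (hx : leaf x ∈ S σ) (hy : leaf y ∈ S σ) :
    4 * Pv G leaf x y ≤ hv G leaf S₀ w x * hv G leaf S₀ w y := by
  rw [hv, hv, hs.h_val h₀ hx, hs.h_val h₀ hy, hV.f _ σ.2]
  have := same_le hN hs hxy hx hy
  linarith

theorem cyc_diff (h₀ : IsSide G S₀ w v) (hV : CycV G w)
    {S : {c // c ∈ slotSet G w} → Finset V} {d : {c // c ∈ slotSet G w} → V}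
    (hs : Slots G leaf S₀ w {c // c ∈ slotSet G w} S d (fun σ => σ.1)) (x y : Λ)
    (σ τ : {c // c ∈ slotSet G w}) (hst : σ ≠ τ) (hx : leaf x ∈ S σ) (hy : leaf y ∈ S τ) :
    2 * Pv G leaf x y = hv G leaf S₀ w x * hv G leaf S₀ w y := by
  rw [hv, hv, hs.h_val h₀ hx, hs.h_val h₀ hy, hV.f _ σ.2, hV.f _ τ.2, Pv, hs.P_val hst hx hy,
    hV.F _ σ.2 _ τ.2 (fun e => hst (Subtype.ext e))]
  ring

theorem hv_pos (hN : Net G leaf) (h₀ : IsSide G S₀ w v) {x : Λ} (hx : leaf x ∈ S₀) :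
    1 ≤ hv G leaf S₀ w x := (good hN h₀).one x hx

theorem hv_mul_pos (hN : Net G leaf) (h₀ : IsSide G S₀ w v) {x y : Λ} (hx : leaf x ∈ S₀)
    (hy : leaf y ∈ S₀) : 1 ≤ hv G leaf S₀ w x * hv G leaf S₀ w y := by
  have := hv_pos hN h₀ hx
  have := hv_pos hN h₀ hy
  nlinarith

theorem cyc_all (hN : Net G leaf) (h₀ : IsSide G S₀ w v) (h : KCyc G leaf S₀ w) {x y : Λ}
    (hxy : x ≠ y) (hx : leaf x ∈ S₀) (hy : leaf y ∈ S₀) :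
    2 * Pv G leaf x y ≤ hv G leaf S₀ w x * hv G leaf S₀ w y := by
  obtain ⟨⟨S, d, hs⟩, n, z, hz, h0⟩ := h
  have hV := cycV hz h0
  have h1 := hv_mul_pos hN h₀ hx hy
  obtain ⟨σ, hσ⟩ := hs.slot hx
  obtain ⟨τ, hτ⟩ := hs.slot hy
  by_cases hst : σ = τ
  · subst hst
    have := cyc_same hN h₀ hV hs x y σ hxy hσ hτ
    omega
  · exact (cyc_diff h₀ hV hs x y σ τ hst hσ hτ).le

theorem cyc_pair (hN : Net G leaf) (h₀ : IsSide G S₀ w v) (h : KCyc G leaf S₀ w) :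
    ∃ x y, x ≠ y ∧ leaf x ∈ S₀ ∧ leaf y ∈ S₀ ∧
      2 * Pv G leaf x y = hv G leaf S₀ w x * hv G leaf S₀ w y := by
  obtain ⟨⟨S, d, hs⟩, n, z, hz, h0⟩ := h
  have hV := cycV hz h0
  obtain ⟨a, ha, b, hb, hab⟩ := hV.ex
  obtain ⟨x, hx, -⟩ := hs.ex hN ⟨a, ha⟩
  obtain ⟨y, hy, -⟩ := hs.ex hN ⟨b, hb⟩
  have hst : (⟨a, ha⟩ : {c // c ∈ slotSet G w}) ≠ ⟨b, hb⟩ := fun e => hab (congrArg Subtype.val e)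
  have hxy : x ≠ y := by rintro rfl; exact hst (hs.uniq hx hy)
  exact ⟨x, y, hxy, (hs.part _).sub hx, (hs.part _).sub hy, cyc_diff h₀ hV hs x y _ _ hst hx hy⟩

/-- Theta values. -/
theorem th_same (hN : Net G leaf) (h₀ : IsSide G S₀ w v) (hV : ThV G w)
    {S : {c // c ∈ slotSet G w} → Finset V} {d : {c // c ∈ slotSet G w} → V}
    (hs : Slots G leaf S₀ w {c // c ∈ slotSet G w} S d (fun σ => σ.1)) (x y : Λ)
    (σ : {c // c ∈ slotSet G w}) (hxy : x ≠ y) (hx : leaf x ∈ S σ) (hy : leaf y ∈ S σ) :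
    9 * Pv G leaf x y ≤ hv G leaf S₀ w x * hv G leaf S₀ w y := by
  rw [hv, hv, hs.h_val h₀ hx, hs.h_val h₀ hy]
  have h1 := same_le hN hs hxy hx hy
  have g1 := g_pos hN hs hx
  have g2 := g_pos hN hs hy
  have g3 := mul_pos (show (0:ℤ) < _ by linarith) (show (0:ℤ) < _ by linarith [g2])
  rcases hV.f _ σ.2 with e | e <;> rw [e] <;> nlinarith

theorem th_diff (hN : Net G leaf) (h₀ : IsSide G S₀ w v) (hV : ThV G w)
    {S : {c // c ∈ slotSet G w} → Finset V} {d : {c // c ∈ slotSet G w} → V}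
    (hs : Slots G leaf S₀ w {c // c ∈ slotSet G w} S d (fun σ => σ.1)) (x y : Λ)
    (σ τ : {c // c ∈ slotSet G w}) (hst : σ ≠ τ) (hx : leaf x ∈ S σ) (hy : leaf y ∈ S τ) :
    9 * Pv G leaf x y ≤ 4 * (hv G leaf S₀ w x * hv G leaf S₀ w y) ∧
    3 * (hv G leaf S₀ w x * hv G leaf S₀ w y) ≤ 16 * Pv G leaf x y := by
  rw [hv, hv, hs.h_val h₀ hx, hs.h_val h₀ hy, Pv, hs.P_val hst hx hy]
  have g1 := g_pos hN hs hx
  have g2 := g_pos hN hs hy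
  have g3 : 1 ≤ (gf G (S σ) (d σ) (leaf x)).eval 1 * (gf G (S τ) (d τ) (leaf y)).eval 1 := by
    nlinarith
  rcases hV.f _ σ.2 with e | e <;> rcases hV.f _ τ.2 with e' | e' <;>
    rcases hV.F _ σ.2 _ τ.2 (fun e => hst (Subtype.ext e)) with e'' | e'' <;>
    rw [e, e', e''] <;> constructor <;> nlinarith

theorem th_all (hN : Net G leaf) (h₀ : IsSide G S₀ w v) (h : KTheta G leaf S₀ w) {x y : Λ}
    (hxy : x ≠ y) (hx : leaf x ∈ S₀) (hy : leaf y ∈ S₀) :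
    9 * Pv G leaf x y ≤ 4 * (hv G leaf S₀ w x * hv G leaf S₀ w y) := by
  obtain ⟨⟨S, d, hs⟩, P, Q, l, z, p, hz, hp, hp1, h0⟩ := h
  have hV := thV hz hp hp1 h0
  have h1 := hv_mul_pos hN h₀ hx hy
  obtain ⟨σ, hσ⟩ := hs.slot hx
  obtain ⟨τ, hτ⟩ := hs.slot hy
  by_cases hst : σ = τ
  · subst hst
    have := th_same hN h₀ hV hs x y σ hxy hσ hτ
    omega
  · exact (th_diff hN h₀ hV hs x y σ τ hst hσ hτ).1

theorem th_three (hN : Net G leaf) (h₀ : IsSide G S₀ w v) (h : KTheta G leaf S₀ w) {x : Λ}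
    (hx : leaf x ∈ S₀) : 3 ≤ hv G leaf S₀ w x := by
  obtain ⟨⟨S, d, hs⟩, P, Q, l, z, p, hz, hp, hp1, h0⟩ := h
  have hV := thV hz hp hp1 h0
  obtain ⟨σ, hσ⟩ := hs.slot hx
  rw [hv, hs.h_val h₀ hσ]
  have g1 := g_pos hN hs hσ
  rcases hV.f _ σ.2 with e | e <;> rw [e] <;> linarith

end Main
end L2R

namespace L2R
set_option linter.unusedSectionVars false
open Polynomial
open scoped Classical

section Main2
variable {V : Type} [Fintype V] {G : SimpleGraph V} {Λ : Type} {leaf : Λ → V}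
  {V' : Type} [Fintype V'] {G' : SimpleGraph V'} {leaf' : Λ → V'}
  {S₀ : Finset V} {w v : V} {S₀' : Finset V'} {w' v' : V'}

theorem SameData.hv (D : SameData G leaf S₀ w G' leaf' S₀' w') {x : Λ} (hx : leaf x ∈ S₀) :
    hv G leaf S₀ w x = L2R.hv G' leaf' S₀' w' x := by
  rw [L2R.hv, L2R.hv, D.h x hx]

theorem SameData.Pv (D : SameData G leaf S₀ w G' leaf' S₀' w') (x y : Λ) :
    Pv G leaf x y = L2R.Pv G' leaf' x y := by
  rw [L2R.Pv, L2R.Pv, D.P x y]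

/-- The kinds of two sides with the same data cannot differ. -/
theorem no_leaf_node (hN : Net G leaf) (hN' : Net G' leaf')
    (h₀' : IsSide G' S₀' w' v')
    (D : SameData G leaf S₀ w G' leaf' S₀' w') (k : KLeaf leaf S₀ w)
    (k' : KNode G' leaf' S₀' w') : False := by
  obtain ⟨x, y, hxy, hx, hy, -⟩ := node_pair hN' h₀' k'
  exact hxy (leaf_single hN k ((D.Y x).2 hx) ((D.Y y).2 hy))

theorem no_leaf_cyc (hN : Net G leaf) (hN' : Net G' leaf')
    (h₀' : IsSide G' S₀' w' v')
    (D : SameData G leaf S₀ w G' leaf' S₀' w') (k : KLeaf leaf S₀ w)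
    (k' : KCyc G' leaf' S₀' w') : False := by
  obtain ⟨x, y, hxy, hx, hy, -⟩ := cyc_pair hN' h₀' k'
  exact hxy (leaf_single hN k ((D.Y x).2 hx) ((D.Y y).2 hy))

theorem no_leaf_theta (hN' : Net G' leaf')
    (h₀' : IsSide G' S₀' w' v')
    (D : SameData G leaf S₀ w G' leaf' S₀' w') (k : KLeaf leaf S₀ w)
    (k' : KTheta G' leaf' S₀' w') : False := by
  obtain ⟨x, hx, h1⟩ := leaf_one (G := G) k
  have := th_three hN' h₀' k' ((D.Y x).1 hx)
  rw [← D.hv hx] at this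
  omega

theorem no_node_cyc (hN : Net G leaf) (hN' : Net G' leaf')
    (h₀ : IsSide G S₀ w v) (h₀' : IsSide G' S₀' w' v')
    (D : SameData G leaf S₀ w G' leaf' S₀' w') (k : KNode G leaf S₀ w)
    (k' : KCyc G' leaf' S₀' w') : False := by
  obtain ⟨x, y, hxy, hx, hy, e⟩ := node_pair hN h₀ k
  have h1 := cyc_all hN' h₀' k' hxy ((D.Y x).1 hx) ((D.Y y).1 hy)
  rw [← D.hv hx, ← D.hv hy, ← D.Pv] at h1
  have h2 := hv_mul_pos hN h₀ hx hy
  linarith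

theorem no_node_theta (hN : Net G leaf) (hN' : Net G' leaf')
    (h₀ : IsSide G S₀ w v) (h₀' : IsSide G' S₀' w' v')
    (D : SameData G leaf S₀ w G' leaf' S₀' w') (k : KNode G leaf S₀ w)
    (k' : KTheta G' leaf' S₀' w') : False := by
  obtain ⟨x, y, hxy, hx, hy, e⟩ := node_pair hN h₀ k
  have h1 := th_all hN' h₀' k' hxy ((D.Y x).1 hx) ((D.Y y).1 hy)
  rw [← D.hv hx, ← D.hv hy, ← D.Pv] at h1
  have h2 := hv_mul_pos hN h₀ hx hy
  linarith

theorem no_cyc_theta (hN : Net G leaf) (hN' : Net G' leaf')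
    (h₀ : IsSide G S₀ w v) (h₀' : IsSide G' S₀' w' v')
    (D : SameData G leaf S₀ w G' leaf' S₀' w') (k : KCyc G leaf S₀ w)
    (k' : KTheta G' leaf' S₀' w') : False := by
  obtain ⟨x, y, hxy, hx, hy, e⟩ := cyc_pair hN h₀ k
  have h1 := th_all hN' h₀' k' hxy ((D.Y x).1 hx) ((D.Y y).1 hy)
  rw [← D.hv hx, ← D.hv hy, ← D.Pv] at h1
  have h2 := hv_mul_pos hN h₀ hx hy
  linarith

/-- Leaf case. -/
theorem leaf_case (hN' : Net G' leaf') (hN : Net G leaf)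
    (D : SameData G leaf S₀ w G' leaf' S₀' w') (k : KLeaf leaf S₀ w)
    (k' : KLeaf leaf' S₀' w') : SIso G leaf G' leaf' S₀ S₀' w w' := by
  obtain ⟨x, hw, hS⟩ := k
  have hx : leaf x ∈ S₀ := by simp [hS, hw]
  have hx' := (D.Y x).1 hx
  obtain ⟨x', hw', hS'⟩ := k'
  have e : leaf' x = w' := by simpa [hS'] using hx'
  refine ⟨fun _ => w', ⟨?_, ?_⟩, rfl, ?_⟩
  · rw [hS, hS']
    refine ⟨by intro; simp, ?_, ?_⟩
    · intro a ha b hb _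
      simp at ha hb
      rw [ha, hb]
    · intro a ha
      simp at ha
      exact ⟨w, by simp, ha.symm⟩
  · intro a ha b hb
    rw [hS, Finset.mem_singleton] at ha hb
    subst ha; subst hb
    simp
  · intro y hy
    have : y = x := by
      apply hN.inj
      rw [hS, Finset.mem_singleton] at hy
      rw [hy, hw]
    rw [this, e]

theorem node_case (hN : Net G leaf) (hN' : Net G' leaf')
    (h₀ : IsSide G S₀ w v) (h₀' : IsSide G' S₀' w' v')
    (D : SameData G leaf S₀ w G' leaf' S₀' w')
    (ih : ∀ S d c S' d' c', S.card < S₀.card → IsSide G S d c → IsSide G' S' d' c' →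
      SameData G leaf S d G' leaf' S' d' → SIso G leaf G' leaf' S S' d d')
    (k : KNode G leaf S₀ w) (k' : KNode G' leaf' S₀' w') :
    SIso G leaf G' leaf' S₀ S₀' w w' := by
  obtain ⟨hk, S, d, hs⟩ := k
  obtain ⟨hk', S', d', hs'⟩ := k'
  obtain ⟨β, hβ⟩ := exists_match hN hN' hs hs' D
    (fun x y => gf G Finset.univ (leaf x) (leaf y) = gf G S₀ w (leaf x) * gf G S₀ w (leaf y))
    (fun x y => gf G' Finset.univ (leaf' x) (leaf' y) =
      gf G' S₀' w' (leaf' x) * gf G' S₀' w' (leaf' y))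
    (fun x y hx hy => by rw [D.P, D.h x hx, D.h y hy])
    (node_iff hN h₀ hs) (node_iff hN' h₀' hs')
  refine finish hN h₀ h₀' hs hs' D ih β hβ (φ₀ := fun _ => w') ⟨?_, ?_⟩ rfl (fun _ => rfl)
  · rw [hk, hk']
    refine ⟨by intro; simp, ?_, ?_⟩
    · intro a ha b hb _
      simp at ha hb
      rw [ha, hb]
    · intro a ha
      simp at ha
      exact ⟨w, by simp, ha.symm⟩
  · intro a ha b hb
    rw [hk, Finset.mem_singleton] at ha hb
    subst ha; subst hb
    simp

/-- Vertex map attached to a bijection of slots. -/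
noncomputable def vmap (β : {c // c ∈ slotSet G w} ≃ {c // c ∈ slotSet G' w'}) (u : V) : V' :=
  if h : u ∈ slotSet G w then (β ⟨u, h⟩).1 else w'

theorem vmap_eq (β : {c // c ∈ slotSet G w} ≃ {c // c ∈ slotSet G' w'}) {u : V}
    (h : u ∈ slotSet G w) : vmap β u = (β ⟨u, h⟩).1 := by simp [vmap, h]

theorem vmap_w (β : {c // c ∈ slotSet G w} ≃ {c // c ∈ slotSet G' w'}) : vmap β w = w' := by
  have : w ∉ slotSet G w := by simp [mem_slotSet]
  simp [vmap, this]

theorem vmap_mem (β : {c // c ∈ slotSet G w} ≃ {c // c ∈ slotSet G' w'}) {u : V}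
    (h : u ∈ slotSet G w) : vmap β u ∈ slotSet G' w' := by
  rw [vmap_eq β h]; exact (β ⟨u, h⟩).2

theorem vmap_ne (β : {c // c ∈ slotSet G w} ≃ {c // c ∈ slotSet G' w'}) {u t : V}
    (h : u ∈ slotSet G w) (ht : t ∈ slotSet G w) (hut : u ≠ t) : vmap β u ≠ vmap β t := by
  rw [vmap_eq β h, vmap_eq β ht]
  intro e
  exact hut (congrArg Subtype.val (β.injective (Subtype.ext e)))

theorem vstar (hN : Net G leaf) (hN' : Net G' leaf')
    (h₀ : IsSide G S₀ w v) (h₀' : IsSide G' S₀' w' v')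
    (D : SameData G leaf S₀ w G' leaf' S₀' w')
    {S : {c // c ∈ slotSet G w} → Finset V} {d : {c // c ∈ slotSet G w} → V}
    (hs : Slots G leaf S₀ w {c // c ∈ slotSet G w} S d (fun σ => σ.1))
    {S' : {c // c ∈ slotSet G' w'} → Finset V'} {d' : {c // c ∈ slotSet G' w'} → V'}
    (hs' : Slots G' leaf' S₀' w' {c // c ∈ slotSet G' w'} S' d' (fun σ => σ.1))
    (β : {c // c ∈ slotSet G w} ≃ {c // c ∈ slotSet G' w'})
    (hβ : ∀ x σ, leaf x ∈ S σ ↔ leaf' x ∈ S' (β σ)) {u t : V} (hu : u ∈ slotSet G w)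
    (ht : t ∈ slotSet G w) (hut : u ≠ t) :
    gf G (cls G w) u t * gf G' (cls G' w') w' (vmap β u) * gf G' (cls G' w') w' (vmap β t) =
    gf G' (cls G' w') (vmap β u) (vmap β t) * gf G (cls G w) w u * gf G (cls G w) w t := by
  have := star hN hN' h₀ h₀' hs hs' D β hβ (σ := ⟨u, hu⟩) (τ := ⟨t, ht⟩)
    (fun e => hut (congrArg Subtype.val e))
  rw [vmap_eq β hu, vmap_eq β ht]
  exact this

theorem cyc_case (hN : Net G leaf) (hN' : Net G' leaf')
    (h₀ : IsSide G S₀ w v) (h₀' : IsSide G' S₀' w' v')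
    (D : SameData G leaf S₀ w G' leaf' S₀' w')
    (ih : ∀ S d c S' d' c', S.card < S₀.card → IsSide G S d c → IsSide G' S' d' c' →
      SameData G leaf S d G' leaf' S' d' → SIso G leaf G' leaf' S S' d d')
    (k : KCyc G leaf S₀ w) (k' : KCyc G' leaf' S₀' w') :
    SIso G leaf G' leaf' S₀ S₀' w w' := by
  obtain ⟨⟨S, d, hs⟩, n, z, hz, h0⟩ := k
  obtain ⟨⟨S', d', hs'⟩, n', z', hz', h0'⟩ := k'
  have hV := cycV hz h0
  have hV' := cycV hz' h0'
  obtain ⟨β, hβ⟩ := exists_match hN hN' hs hs' D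
    (fun x y => 2 * Pv G leaf x y = hv G leaf S₀ w x * hv G leaf S₀ w y)
    (fun x y => 2 * Pv G' leaf' x y = hv G' leaf' S₀' w' x * hv G' leaf' S₀' w' y)
    (fun x y hx hy => by rw [D.Pv, D.hv hx, D.hv hy])
    (fun x y σ τ hxy hx hy => ⟨by
      rintro e rfl
      have h1 := cyc_same hN h₀ hV hs x y σ hxy hx hy
      have h2 := hv_mul_pos hN h₀ ((hs.part _).sub hx) ((hs.part _).sub hy)
      linarith, fun hst => cyc_diff h₀ hV hs x y σ τ hst hx hy⟩)
    (fun x y σ τ hxy hx hy => ⟨by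
      rintro e rfl
      have h1 := cyc_same hN' h₀' hV' hs' x y σ hxy hx hy
      have h2 := hv_mul_pos hN' h₀' ((hs'.part _).sub hx) ((hs'.part _).sub hy)
      linarith, fun hst => cyc_diff h₀' hV' hs' x y σ τ hst hx hy⟩)
  have hsl : ∀ u ∈ cls G w, u ≠ z 0 → u ∈ slotSet G w := by
    intro u hu hne
    rw [mem_slotSet]
    obtain ⟨a, rfl⟩ := hz.cover u hu
    exact ⟨hu, by rwa [← h0], hz.dK a⟩
  obtain ⟨φ, hφ, hφ0, hφc⟩ := cyc_rigid hz hz' (β := vmap β)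
    (fun u hu hne => by
      have := vmap_mem β (hsl u hu hne)
      rw [mem_slotSet] at this
      exact ⟨this.1, by rw [h0']; exact this.2.1⟩)
    (fun u hu hne t ht hnt hut => vmap_ne β (hsl u hu hne) (hsl t ht hnt) hut)
    (fun u hu hne t ht hnt hut => by
      rw [h0, h0']
      exact vstar hN hN' h₀ h₀' D hs hs' β hβ (hsl u hu hne) (hsl t ht hnt) hut)
  refine finish hN h₀ h₀' hs hs' D ih β hβ hφ (by rw [← h0, hφ0, h0']) fun σ => ?_
  have hσ := mem_slotSet.1 σ.2
  rw [hφc _ hσ.1 (by rw [h0]; exact hσ.2.1), vmap_eq β σ.2]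

theorem f_val_aux {f g f' g' : ℤ} (hf : f = 3 ∨ f = 4) (hf' : f' = 3 ∨ f' = 4)
    (e : f * g = f' * g') (hg : ¬ (3 : ℤ) ∣ g) : f = 4 → f' = 4 := by
  intro h
  rcases hf' with h' | h'
  · subst h; subst h'
    exfalso; omega
  · exact h'

theorem f_val (hN : Net G leaf)
    (h₀ : IsSide G S₀ w v) (h₀' : IsSide G' S₀' w' v')
    (D : SameData G leaf S₀ w G' leaf' S₀' w') (hV : ThV G w) (hV' : ThV G' w')
    {S : {c // c ∈ slotSet G w} → Finset V} {d : {c // c ∈ slotSet G w} → V}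
    (hs : Slots G leaf S₀ w {c // c ∈ slotSet G w} S d (fun σ => σ.1))
    {S' : {c // c ∈ slotSet G' w'} → Finset V'} {d' : {c // c ∈ slotSet G' w'} → V'}
    (hs' : Slots G' leaf' S₀' w' {c // c ∈ slotSet G' w'} S' d' (fun σ => σ.1))
    (β : {c // c ∈ slotSet G w} ≃ {c // c ∈ slotSet G' w'})
    (hβ : ∀ x σ, leaf x ∈ S σ ↔ leaf' x ∈ S' (β σ)) (σ : {c // c ∈ slotSet G w}) :
    (gf G (cls G w) w σ.1).eval 1 = 4 → (gf G' (cls G' w') w' (β σ).1).eval 1 = 4 := by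
  obtain ⟨x, hx, h3⟩ := hs.ex hN σ
  have e := D.hv ((hs.part _).sub hx)
  rw [hv, hv, hs.h_val h₀ hx, hs'.h_val h₀' ((hβ x σ).1 hx)] at e
  exact f_val_aux (hV.f _ σ.2) (hV'.f _ (β σ).2) e h3

theorem theta_case (hN : Net G leaf) (hN' : Net G' leaf')
    (h₀ : IsSide G S₀ w v) (h₀' : IsSide G' S₀' w' v')
    (D : SameData G leaf S₀ w G' leaf' S₀' w')
    (ih : ∀ S d c S' d' c', S.card < S₀.card → IsSide G S d c → IsSide G' S' d' c' →
      SameData G leaf S d G' leaf' S' d' → SIso G leaf G' leaf' S S' d d')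
    (k : KTheta G leaf S₀ w) (k' : KTheta G' leaf' S₀' w') :
    SIso G leaf G' leaf' S₀ S₀' w w' := by
  obtain ⟨⟨S, d, hs⟩, P, Q, l, z, p, hz, hp, hp1, h0⟩ := k
  obtain ⟨⟨S', d', hs'⟩, P', Q', l', z', p', hz', hp', hp1', h0'⟩ := k'
  have hV := thV hz hp hp1 h0
  have hV' := thV hz' hp' hp1' h0'
  obtain ⟨β, hβ⟩ := exists_match hN hN' hs hs' D
    (fun x y => 3 * (hv G leaf S₀ w x * hv G leaf S₀ w y) ≤ 16 * Pv G leaf x y)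
    (fun x y => 3 * (hv G' leaf' S₀' w' x * hv G' leaf' S₀' w' y) ≤ 16 * Pv G' leaf' x y)
    (fun x y hx hy => by rw [D.Pv, D.hv hx, D.hv hy])
    (fun x y σ τ hxy hx hy => ⟨by
      rintro e rfl
      have h1 := th_same hN h₀ hV hs x y σ hxy hx hy
      have h2 := hv_mul_pos hN h₀ ((hs.part _).sub hx) ((hs.part _).sub hy)
      linarith, fun hst => (th_diff hN h₀ hV hs x y σ τ hst hx hy).2⟩)
    (fun x y σ τ hxy hx hy => ⟨by
      rintro e rfl
      have h1 := th_same hN' h₀' hV' hs' x y σ hxy hx hy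
      have h2 := hv_mul_pos hN' h₀' ((hs'.part _).sub hx) ((hs'.part _).sub hy)
      linarith, fun hst => (th_diff hN' h₀' hV' hs' x y σ τ hst hx hy).2⟩)
  have hsl : ∀ u ∈ cls G w, dK G (cls G w) u = 2 → u ≠ w → u ∈ slotSet G w := by
    intro u hu h2 hne
    rw [mem_slotSet]
    exact ⟨hu, hne, h2⟩
  have hw2 : dK G (cls G w) w = 2 := by
    have := hz.dKint hp hp1
    rwa [h0] at this
  have hw2' : dK G' (cls G' w') w' = 2 := by
    have := hz'.dKint hp' hp1'
    rwa [h0'] at this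
  have hf : ∀ u (hu : u ∈ slotSet G w),
      (gf G (cls G w) w u).eval 1 = (gf G' (cls G' w') w' (vmap β u)).eval 1 := by
    intro u hu
    rw [vmap_eq β hu]
    have a1 := f_val hN h₀ h₀' D hV hV' hs hs' β hβ ⟨u, hu⟩
    have a2 := f_val hN' h₀' h₀ D.symm hV' hV hs' hs β.symm
      (fun x σ => by rw [hβ x (β.symm σ), β.apply_symm_apply]) (β ⟨u, hu⟩)
    rw [β.symm_apply_apply] at a2
    rcases hV.f u hu with e | e
    · rcases hV'.f _ (β ⟨u, hu⟩).2 with e' | e'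
      · rw [e, e']
      · rw [e', a2 e']
    · rw [e, a1 e]
  have hF : ∀ u (hu : u ∈ slotSet G w) t (ht : t ∈ slotSet G w), u ≠ t →
      (gf G (cls G w) u t).eval 1 = (gf G' (cls G' w') (vmap β u) (vmap β t)).eval 1 := by
    intro u hu t ht hut
    have e := congrArg (eval 1) (vstar hN hN' h₀ h₀' D hs hs' β hβ hu ht hut)
    simp only [eval_mul] at e
    rw [← hf u hu, ← hf t ht, mul_assoc, mul_assoc] at e
    refine mul_right_cancel₀ ?_ e
    rcases hV.f u hu with e1 | e1 <;> rcases hV.f t ht with e2 | e2 <;> rw [e1, e2] <;> norm_num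
  obtain ⟨φ, hφ, hφc⟩ := theta_rigid hz hz' hp hp1 hp' hp1' (β := vmap β)
    (fun u hu h2 => by
      by_cases hne : u = w
      · rw [hne, vmap_w]; exact ⟨self_mem_cls w', hw2'⟩
      · have := mem_slotSet.1 (vmap_mem β (hsl u hu h2 hne))
        exact ⟨this.1, this.2.2⟩)
    (by rw [h0, h0', vmap_w])
    (fun u hu h2 t ht h2' hut => by
      by_cases hne : u = w
      · by_cases hnt : t = w
        · exact absurd (hne.trans hnt.symm) hut
        · rw [hne, vmap_w]
          exact (mem_slotSet.1 (vmap_mem β (hsl t ht h2' hnt))).2.1.symm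
      · by_cases hnt : t = w
        · rw [hnt, vmap_w]
          exact (mem_slotSet.1 (vmap_mem β (hsl u hu h2 hne))).2.1
        · exact vmap_ne β (hsl u hu h2 hne) (hsl t ht h2' hnt) hut)
    (fun u hu h2 => by
      by_cases hne : u = w'
      · exact ⟨w, self_mem_cls w, hw2, by rw [hne, vmap_w]⟩
      · have hu' : u ∈ slotSet G' w' := mem_slotSet.2 ⟨hu, hne, h2⟩
        have h1 := (β.symm ⟨u, hu'⟩).2
        have h2 := mem_slotSet.1 h1
        refine ⟨(β.symm ⟨u, hu'⟩).1, h2.1, h2.2.2, ?_⟩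
        rw [vmap_eq β h1]
        simp)
    (fun u hu h2 t ht h2' hut => by
      by_cases hne : u = w
      · by_cases hnt : t = w
        · exact absurd (hne.trans hnt.symm) hut
        · rw [hne, vmap_w]
          exact hf t (hsl t ht h2' hnt)
      · by_cases hnt : t = w
        · rw [hnt, vmap_w, gf_symm G, gf_symm G']
          exact hf u (hsl u hu h2 hne)
        · exact hF u (hsl u hu h2 hne) t (hsl t ht h2' hnt) hut)
    (fun u hu h2 hne t ht h2' hnt hut => by
      rw [h0] at hne hnt
      rw [h0, h0']
      exact vstar hN hN' h₀ h₀' D hs hs' β hβ (hsl u hu h2 hne) (hsl t ht h2' hnt) hut)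
  refine finish hN h₀ h₀' hs hs' D ih β hβ hφ
    (by rw [hφc w (self_mem_cls w) hw2, vmap_w]) fun σ => ?_
  have hσ := mem_slotSet.1 σ.2
  rw [hφc _ hσ.1 hσ.2.2, vmap_eq β σ.2]

/-- Sides with the same data are isomorphic. -/
theorem main_claim (hN : Net G leaf) (hN' : Net G' leaf') : ∀ (m : ℕ) (S₀ : Finset V) (w v : V)
    (S₀' : Finset V') (w' v' : V'), S₀.card = m → IsSide G S₀ w v → IsSide G' S₀' w' v' →
    SameData G leaf S₀ w G' leaf' S₀' w' → SIso G leaf G' leaf' S₀ S₀' w w' := by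
  intro m
  induction m using Nat.strong_induction_on with
  | _ m IH =>
  intro S₀ w v S₀' w' v' hm h₀ h₀' D
  have ih : ∀ S d c S' d' c', S.card < S₀.card → IsSide G S d c → IsSide G' S' d' c' →
      SameData G leaf S d G' leaf' S' d' → SIso G leaf G' leaf' S S' d d' :=
    fun S d c S' d' c' hlt h1 h2 h3 => IH S.card (hm ▸ hlt) S d c S' d' c' rfl h1 h2 h3
  rcases kinds hN h₀ with k | k | k | k <;> rcases kinds hN' h₀' with k' | k' | k' | k'
  · exact leaf_case hN' hN D k k'
  · exact (no_leaf_node hN hN' h₀' D k k').elim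
  · exact (no_leaf_cyc hN hN' h₀' D k k').elim
  · exact (no_leaf_theta hN' h₀' D k k').elim
  · exact (no_leaf_node hN' hN h₀ D.symm k' k).elim
  · exact node_case hN hN' h₀ h₀' D ih k k'
  · exact (no_node_cyc hN hN' h₀ h₀' D k k').elim
  · exact (no_node_theta hN hN' h₀ h₀' D k k').elim
  · exact (no_leaf_cyc hN' hN h₀ D.symm k' k).elim
  · exact (no_node_cyc hN' hN h₀' h₀ D.symm k' k).elim
  · exact cyc_case hN hN' h₀ h₀' D ih k k'
  · exact (no_cyc_theta hN hN' h₀ h₀' D k k').elim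
  · exact (no_leaf_theta hN h₀ D.symm k' k).elim
  · exact (no_node_theta hN' hN h₀' h₀ D.symm k' k).elim
  · exact (no_cyc_theta hN' hN h₀' h₀ D.symm k' k).elim
  · exact theta_case hN hN' h₀ h₀' D ih k k'
end Main2
end L2R

namespace L2R
set_option linter.unusedSectionVars false
open Polynomial
open scoped Classical

section Fin1
variable {V : Type} [Fintype V] {G : SimpleGraph V} {Λ : Type} {leaf : Λ → V}
  {V' : Type} [Fintype V'] {G' : SimpleGraph V'} {leaf' : Λ → V'}

theorem exists_leaf (hN : Net G leaf) (w : V) : Nonempty Λ := by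
  by_cases hb : ∃ c ∈ cls G w, ∃ d, d ∉ cls G w ∧ G.Adj c d
  · obtain ⟨c, hc, d, hd, h⟩ := hb
    obtain ⟨S, hS⟩ := part_of_edge hc hd h
    obtain ⟨x, -⟩ := (good hN hS.side).ex
    exact ⟨x⟩
  · push Not at hb
    have hu := hN.conn (cls G w) ⟨w, self_mem_cls w⟩ (fun x hx y hy => hb x hx y hy)
    by_contra hne
    have h3 : ∀ u, dK G (cls G w) u = 3 := by
      intro u
      rw [hu]
      exact hN.deg3 u (by rintro ⟨x, -⟩; exact hne ⟨x⟩)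
    have hc : 2 ≤ (cls G w).card := by
      have h1 := h3 w
      have h2 : dK G (cls G w) w ≤ (cls G w).card := Finset.card_filter_le _ _
      omega
    rcases hN.lev w hc with h | ⟨P, Q, hP, hQ, hPQ, -, -, h⟩
    · have := h w (self_mem_cls w)
      rw [h3] at this
      omega
    · have hsub : (cls G w).filter (G.Adj P) ⊆ {Q} := by
        intro u hu'
        rw [Finset.mem_filter] at hu'
        rw [Finset.mem_singleton]
        by_contra hne'
        have := h u hu'.1 hu'.2.ne' hne'
        rw [h3] at this
        omega
      have h1 := Finset.card_le_card hsub
      have h2 := h3 P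
      rw [dK] at h2
      simp only [Finset.card_singleton] at h1
      omega

theorem leaf_nbr (hN : Net G leaf) (r : Λ) : ∃ w, ∀ u, G.Adj (leaf r) u ↔ u = w := by
  obtain ⟨w, hw⟩ := Finset.card_eq_one.1 (hN.deg1 r)
  refine ⟨w, fun u => ?_⟩
  have := Finset.ext_iff.1 hw u
  simpa using this

theorem leaf_side {r : Λ} {w : V} (hw : ∀ u, G.Adj (leaf r) u ↔ u = w) :
    IsSide G (Finset.univ.erase (leaf r)) w (leaf r) where
  din := by
    have := (hw w).2 rfl
    simp [this.ne']
  cout := by simp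
  adj := ((hw w).2 rfl).symm
  only := by
    intro x hx y hy h
    have : y = leaf r := by simpa using hy
    subst this
    exact ⟨(hw x).1 h.symm, rfl⟩

theorem other_leaf (hN : Net G leaf) (r : Λ) : ∃ x, x ≠ r := by
  obtain ⟨w, hw⟩ := leaf_nbr hN r
  obtain ⟨x, hx, -⟩ := (good hN (leaf_side hw)).ex
  refine ⟨x, ?_⟩
  rintro rfl
  simp at hx

theorem root_h {r : Λ} {w : V} (hw : ∀ u, G.Adj (leaf r) u ↔ u = w) {y : V} (hy : y ≠ leaf r) :
    gf G Finset.univ (leaf r) y = X * gf G (Finset.univ.erase (leaf r)) w y := by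
  rw [gf_bridge (leaf_side hw) (T := Finset.univ) (x := leaf r) (by simp) (by simpa using hy),
    gf_self G (by simp), one_mul, Finset.univ_inter]

theorem net_iso (hN : Net G leaf) (hN' : Net G' leaf') (w₀ : V)
    (hP : ∀ x y, gf G Finset.univ (leaf x) (leaf y) = gf G' Finset.univ (leaf' x) (leaf' y)) :
    ∃ φ : G ≃g G', ∀ x, φ (leaf x) = leaf' x := by
  obtain ⟨r⟩ := exists_leaf hN w₀
  obtain ⟨w, hw⟩ := leaf_nbr hN r
  obtain ⟨w', hw'⟩ := leaf_nbr hN' r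
  have D : SameData G leaf (Finset.univ.erase (leaf r)) w G' leaf'
      (Finset.univ.erase (leaf' r)) w' := by
    refine ⟨fun x => ?_, fun x hx => ?_, hP⟩
    · simp [hN.inj.eq_iff, hN'.inj.eq_iff]
    · have h1 : x ≠ r := by rintro rfl; simp at hx
      have h2 := hP r x
      rw [root_h hw (fun e => h1 (hN.inj e)), root_h hw' (fun e => h1 (hN'.inj e))] at h2
      exact mul_left_cancel₀ X_ne_zero h2
  obtain ⟨φ, hφ, hφw, hφl⟩ := main_claim hN hN' _ _ _ _ _ _ _ rfl (leaf_side hw) (leaf_side hw') D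
  have hmem : ∀ u, u ≠ leaf r → φ u ≠ leaf' r := by
    intro u hu
    have := hφ.bij.mapsTo (show u ∈ ((Finset.univ.erase (leaf r) : Finset V) : Set V) by simp [hu])
    simpa using this
  have hwr : w ≠ leaf r := ((hw w).2 rfl).ne'
  have hinj : ∀ u t, u ≠ leaf r → t ≠ leaf r → φ u = φ t → u = t := fun u t hu ht e =>
    hφ.bij.injOn (by simp [hu]) (by simp [ht]) e
  let ψ : V → V' := fun u => if u = leaf r then leaf' r else φ u
  have ψr : ψ (leaf r) = leaf' r := by simp [ψ]
  have ψn : ∀ u, u ≠ leaf r → ψ u = φ u := fun u hu => by simp [ψ, hu]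
  have hbij : Function.Bijective ψ := by
    constructor
    · intro a b e
      by_cases ha : a = leaf r <;> by_cases hb : b = leaf r
      · rw [ha, hb]
      · rw [ha, ψr, ψn b hb] at e
        exact absurd e.symm (hmem b hb)
      · rw [hb, ψr, ψn a ha] at e
        exact absurd e (hmem a ha)
      · rw [ψn a ha, ψn b hb] at e
        exact hinj a b ha hb e
    · intro b
      by_cases hb : b = leaf' r
      · exact ⟨leaf r, by rw [ψr, hb]⟩
      · obtain ⟨a, ha, e⟩ := hφ.bij.surjOn
          (show b ∈ ((Finset.univ.erase (leaf' r) : Finset V') : Set V') by simp [hb])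
        have ha' : a ≠ leaf r := by simpa using ha
        exact ⟨a, by rw [ψn a ha', e]⟩
  have hroot : ∀ t, t ≠ leaf r → (G'.Adj (leaf' r) (φ t) ↔ G.Adj (leaf r) t) := by
    intro t ht
    rw [hw, hw', ← hφw]
    exact ⟨fun e => hinj t w ht hwr e, fun e => by rw [e]⟩
  have hadj : ∀ a b, G'.Adj (ψ a) (ψ b) ↔ G.Adj a b := by
    intro a b
    by_cases ha : a = leaf r <;> by_cases hb : b = leaf r
    · rw [ha, hb]; simp
    · rw [ha, ψr, ψn b hb]; exact hroot b hb
    · rw [hb, ψr, ψn a ha, G'.adj_comm, G.adj_comm]; exact hroot a ha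
    · rw [ψn a ha, ψn b hb]
      exact (hφ.adj a (by simp [ha]) b (by simp [hb])).symm
  refine ⟨⟨Equiv.ofBijective ψ hbij, fun {a b} => hadj a b⟩, fun x => ?_⟩
  change ψ (leaf x) = leaf' x
  by_cases hx : leaf x = leaf r
  · rw [hN.inj hx, ψr]
  · rw [ψn _ hx]
    exact hφl x (by simp [hx])

end Fin1

section Fin2
variable {Λ : Type} [Fintype Λ] [DecidableEq Λ]

theorem degOf_eq (N : LabGraph Λ) (v : N.V) :
    N.degOf v = (Finset.univ.filter (N.G.Adj v)).card := by
  rw [LabGraph.degOf, ← Set.ncard_coe_finset]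
  congr 1
  ext t
  simp

theorem net_of (N : LabGraph Λ) (hc : N.G.Connected) (hi : Function.Injective N.leaf)
    (h1 : ∀ x, N.degOf (N.leaf x) = 1) (h3 : ∀ v, v ∉ Set.range N.leaf → N.degOf v = 3)
    (hl : N.IsLevel 2) : Net N.G N.leaf where
  conn := cutConn_of_connected hc
  inj := hi
  deg1 := fun x => by rw [← degOf_eq, h1]
  deg3 := fun u hu => by rw [← degOf_eq, h3 u hu]
  lev := fun w hw => level_cases (cutConn_of_connected hc) (fun u => by
    rw [← degOf_eq]
    by_cases h : u ∈ Set.range N.leaf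
    · obtain ⟨x, rfl⟩ := h
      rw [h1]; omega
    · rw [h3 u h]) hl hw

theorem gf_dms (N : LabGraph Λ) (x y : Λ) :
    gf N.G Finset.univ (N.leaf x) (N.leaf y) = ((N.dms x y).map fun n => (X : ℤ[X]) ^ n).sum := by
  rw [gf_eq_sum_paths, LabGraph.dms]
  simp only [Finset.mem_univ, implies_true, Finset.filter_true, Multiset.map_map]
  rw [Finset.sum]
  congr! 

theorem final (N N' : LabGraph Λ) (hN : N.IsNetwork) (hN' : N'.IsNetwork)
    (hlev : N.IsLevel 2) (hlev' : N'.IsLevel 2)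
    (hd : ∀ x y, N.dms x y = N'.dms x y) : N.IsomLabelled N' := by
  obtain ⟨hc, hi, h⟩ := hN
  obtain ⟨hc', hi', h'⟩ := hN'
  have key : ∀ M : LabGraph Λ, Fintype.card Λ = 1 → Net M.G M.leaf → False := by
    intro M h1 hM
    obtain ⟨r, hr⟩ := Fintype.card_eq_one_iff.1 h1
    obtain ⟨x, hx⟩ := other_leaf hM r
    exact hx (hr x)
  obtain ⟨w₀⟩ := hc.nonempty
  rcases h with ⟨a, b⟩ | ⟨h1, h3⟩ <;> rcases h' with ⟨a', b'⟩ | ⟨h1', h3'⟩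
  · obtain ⟨v, hv⟩ := Fintype.card_eq_one_iff.1 b
    obtain ⟨v', hv'⟩ := Fintype.card_eq_one_iff.1 b'
    refine ⟨⟨⟨fun _ => v', fun _ => v, fun u => (hv u).symm, fun u => (hv' u).symm⟩, ?_⟩, ?_⟩
    · intro p q
      rw [hv p, hv q]
      simp
    · intro x
      exact (hv' _).symm
  · exact (key N' a (net_of N' hc' hi' h1' h3' hlev')).elim
  · exact (key N a' (net_of N hc hi h1 h3 hlev)).elim
  · exact net_iso (net_of N hc hi h1 h3 hlev) (net_of N' hc' hi' h1' h3' hlev') w₀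
      (fun x y => by rw [gf_dms, gf_dms, hd])
end Fin2
end L2R

namespace LabGraph

variable {X : Type} [Fintype X] [DecidableEq X]

/-- Theorem: Level-2 networks are reconstructible from their multisets of distances. -/
theorem level2_reconstructible_from_multisets
    (X : Type) [Fintype X] [DecidableEq X]
    (N N' : LabGraph X) (hN : N.IsNetwork) (hN' : N'.IsNetwork)
    (hlev : N.IsLevel 2) (hlev' : N'.IsLevel 2)
    (hd : ∀ x y : X, N.dms x y = N'.dms x y) :
    N.IsomLabelled N' := by
  exact L2R.final N N' hN hN' hlev hlev' hd

end LabGraph
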